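/- Let 1 ≤ l ≤ n−1 and i ∈ ℤ, and let J be the Jacobson radical of H_{mn}(ξ). Then P(l,i) is an indecomposable H_{mn}(ξ)-module which is both projective and injective; its socle is isomorphic to M(l,i), its top P(l,i)/J·P(l,i) is isomorphic to M(l,i), its Loewy length is 3 (J^2·P(l,i) ≠ 0 and J^3·P(l,i) = 0), and its composition length is 4, with J·P(l,i)/J^2·P(l,i) ≅ M(n−l, i+l−n) ⊕ M(n−l, i+l). In particular, P(l,i) is both a projective cover and an injective envelope of the simple module M(l,i). -/

import Mathlib

noncomputable section

namespace Radford

variable (𝕜 : Type) [Field 𝕜]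

/-- The q-integer `(k)_q = 1 + q + ⋯ + q^(k-1)`. -/
def qInt (q : 𝕜) (k : ℕ) : 𝕜 := ∑ j ∈ Finset.range k, q ^ j

/-- The q-factorial `(k)!_q = (1)_q (2)_q ⋯ (k)_q`. -/
def qFact (q : 𝕜) : ℕ → 𝕜
  | 0 => 1
  | k + 1 => qFact q k * qInt 𝕜 q (k + 1)

variable (m n : ℕ) (ξ : 𝕜)

/-- Generators of the free algebra: 0 ↦ a, 1 ↦ b, 2 ↦ c, 3 ↦ d. -/
def fgen (k : Fin 4) : FreeAlgebra 𝕜 (Fin 4) := FreeAlgebra.ι 𝕜 k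

local notation "fa" => fgen 𝕜 0
local notation "fb" => fgen 𝕜 1
local notation "fc" => fgen 𝕜 2
local notation "fd" => fgen 𝕜 3

/-- The defining relations of the Drinfeld double `H_{mn}(ξ) = D(R_{mn}(q))`, where `q = ξ^m`. -/
inductive HRel : FreeAlgebra 𝕜 (Fin 4) → FreeAlgebra 𝕜 (Fin 4) → Prop
  | aPow : HRel (fa ^ n) (fb ^ n - 1)
  | bPow : HRel (fb ^ (m * n)) 1
  | cPow : HRel (fc ^ (m * n)) 1
  | dPow : HRel (fd ^ n) 0
  | ab : HRel (fa * fb) (ξ ^ m • (fb * fa))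
  | dc : HRel (fd * fc) (ξ • (fc * fd))
  | bc : HRel (fb * fc) (fc * fb)
  | bd : HRel (fb * fd) (ξ ^ m • (fd * fb))
  | ad : HRel (fa * fd - fd * fa) (fb - fc ^ m)
  | ac : HRel (fa * fc)
      (ξ⁻¹ • (fc * fa) +
        ((ξ⁻¹ - ξ ^ (n - 1)) / qFact 𝕜 (ξ ^ m) (n - 1)) •
          ((fc ^ (m + 1) - ξ ^ m • (fb * fc)) * fd ^ (n - 1)))

/-- The Drinfeld double `H_{mn}(ξ)` of the Radford Hopf algebra `R_{mn}(q)`, presented by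
generators `a, b, c, d` and the above relations. -/
def H := RingQuot (HRel 𝕜 m n ξ)

instance : Ring (H 𝕜 m n ξ) := inferInstanceAs (Ring (RingQuot (HRel 𝕜 m n ξ)))

instance : Algebra 𝕜 (H 𝕜 m n ξ) := inferInstanceAs (Algebra 𝕜 (RingQuot (HRel 𝕜 m n ξ)))

/-- The generators `a, b, c, d` of `H_{mn}(ξ)` (indexed by 0,1,2,3). -/
def gen (k : Fin 4) : H 𝕜 m n ξ := RingQuot.mkAlgHom 𝕜 (HRel 𝕜 m n ξ) (fgen 𝕜 k)

local notation "ha" => gen 𝕜 m n ξ 0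
local notation "hb" => gen 𝕜 m n ξ 1
local notation "hc" => gen 𝕜 m n ξ 2
local notation "hd" => gen 𝕜 m n ξ 3

/-- The Jacobson radical `J` of `H_{mn}(ξ)`. -/
def jrad : Ideal (H 𝕜 m n ξ) := Ideal.jacobson ⊥

/-- The scalars `α_k(l,i)`;  `alph l i k` is `α_k(l,i)`, where `q = ξ^m`. -/
def alph (l : ℕ) (i : ℤ) (k : ℕ) : 𝕜 :=
  if k = n then ((ξ ^ m) ^ (i + (l : ℤ)) - (ξ ^ m) ^ i) / qFact 𝕜 (ξ ^ m) (n - 1)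
  else qInt 𝕜 (ξ ^ m) k * ((ξ ^ m) ^ i - (ξ ^ m) ^ (i + (l : ℤ) - (k : ℤ)))

/-- The scalars `γ_k(l,i)`;  `gam l i k` is `γ_k(l,i)`, where `q = ξ^m`. -/
def gam (l : ℕ) (i : ℤ) (k : ℕ) : 𝕜 :=
  if k = n then ((ξ ^ m) ^ i - (ξ ^ m) ^ (i + (l : ℤ))) / qFact 𝕜 (ξ ^ m) (n - 1)
  else qInt 𝕜 (ξ ^ m) k * ((ξ ^ m) ^ (i + (l : ℤ)) - (ξ ^ m) ^ (i - (k : ℤ)))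

section ModuleH

variable {W : Type} [AddCommGroup W] [Module (H 𝕜 m n ξ) W]

variable (W) in
/-- The socle of an `H`-module: the sum of all simple submodules. -/
def socle : Submodule (H 𝕜 m n ξ) W :=
  sSup {N : Submodule (H 𝕜 m n ξ) W | IsSimpleModule (H 𝕜 m n ξ) N}

variable (W) in
/-- The submodule `J•W`, the radical of `W`. -/
def radM : Submodule (H 𝕜 m n ξ) W :=
  Submodule.span (H 𝕜 m n ξ) {x | ∃ r ∈ jrad 𝕜 m n ξ, ∃ w : W, x = r • w}

variable (W) in
/-- The submodule `J²•W`. -/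
def rad2M : Submodule (H 𝕜 m n ξ) W :=
  Submodule.span (H 𝕜 m n ξ)
    {x | ∃ r ∈ jrad 𝕜 m n ξ, ∃ s ∈ jrad 𝕜 m n ξ, ∃ w : W, x = r • s • w}

variable (W) in
/-- The submodule `J³•W`. -/
def rad3M : Submodule (H 𝕜 m n ξ) W :=
  Submodule.span (H 𝕜 m n ξ)
    {x | ∃ r ∈ jrad 𝕜 m n ξ, ∃ s ∈ jrad 𝕜 m n ξ, ∃ t ∈ jrad 𝕜 m n ξ, ∃ w : W, x = r • s • t • w}

variable (W) in
/-- `lengthIs c W` : the `H`-module `W` has a composition series of length `c`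
(hence, by Jordan–Hölder, has composition length `c`). -/
def lengthIs (c : ℕ) : Prop :=
  ∃ s : CompositionSeries (Submodule (H 𝕜 m n ξ) W), s.head = ⊥ ∧ s.last = ⊤ ∧ s.length = c

variable (W) in
/-- An `H`-module is indecomposable if it is nonzero and is not the direct sum of two
nonzero submodules. -/
def Indec : Prop :=
  Nontrivial W ∧ ∀ N₁ N₂ : Submodule (H 𝕜 m n ξ) W, IsCompl N₁ N₂ → N₁ = ⊥ ∨ N₂ = ⊥

variable (W) in
/-- `W` has Loewy length 2: `J•W ≠ 0` and `J²•W = 0`. -/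
def LoewyLen2 : Prop := radM 𝕜 m n ξ W ≠ ⊥ ∧ rad2M 𝕜 m n ξ W = ⊥

variable (W) in
/-- `W` is of `(s,t)`-type: it has Loewy length `2`, its socle has composition length `t`,
and `W/soc W` has composition length `s`. -/
def IsType (s t : ℕ) : Prop :=
  LoewyLen2 𝕜 m n ξ W ∧ lengthIs 𝕜 m n ξ (socle 𝕜 m n ξ W) t ∧
    lengthIs 𝕜 m n ξ (W ⧸ socle 𝕜 m n ξ W) s

end ModuleH

section ModuleK

variable {V : Type} [AddCommGroup V] [Module 𝕜 V] [Module (H 𝕜 m n ξ) V]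
  [IsScalarTower 𝕜 (H 𝕜 m n ξ) V]

variable (V) in
/-- `V^d = {v ∈ V | d•v = 0}`, as a `𝕜`-subspace. -/
def dKer : Submodule 𝕜 V where
  carrier := {v | hd • v = 0}
  add_mem' := by
    intro x y hx hy
    simp only [Set.mem_setOf_eq] at *
    rw [smul_add, hx, hy, add_zero]
  zero_mem' := smul_zero _
  smul_mem' := by
    intro r v hv
    simp only [Set.mem_setOf_eq] at *
    rw [smul_comm, hv, smul_zero]

variable (V) in
/-- `V_{(i)} = {v ∈ V | c•v = ξ^i v}`, as a `𝕜`-subspace. -/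
def eigsp (i : ℤ) : Submodule 𝕜 V where
  carrier := {v | hc • v = ξ ^ i • v}
  add_mem' := by
    intro x y hx hy
    simp only [Set.mem_setOf_eq] at *
    rw [smul_add, hx, hy, smul_add]
  zero_mem' := by simp
  smul_mem' := by
    intro r v hv
    simp only [Set.mem_setOf_eq] at *
    rw [smul_comm, hv, smul_comm]

/-- `V`, equipped with the family `mv : Fin l → V`, realizes the simple module `M(l,i)`:
`mv` is a basis of `V` and the generators act by the defining formulas of `M(l,i)`. -/
def IsMrep (l : ℕ) (i : ℤ) (mv : Fin l → V) : Prop :=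
  LinearIndependent 𝕜 mv ∧ Submodule.span 𝕜 (Set.range mv) = ⊤ ∧
  (∀ (j : ℕ) (hj : j + 1 < l),
    ha • mv ⟨j, by omega⟩ = alph 𝕜 m n ξ l i (j + 1) • mv ⟨j + 1, hj⟩) ∧
  (∀ (j : ℕ) (hj : j < l), j + 1 = l → ha • mv ⟨j, hj⟩ = 0) ∧
  (∀ j : Fin l, hb • mv j = ((ξ ^ m) ^ (i + (l : ℤ) - ((j : ℕ) + 1 : ℤ)) : 𝕜) • mv j) ∧
  (∀ j : Fin l, hc • mv j = (ξ ^ (i + (j : ℕ) : ℤ) : 𝕜) • mv j) ∧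
  (∀ (j : ℕ) (hj : j + 1 < l), hd • mv ⟨j + 1, hj⟩ = mv ⟨j, by omega⟩) ∧
  (∀ hl : 0 < l, hd • mv ⟨0, hl⟩ = 0)

/-- `V` realizes the induced module `Z(λ_{ij})`: there is a cyclic vector `z` with
`d•z = 0`, `b•z = ξ^j z`, `c•z = ξ^i z` such that `(a^k • z)_{0 ≤ k ≤ n-1}` is a basis. -/
def IsZrep (i j : ℤ) (V : Type) [AddCommGroup V] [Module 𝕜 V] [Module (H 𝕜 m n ξ) V]
    [IsScalarTower 𝕜 (H 𝕜 m n ξ) V] : Prop :=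
  ∃ z : V, hd • z = 0 ∧ hb • z = (ξ ^ j : 𝕜) • z ∧ hc • z = (ξ ^ i : 𝕜) • z ∧
    LinearIndependent 𝕜 (fun k : Fin n => (ha ^ (k : ℕ)) • z) ∧
    Submodule.span 𝕜 (Set.range fun k : Fin n => (ha ^ (k : ℕ)) • z) = ⊤

/-- `V`, equipped with the families `v u : Fin n → V`, realizes the projective module `P(l,i)`
with its standard basis. -/
def IsPrep (l : ℕ) (hl1 : 1 ≤ l) (hl2 : l < n) (i : ℤ) (v u : Fin n → V) : Prop :=
  LinearIndependent 𝕜 (Sum.elim v u) ∧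
  Submodule.span 𝕜 (Set.range v ∪ Set.range u) = ⊤ ∧
  (∀ (j : ℕ) (hj : j + l + 2 ≤ n),
    ha • v ⟨j, by omega⟩ = gam 𝕜 m n ξ l i (j + 1) • v ⟨j + 1, by omega⟩) ∧
  (∀ (j : ℕ) (hj : j + 1 < n), n ≤ j + 1 + l →
    ha • v ⟨j, by omega⟩ =
      gam 𝕜 m n ξ l i (j + 1) • v ⟨j + 1, hj⟩ + u ⟨j + 1 + l - n, by omega⟩) ∧
  (ha • v ⟨n - 1, by omega⟩ = gam 𝕜 m n ξ l i n • v ⟨0, by omega⟩ + u ⟨l, by omega⟩) ∧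
  (∀ (j : ℕ) (hj : j + 1 < n),
    ha • u ⟨j, by omega⟩ = alph 𝕜 m n ξ l i (j + 1) • u ⟨j + 1, hj⟩) ∧
  (ha • u ⟨n - 1, by omega⟩ = alph 𝕜 m n ξ l i n • u ⟨0, by omega⟩) ∧
  (∀ j : Fin n, hb • v j = ((ξ ^ m) ^ (i + (n : ℤ) - ((j : ℕ) + 1 : ℤ)) : 𝕜) • v j) ∧
  (∀ j : Fin n, hb • u j = ((ξ ^ m) ^ (i + (l : ℤ) - ((j : ℕ) + 1 : ℤ)) : 𝕜) • u j) ∧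
  (∀ j : Fin n, hc • v j = (ξ ^ (i - ((n : ℤ) - (l : ℤ)) + (j : ℕ) : ℤ) : 𝕜) • v j) ∧
  (∀ j : Fin n, hc • u j = (ξ ^ (i + (j : ℕ) : ℤ) : 𝕜) • u j) ∧
  (hd • v ⟨0, by omega⟩ = 0) ∧
  (∀ (j : ℕ) (hj : j + 1 < n), hd • v ⟨j + 1, hj⟩ = v ⟨j, by omega⟩) ∧
  (hd • u ⟨0, by omega⟩ = 0) ∧
  (∀ (j : ℕ) (hj : j + 1 < n), hd • u ⟨j + 1, hj⟩ = u ⟨j, by omega⟩)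

/-- `V`, equipped with the basis `e : Fin n → V`, realizes the module `T_1(l,i)`. -/
def IsT1rep (l : ℕ) (hl1 : 1 ≤ l) (hl2 : l < n) (i : ℤ) (e : Fin n → V) : Prop :=
  LinearIndependent 𝕜 e ∧ Submodule.span 𝕜 (Set.range e) = ⊤ ∧
  (∀ (j : ℕ) (hj : j + 1 < n),
    ha • e ⟨j, by omega⟩ = alph 𝕜 m n ξ l i (j + 1) • e ⟨j + 1, hj⟩) ∧
  (ha • e ⟨n - 1, by omega⟩ = alph 𝕜 m n ξ l i n • e ⟨0, by omega⟩) ∧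
  (∀ j : Fin n, hb • e j = ((ξ ^ m) ^ (i + (l : ℤ) - ((j : ℕ) + 1 : ℤ)) : 𝕜) • e j) ∧
  (∀ j : Fin n, hc • e j = (ξ ^ (i + (j : ℕ) : ℤ) : 𝕜) • e j) ∧
  (hd • e ⟨0, by omega⟩ = 0) ∧
  (∀ (j : ℕ) (hj : j + 1 < n), hd • e ⟨j + 1, hj⟩ = e ⟨j, by omega⟩)

/-- `V`, equipped with the basis `e : Fin n → V`, realizes the module `T̄_1(l,i)`. -/
def IsT1barrep (l : ℕ) (hl1 : 1 ≤ l) (hl2 : l < n) (i : ℤ) (e : Fin n → V) : Prop :=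
  LinearIndependent 𝕜 e ∧ Submodule.span 𝕜 (Set.range e) = ⊤ ∧
  (∀ (j : ℕ) (hj : j + 1 < n - l),
    ha • e ⟨j, by omega⟩ = alph 𝕜 m n ξ (n - l) (i + l - n) (j + 1) • e ⟨j + 1, by omega⟩) ∧
  (ha • e ⟨n - l - 1, by omega⟩ = e ⟨n - l, by omega⟩) ∧
  (∀ (k : ℕ) (hk : k + 1 < l),
    ha • e ⟨n - l + k, by omega⟩ = alph 𝕜 m n ξ l i (k + 1) • e ⟨n - l + k + 1, by omega⟩) ∧
  (ha • e ⟨n - 1, by omega⟩ = 0) ∧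
  (∀ j : Fin n, hb • e j = ((ξ ^ m) ^ (i - ((j : ℕ) + 1 : ℤ)) : 𝕜) • e j) ∧
  (∀ j : Fin n, hc • e j = (ξ ^ (i + (l : ℤ) - (n : ℤ) + (j : ℕ) : ℤ) : 𝕜) • e j) ∧
  (hd • e ⟨0, by omega⟩ = 0) ∧
  (∀ (j : ℕ) (hj : j + 1 < n - l), hd • e ⟨j + 1, by omega⟩ = e ⟨j, by omega⟩) ∧
  (hd • e ⟨n - l, by omega⟩ = 0) ∧
  (∀ (k : ℕ) (hk : k + 1 < l), hd • e ⟨n - l + k + 1, by omega⟩ = e ⟨n - l + k, by omega⟩)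

end ModuleK

section Matrices

/-- The nilpotent Jordan-type matrix `D_s` with `1` on the superdiagonal. -/
def Dmat (s : ℕ) : Matrix (Fin s) (Fin s) 𝕜 :=
  fun r c => if (r : ℕ) + 1 = (c : ℕ) then 1 else 0

/-- The matrix `X_{l,i}` : subdiagonal entries `γ_k(l,i)`, `(1,n)`-entry `γ_n(l,i)`. -/
def Xmat (l : ℕ) (i : ℤ) : Matrix (Fin n) (Fin n) 𝕜 := fun r c =>
  if (r : ℕ) = (c : ℕ) + 1 then gam 𝕜 m n ξ l i ((c : ℕ) + 1)
  else if (r : ℕ) = 0 ∧ (c : ℕ) = n - 1 then gam 𝕜 m n ξ l i n else 0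

/-- The matrix `Z_{l,i}` : subdiagonal entries `α_k(l,i)`, `(1,n)`-entry `α_n(l,i)`. -/
def Zmat (l : ℕ) (i : ℤ) : Matrix (Fin n) (Fin n) 𝕜 := fun r c =>
  if (r : ℕ) = (c : ℕ) + 1 then alph 𝕜 m n ξ l i ((c : ℕ) + 1)
  else if (r : ℕ) = 0 ∧ (c : ℕ) = n - 1 then alph 𝕜 m n ξ l i n else 0

/-- The block matrix `A(l,i) = [[X_{l,i}, 0], [D_n^{n-l-1}, Z_{l,i}]]`. -/
def Amat (l : ℕ) (i : ℤ) : Matrix (Fin n ⊕ Fin n) (Fin n ⊕ Fin n) 𝕜 :=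
  Matrix.fromBlocks (Xmat 𝕜 m n ξ l i) 0 (Dmat 𝕜 n ^ (n - l - 1)) (Zmat 𝕜 m n ξ l i)

/-- The diagonal matrix `B(l,i)`. -/
def Bmat (l : ℕ) (i : ℤ) : Matrix (Fin n ⊕ Fin n) (Fin n ⊕ Fin n) 𝕜 :=
  Matrix.fromBlocks
    (Matrix.diagonal fun j : Fin n => (ξ ^ m) ^ (i - ((j : ℕ) + 1 : ℤ))) 0 0
    (Matrix.diagonal fun j : Fin n => (ξ ^ m) ^ (i + (l : ℤ) - ((j : ℕ) + 1 : ℤ)))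

/-- The diagonal matrix `C(l,i)`. -/
def Cmat (l : ℕ) (i : ℤ) : Matrix (Fin n ⊕ Fin n) (Fin n ⊕ Fin n) 𝕜 :=
  Matrix.fromBlocks
    (Matrix.diagonal fun j : Fin n => ξ ^ (i + (l : ℤ) - (n : ℤ) + (j : ℕ))) 0 0
    (Matrix.diagonal fun j : Fin n => ξ ^ (i + (j : ℕ) : ℤ))

/-- The block matrix `D = diag(D_n, D_n)`. -/
def Dbig : Matrix (Fin n ⊕ Fin n) (Fin n ⊕ Fin n) 𝕜 :=
  Matrix.fromBlocks (Dmat 𝕜 n) 0 0 (Dmat 𝕜 n)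

end Matrices
section Operators

variable {𝕜 m n ξ}
variable {V : Type*} [AddCommGroup V] [Module 𝕜 V]

/-- Operators satisfying the defining relations of `H_{mn}(ζ)`, where the correction term in
the commutation of `A` and `C` has arbitrary coefficients `s` and `t`. -/
structure Rels (m n : ℕ) (ζ s t : 𝕜) (A B C D : Module.End 𝕜 V) : Prop where
  aPow : A ^ n = B ^ n - 1
  bPow : B ^ (m * n) = 1
  cPow : C ^ (m * n) = 1
  dPow : D ^ n = 0
  ab : A * B = ζ ^ m • (B * A)
  dc : D * C = ζ • (C * D)
  bc : B * C = C * B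
  bd : B * D = ζ ^ m • (D * B)
  ad : A * D - D * A = B - C ^ m
  ac : A * C = ζ⁻¹ • (C * A) + C * ((s • C ^ m + t • B) * D ^ (n - 1))

/-- The Casimir operator. -/
def casimir (m : ℕ) (ζ : 𝕜) (A B C D : Module.End 𝕜 V) : Module.End 𝕜 V :=
  (ζ ^ m - 1) • (D * A) - B - ζ ^ m • C ^ m

theorem mul_pow_of_smul_comm {R : Type*} [Ring R] [Algebra 𝕜 R] {x y : R} {c : 𝕜}
    (h : x * y = c • (y * x)) (k : ℕ) : x * y ^ k = c ^ k • (y ^ k * x) := by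
  induction k with
  | zero => simp
  | succ k ih =>
    rw [pow_succ, ← mul_assoc, ih, smul_mul_assoc, mul_assoc, h, mul_smul_comm, smul_smul,
      ← pow_succ, ← mul_assoc]

theorem pow_mul_of_smul_comm {R : Type*} [Ring R] [Algebra 𝕜 R] {x y : R} {c : 𝕜}
    (h : x * y = c • (y * x)) (k : ℕ) : x ^ k * y = c ^ k • (y * x ^ k) := by
  induction k with
  | zero => simp
  | succ k ih =>
    rw [pow_succ, mul_assoc, h, mul_smul_comm, ← mul_assoc, ih, smul_mul_assoc, smul_smul,
      ← pow_succ', ← mul_assoc]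

namespace Rels

variable {ζ s t : 𝕜} {A B C D : Module.End 𝕜 V}

theorem a_cPow (h : Rels m n ζ s t A B C D) (hm : 1 < m) (hn : 1 < n)
    (hζ : IsPrimitiveRoot ζ (m * n)) : ζ ^ m • (A * C ^ m) = C ^ m * A := by
  have h0 : ζ ≠ 0 := hζ.ne_zero (by positivity)
  have hz : 1 - ζ ^ n ≠ 0 := by
    rw [sub_ne_zero]
    exact fun e => hζ.pow_ne_one_of_pos_of_lt (by omega) (by nlinarith) e.symm
  set Y := (s • C ^ m + t • B) * D ^ (n - 1) with hY
  have hYC : Y * C = ζ ^ (n - 1) • (C * Y) := by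
    rw [hY, mul_assoc, pow_mul_of_smul_comm h.dc, mul_smul_comm, ← mul_assoc, ← mul_assoc]
    congr 2
    rw [add_mul, mul_add, smul_mul_assoc, smul_mul_assoc, mul_smul_comm, mul_smul_comm, h.bc,
      ← pow_succ, ← pow_succ']
  obtain ⟨x, hx⟩ : ∃ x : 𝕜, 1 + x * ζ ^ (n - 1) = ζ⁻¹ * x := by
    refine ⟨ζ / (1 - ζ ^ n), ?_⟩
    obtain ⟨n, rfl⟩ : ∃ k, n = k + 1 := ⟨n - 1, by omega⟩
    rw [Nat.add_sub_cancel]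
    field_simp
    ring
  have hA : (A + x • Y) * C = ζ⁻¹ • (C * (A + x • Y)) := by
    rw [add_mul, h.ac, ← hY, smul_mul_assoc, hYC, mul_add, mul_smul_comm, smul_add, smul_smul,
      smul_smul, ← hx, add_smul, one_smul, add_assoc]
  have e1 := mul_pow_of_smul_comm hA m
  have e2 := mul_pow_of_smul_comm hYC m
  have e3 : (ζ ^ (n - 1)) ^ m = (ζ ^ m)⁻¹ := by
    apply eq_inv_of_mul_eq_one_left
    rw [← pow_mul, ← pow_add, ← hζ.pow_eq_one]
    congr 1
    obtain ⟨n, rfl⟩ : ∃ k, n = k + 1 := ⟨n - 1, by omega⟩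
    rw [Nat.add_sub_cancel]
    ring
  rw [e3] at e2
  rw [add_mul, mul_add, smul_mul_assoc, e2, mul_smul_comm, inv_pow, smul_add,
    smul_comm x, add_left_inj] at e1
  rw [e1, smul_inv_smul₀ (pow_ne_zero _ h0)]

theorem d_cPow (h : Rels m n ζ s t A B C D) : D * C ^ m = ζ ^ m • (C ^ m * D) :=
  mul_pow_of_smul_comm h.dc m

theorem bcPow (h : Rels m n ζ s t A B C D) : B * C ^ m = C ^ m * B :=
  (show Commute B C from h.bc).pow_right m

theorem q_smul_da (_ : Rels m n ζ s t A B C D) :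
    (ζ ^ m - 1) • (D * A) = casimir m ζ A B C D + B + ζ ^ m • C ^ m := by
  rw [casimir]; abel

theorem q_smul_ad (h : Rels m n ζ s t A B C D) :
    (ζ ^ m - 1) • (A * D) = casimir m ζ A B C D + ζ ^ m • B + C ^ m := by
  rw [casimir]
  linear_combination (norm := module) (ζ ^ m - 1) • h.ad

theorem casimir_a (h : Rels m n ζ s t A B C D) (hm : 1 < m) (hn : 1 < n)
    (hζ : IsPrimitiveRoot ζ (m * n)) : Commute (casimir m ζ A B C D) A := by
  have e1 := h.a_cPow hm hn hζ
  have e2 := congrArg (· * A) h.ad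
  simp only [sub_mul, mul_assoc] at e2
  rw [Commute, SemiconjBy, casimir]
  simp only [sub_mul, mul_sub, smul_mul_assoc, mul_smul_comm, mul_assoc]
  linear_combination (norm := module) h.ab + e1 - (ζ ^ m - 1) • e2

theorem casimir_d (h : Rels m n ζ s t A B C D) : Commute (casimir m ζ A B C D) D := by
  have e1 := h.d_cPow
  have e2 := congrArg (D * ·) h.ad
  simp only [mul_sub] at e2
  rw [Commute, SemiconjBy, casimir]
  simp only [sub_mul, mul_sub, smul_mul_assoc, mul_smul_comm, mul_assoc]
  linear_combination (norm := module) (ζ ^ m - 1) • e2 - h.bd + e1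

theorem casimir_b (h : Rels m n ζ s t A B C D) : Commute (casimir m ζ A B C D) B := by
  have e1 := h.bcPow
  have e2 := congrArg (D * ·) h.ab
  have e3 := congrArg (· * A) h.bd
  simp only [smul_mul_assoc, mul_smul_comm, mul_assoc] at e2 e3
  rw [Commute, SemiconjBy, casimir]
  simp only [sub_mul, mul_sub, smul_mul_assoc, mul_smul_comm, mul_assoc]
  linear_combination (norm := module) (ζ ^ m - 1) • (e2 - e3) + ζ ^ m • e1

theorem casimir_cPow (h : Rels m n ζ s t A B C D) (hm : 1 < m) (hn : 1 < n)
    (hζ : IsPrimitiveRoot ζ (m * n)) : Commute (casimir m ζ A B C D) (C ^ m) := by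
  have e1 := h.bcPow
  have e2 := congrArg (D * ·) (h.a_cPow hm hn hζ)
  have e3 := congrArg (· * A) h.d_cPow
  have h0 : ζ ^ m ≠ 0 := pow_ne_zero _ (hζ.ne_zero (by positivity))
  simp only [smul_mul_assoc, mul_smul_comm, mul_assoc] at e2 e3
  have e4 : D * (A * C ^ m) = C ^ m * (D * A) := smul_right_injective _ h0 (e2.trans e3)
  rw [Commute, SemiconjBy, casimir]
  simp only [sub_mul, mul_sub, smul_mul_assoc, mul_smul_comm, mul_assoc]
  linear_combination (norm := module) (ζ ^ m - 1) • e4 - e1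
end Rels

/-- `x` is a weight vector for `B` and `C ^ m`, in position `r` of the `l`-string of `β`. -/
def IsWt (q β : 𝕜) (m : ℕ) (l : ℤ) (B C : Module.End 𝕜 V) (r : ℤ) (x : V) : Prop :=
  B x = (β * q ^ (-r)) • x ∧ (C ^ m) x = (β * q ^ (l - 1 + r)) • x

/-- The value of the Casimir operator attached to position `r`. -/
def kap (q β : 𝕜) (l r : ℤ) : 𝕜 := -(β * (q ^ (-r) + q ^ (l + r)))

theorem kap_eq_iff {q β : 𝕜} (hq : IsPrimitiveRoot q n) (hn : n ≠ 0) (hβ : β ≠ 0) (l r : ℤ) :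
    kap q β l r = kap q β l 0 ↔ (n : ℤ) ∣ r ∨ (n : ℤ) ∣ l + r := by
  have h0 : q ≠ 0 := hq.ne_zero hn
  have key : kap q β l r - kap q β l 0 = β * ((q ^ (-r) - 1) * (q ^ (l + r) - 1)) := by
    have : q ^ l = q ^ (-r) * q ^ (l + r) := by rw [← zpow_add₀ h0]; congr 1; ring
    simp only [kap, neg_zero, zpow_zero, add_zero]
    linear_combination β * this
  rw [← sub_eq_zero, key, mul_eq_zero, mul_eq_zero, sub_eq_zero, sub_eq_zero,
    hq.zpow_eq_one_iff_dvd, hq.zpow_eq_one_iff_dvd, dvd_neg]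
  simp [hβ]

section Poly

open Polynomial

theorem aeval_apply_of_eigen {K : Module.End 𝕜 V} {κ : 𝕜} {x : V} (hx : K x = κ • x)
    (p : 𝕜[X]) : aeval K p x = p.eval κ • x := by
  by_cases h : x = 0
  · simp [h]
  · exact Module.End.aeval_apply_of_hasEigenvector ⟨Module.End.mem_eigenspace_iff.2 hx, h⟩

theorem aeval_prod_erase {ι : Type*} [DecidableEq ι] {K : Module.End 𝕜 V} {κ : 𝕜} {x : V}
    (hx : K (K x - κ • x) = κ • (K x - κ • x)) (S : Finset ι) (f : ι → 𝕜) {j : ι} (hj : j ∈ S)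
    (hf : f j = κ) :
    aeval K (∏ r ∈ S, (X - Polynomial.C (f r))) x =
      (∏ r ∈ S.erase j, (κ - f r)) • (K x - κ • x) := by
  rw [← Finset.prod_erase_mul S _ hj, map_mul, Module.End.mul_apply, hf]
  have : aeval K (X - Polynomial.C κ) x = K x - κ • x := by
    simp [Module.algebraMap_end_apply]
  rw [this, aeval_apply_of_eigen hx, eval_prod]
  simp

theorem commute_aeval {K T : Module.End 𝕜 V} (h : Commute K T) (p : 𝕜[X]) :
    Commute (aeval K p) T :=
  Polynomial.induction_on p (fun a => by rw [aeval_C]; exact Algebra.commutes a T)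
    (fun p q hp hq => by simpa using hp.add_left hq)
    (fun k a _ => by
      rw [map_mul, aeval_C, map_pow, aeval_X]
      exact Commute.mul_left (Algebra.commutes a T) (h.pow_left _))

end Poly

namespace Rels

open Polynomial

variable {ζ s t : 𝕜} {A B C D : Module.End 𝕜 V}

local notation "q" => ζ ^ m
local notation "K" => casimir m ζ A B C D

theorem isWt_a (h : Rels m n ζ s t A B C D) (hm : 1 < m) (hn : 1 < n)
    (hζ : IsPrimitiveRoot ζ (m * n)) {β : 𝕜} {l r : ℤ} {x : V}
    (hx : IsWt q β m l B C r x) : IsWt q β m l B C (r + 1) (A x) := by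
  have h0 : q ≠ 0 := pow_ne_zero _ (hζ.ne_zero (by positivity))
  constructor
  · have := congrArg (· x) h.ab
    simp only [Module.End.mul_apply, LinearMap.smul_apply, hx.1, map_smul] at this
    apply smul_right_injective _ h0
    simp only
    rw [← this, smul_smul]
    congr 1
    rw [neg_add, zpow_add₀ h0]
    field_simp
  · have := congrArg (· x) (h.a_cPow hm hn hζ)
    simp only [Module.End.mul_apply, LinearMap.smul_apply, hx.2, map_smul] at this
    rw [← this, smul_smul]
    congr 1
    rw [← add_assoc, zpow_add_one₀ h0 (l - 1 + r)]
    ring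

theorem isWt_d (h : Rels m n ζ s t A B C D) (h0 : q ≠ 0) {β : 𝕜} {l r : ℤ} {x : V}
    (hx : IsWt q β m l B C r x) : IsWt q β m l B C (r - 1) (D x) := by
  constructor
  · have := congrArg (· x) h.bd
    simp only [Module.End.mul_apply, LinearMap.smul_apply, hx.1, map_smul] at this
    rw [this, smul_smul]
    congr 1
    rw [neg_sub, sub_eq_neg_add, zpow_add_one₀ h0]
    ring
  · have := congrArg (· x) h.d_cPow
    simp only [Module.End.mul_apply, LinearMap.smul_apply, hx.2, map_smul] at this
    apply smul_right_injective _ h0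
    simp only
    rw [← this, smul_smul]
    congr 1
    rw [← add_sub_assoc, zpow_sub_one₀ h0 (l - 1 + r)]
    field_simp

theorem isWt_aPow (h : Rels m n ζ s t A B C D) (hm : 1 < m) (hn : 1 < n)
    (hζ : IsPrimitiveRoot ζ (m * n)) {β : 𝕜} {l r : ℤ} {x : V}
    (hx : IsWt q β m l B C r x) (k : ℕ) : IsWt q β m l B C (r + k) ((A ^ k) x) := by
  induction k with
  | zero => simpa using hx
  | succ k ih =>
    rw [pow_succ', Module.End.mul_apply, Nat.cast_succ, ← add_assoc]
    exact h.isWt_a hm hn hζ ih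

theorem isWt_dPow (h : Rels m n ζ s t A B C D) (h0 : q ≠ 0) {β : 𝕜} {l r : ℤ} {x : V}
    (hx : IsWt q β m l B C r x) (k : ℕ) : IsWt q β m l B C (r - k) ((D ^ k) x) := by
  induction k with
  | zero => simpa using hx
  | succ k ih =>
    rw [pow_succ', Module.End.mul_apply, Nat.cast_succ, ← sub_sub]
    exact h.isWt_d h0 ih

theorem isWt_casimir (h : Rels m n ζ s t A B C D) (hm : 1 < m) (hn : 1 < n)
    (hζ : IsPrimitiveRoot ζ (m * n)) {β : 𝕜} {l r : ℤ} {x : V}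
    (hx : IsWt q β m l B C r x) : IsWt q β m l B C r (K x) := by
  constructor
  · rw [← Module.End.mul_apply, ← h.casimir_b.eq, Module.End.mul_apply, hx.1, map_smul]
  · rw [← Module.End.mul_apply, ← (h.casimir_cPow hm hn hζ).eq, Module.End.mul_apply, hx.2,
      map_smul]

theorem _root_.Radford.IsWt.sub_smul {q' β : 𝕜} {l r : ℤ} {x y : V}
    (hx : IsWt q' β m l B C r x) (hy : IsWt q' β m l B C r y) (c : 𝕜) :
    IsWt q' β m l B C r (x - c • y) := by
  constructor
  · rw [map_sub, map_smul, hx.1, hy.1]; module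
  · rw [map_sub, map_smul, hx.2, hy.2]; module

theorem smul_da_apply (h : Rels m n ζ s t A B C D) (h0 : q ≠ 0) {β : 𝕜} {l r : ℤ} {x : V}
    (hx : IsWt q β m l B C r x) :
    (q - 1) • D (A x) = K x - kap q β l r • x := by
  have := congrArg (· x) h.q_smul_da
  simp only [Module.End.mul_apply, LinearMap.smul_apply, LinearMap.add_apply, hx.1, hx.2] at this
  rw [this, kap]
  have e : q ^ (l + r) = q ^ (l - 1 + r) * q := by rw [← zpow_add_one₀ h0]; congr 1; ring
  rw [e]
  module

theorem smul_ad_apply (h : Rels m n ζ s t A B C D) (h0 : q ≠ 0) {β : 𝕜} {l r : ℤ} {x : V}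
    (hx : IsWt q β m l B C r x) :
    (q - 1) • A (D x) = K x - kap q β l (r - 1) • x := by
  have := congrArg (· x) h.q_smul_ad
  simp only [Module.End.mul_apply, LinearMap.smul_apply, LinearMap.add_apply, hx.1, hx.2] at this
  rw [this, kap]
  have e : q ^ (-(r - 1)) = q ^ (-r) * q := by rw [← zpow_add_one₀ h0]; congr 1; ring
  have e' : l + (r - 1) = l - 1 + r := by ring
  rw [e, e']
  module

theorem smul_dPow_aPow_apply (h : Rels m n ζ s t A B C D) (hm : 1 < m) (hn : 1 < n)
    (hζ : IsPrimitiveRoot ζ (m * n)) {β : 𝕜} {l r : ℤ} {x : V}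
    (hx : IsWt q β m l B C r x) (k : ℕ) :
    (q - 1) ^ k • (D ^ k) ((A ^ k) x) =
      aeval K (∏ j ∈ Finset.range k, (X - Polynomial.C (kap q β l (r + j)))) x := by
  have h0 : q ≠ 0 := pow_ne_zero _ (hζ.ne_zero (by positivity))
  induction k generalizing x with
  | zero => simp
  | succ k ih =>
    have hy := (h.isWt_casimir hm hn hζ hx).sub_smul hx (kap q β l (r + k))
    have e : (q - 1) • D (A ((A ^ k) x)) = (A ^ k) (K x - kap q β l (r + k) • x) := by
      rw [h.smul_da_apply h0 (h.isWt_aPow hm hn hζ hx k), map_sub, map_smul,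
        ← Module.End.mul_apply, ← Module.End.mul_apply,
        ((h.casimir_a hm hn hζ).pow_right k).eq]
    rw [pow_succ D, pow_succ' A, Module.End.mul_apply, Module.End.mul_apply, pow_succ, mul_smul,
      ← map_smul, e, ih hy, Finset.prod_range_succ, map_mul, Module.End.mul_apply]
    simp [Module.algebraMap_end_apply]

theorem smul_aPow_dPow_apply (h : Rels m n ζ s t A B C D) (hm : 1 < m) (hn : 1 < n)
    (hζ : IsPrimitiveRoot ζ (m * n)) {β : 𝕜} {l r : ℤ} {x : V}
    (hx : IsWt q β m l B C r x) (k : ℕ) :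
    (q - 1) ^ k • (A ^ k) ((D ^ k) x) =
      aeval K (∏ j ∈ Finset.range k, (X - Polynomial.C (kap q β l (r - j - 1)))) x := by
  have h0 : q ≠ 0 := pow_ne_zero _ (hζ.ne_zero (by positivity))
  induction k generalizing x with
  | zero => simp
  | succ k ih =>
    have hy := (h.isWt_casimir hm hn hζ hx).sub_smul hx (kap q β l (r - k - 1))
    have e : (q - 1) • A (D ((D ^ k) x)) = (D ^ k) (K x - kap q β l (r - k - 1) • x) := by
      rw [h.smul_ad_apply h0 (h.isWt_dPow h0 hx k), map_sub, map_smul,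
        ← Module.End.mul_apply, ← Module.End.mul_apply, (h.casimir_d.pow_right k).eq]
    rw [pow_succ A, pow_succ' D, Module.End.mul_apply, Module.End.mul_apply, pow_succ, mul_smul,
      ← map_smul, e, ih hy, Finset.prod_range_succ, map_mul, Module.End.mul_apply]
    simp [Module.algebraMap_end_apply]
theorem bPow_apply_isWt (_ : Rels m n ζ s t A B C D) (hq : IsPrimitiveRoot q n) {β : 𝕜}
    (hβ : β ^ n = 1) {l r : ℤ} {x : V} (hx : IsWt q β m l B C r x) : (B ^ n) x = x := by
  have : ∀ k : ℕ, (B ^ k) x = (β * q ^ (-r)) ^ k • x := fun k => by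
    induction k with
    | zero => simp
    | succ k ih => rw [pow_succ, Module.End.mul_apply, hx.1, map_smul, ih, smul_smul, ← pow_succ']
  have e : (q ^ (-r)) ^ n = 1 := by
    rw [← zpow_natCast (q ^ (-r)), ← zpow_mul, mul_comm, zpow_mul, zpow_natCast,
      hq.pow_eq_one, one_zpow]
  rw [this, mul_pow, hβ, e, one_mul, one_smul]

theorem aPow_apply_isWt (h : Rels m n ζ s t A B C D) (hq : IsPrimitiveRoot q n) {β : 𝕜}
    (hβ : β ^ n = 1) {l r : ℤ} {x : V} (hx : IsWt q β m l B C r x) : (A ^ n) x = 0 := by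
  rw [h.aPow, LinearMap.sub_apply, h.bPow_apply_isWt hq hβ hx, Module.End.one_apply, sub_self]

theorem isPrimitiveRoot_q (hm : 1 < m) (hn : 1 < n) (hζ : IsPrimitiveRoot ζ (m * n)) :
    IsPrimitiveRoot q n := hζ.pow (by positivity) rfl

theorem dPow_casimir_sub (h : Rels m n ζ s t A B C D) (hm : 1 < m) (hn : 1 < n)
    (hζ : IsPrimitiveRoot ζ (m * n)) {β : 𝕜} (hβ : β ≠ 0) {l : ℕ} (hl1 : 1 ≤ l) (hl2 : l < n)
    {x : V} (hx : IsWt q β m l B C 0 x)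
    (hK : K (K x - kap q β l 0 • x) = kap q β l 0 • (K x - kap q β l 0 • x)) :
    (D ^ l) (K x - kap q β l 0 • x) = 0 := by
  have hq := isPrimitiveRoot_q hm hn hζ
  have e := congrArg (D ^ l) (h.smul_dPow_aPow_apply hm hn hζ hx (n - l))
  rw [map_smul, ← Module.End.mul_apply, ← pow_add, Nat.add_sub_cancel' hl2.le, h.dPow,
    LinearMap.zero_apply, smul_zero, aeval_prod_erase hK (Finset.range (n - l))
      (fun j : ℕ => kap q β l (0 + j)) (Finset.mem_range.2 (Nat.sub_pos_of_lt hl2)) (by simp),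
    map_smul, eq_comm, smul_eq_zero] at e
  refine e.resolve_left (Finset.prod_ne_zero_iff.2 fun j hj => ?_)
  rw [Finset.mem_erase, Finset.mem_range] at hj
  rw [sub_ne_zero, ne_comm, Ne, zero_add, kap_eq_iff hq (by omega) hβ]
  rintro (h1 | h1)
  · have := Int.le_of_dvd (by omega) h1
    omega
  · have := Int.le_of_dvd (by omega) h1
    omega

theorem a_casimir_sub (h : Rels m n ζ s t A B C D) (hm : 1 < m) (hn : 1 < n)
    (hζ : IsPrimitiveRoot ζ (m * n)) {β : 𝕜} (hβ : β ^ n = 1) {l : ℕ} (hl1 : 1 ≤ l) (hl2 : l < n)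
    {x : V} (hx : IsWt q β m l B C 0 x)
    (hK : K (K x - kap q β l 0 • x) = kap q β l 0 • (K x - kap q β l 0 • x)) :
    A (K x - kap q β l 0 • x) = 0 := by
  have hq := isPrimitiveRoot_q hm hn hζ
  have h0 : q ≠ 0 := pow_ne_zero _ (hζ.ne_zero (by positivity))
  have hβ0 : β ≠ 0 := by
    rintro rfl
    simp [show n ≠ 0 by omega] at hβ
  have e := congrArg A (h.smul_aPow_dPow_apply hm hn hζ hx (n - 1))
  have hj : kap q β l (0 - (l - 1 : ℕ) - 1) = kap q β l 0 := by
    rw [kap_eq_iff hq (by omega) hβ0]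
    right
    push_cast [hl1]
    simp
  rw [map_smul, ← Module.End.mul_apply, ← pow_succ', Nat.sub_add_cancel hn.le,
    h.aPow_apply_isWt hq hβ (h.isWt_dPow h0 hx _), smul_zero,
    aeval_prod_erase hK (Finset.range (n - 1))
      (fun j : ℕ => kap q β l (0 - j - 1)) (Finset.mem_range.2 (by omega : l - 1 < n - 1)) hj,
    map_smul, eq_comm, smul_eq_zero] at e
  refine e.resolve_left (Finset.prod_ne_zero_iff.2 fun j hj => ?_)
  rw [Finset.mem_erase, Finset.mem_range] at hj
  rw [sub_ne_zero, ne_comm, Ne, kap_eq_iff hq (by omega) hβ0]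
  rintro (⟨c, h1⟩ | ⟨c, h1⟩)
  · obtain rfl | h2 | h2 : c = 0 ∨ 1 ≤ c ∨ c ≤ -1 := by omega
    · omega
    · nlinarith
    · nlinarith [show (j : ℤ) + 1 < n by omega]
  · obtain rfl | h2 | h2 : c = 0 ∨ 1 ≤ c ∨ c ≤ -1 := by omega
    · omega
    · nlinarith
    · nlinarith [show (j : ℤ) + 1 < n by omega]

theorem aPow_eq_zero (h : Rels m n ζ s t A B C D) (hm : 1 < m) (hn : 1 < n)
    (hζ : IsPrimitiveRoot ζ (m * n)) {β : 𝕜} (hβ : β ^ n = 1) {l : ℕ} (hl1 : 1 ≤ l) (hl2 : l < n)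
    {x : V} (hx : IsWt q β m l B C 0 x)
    (hK : K (K x - kap q β l 0 • x) = kap q β l 0 • (K x - kap q β l 0 • x)) :
    (A ^ (n - l + 1)) x = 0 := by
  have hq := isPrimitiveRoot_q hm hn hζ
  have hβ0 : β ≠ 0 := by
    rintro rfl
    simp [show n ≠ 0 by omega] at hβ
  set y := (A ^ (n - l + 1)) x with hy
  have hKy : K y = kap q β l 0 • y := by
    rw [← sub_eq_zero, hy, ← Module.End.mul_apply,
      ((h.casimir_a hm hn hζ).pow_right (n - l + 1)).eq, Module.End.mul_apply, ← map_smul,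
      ← map_sub, pow_succ, Module.End.mul_apply, h.a_casimir_sub hm hn hζ hβ hl1 hl2 hx hK,
      map_zero]
  have hwt : IsWt q β m l B C (n - l + 1 : ℕ) y := by
    simpa using h.isWt_aPow hm hn hζ hx (n - l + 1)
  have e := h.smul_dPow_aPow_apply hm hn hζ hwt (l - 1)
  rw [hy, ← Module.End.mul_apply (A ^ (l - 1)), ← pow_add,
    show l - 1 + (n - l + 1) = n by omega, h.aPow_apply_isWt hq hβ hx, map_zero, smul_zero, ← hy,
    aeval_apply_of_eigen hKy, eq_comm, smul_eq_zero] at e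
  refine e.resolve_left ?_
  rw [eval_prod]
  refine Finset.prod_ne_zero_iff.2 fun j hj => ?_
  rw [Finset.mem_range] at hj
  have hcast : ((n - l + 1 : ℕ) : ℤ) = n - l + 1 := by omega
  have hj' : (j : ℤ) + 2 ≤ l := by omega
  rw [eval_sub, eval_X, eval_C, sub_ne_zero, ne_comm, Ne, kap_eq_iff hq (by omega) hβ0, hcast]
  rintro (⟨c, h1⟩ | ⟨c, h1⟩)
  · obtain h2 | h2 : 1 ≤ c ∨ c ≤ 0 := by omega
    · nlinarith
    · nlinarith
  · obtain h2 | h2 : 2 ≤ c ∨ c ≤ 1 := by omega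
    · nlinarith
    · nlinarith
theorem casimir_c (h : Rels m n ζ s t A B C D) (hn : 1 < n) (hζ0 : ζ ≠ 0) : Commute K C := by
  have h0 : q ≠ 0 := pow_ne_zero _ hζ0
  have e1 : D * (A * C) = C * (D * A) := by
    rw [h.ac, mul_add, mul_smul_comm, ← mul_assoc D C A, h.dc, smul_mul_assoc, smul_smul,
      inv_mul_cancel₀ hζ0, one_smul, mul_assoc C D A, ← mul_assoc D C, h.dc, smul_mul_assoc,
      mul_assoc C D, ← mul_assoc D]
    have : D * (s • C ^ m + t • B) = ((q * s) • C ^ m + (q⁻¹ * t) • B) * D := by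
      rw [mul_add, mul_smul_comm, mul_smul_comm, h.d_cPow, add_mul, smul_mul_assoc,
        smul_mul_assoc, h.bd, smul_smul, smul_smul, mul_right_comm, inv_mul_cancel₀ h0, one_mul,
        mul_comm s]
    rw [this, mul_assoc _ D, ← pow_succ', Nat.sub_add_cancel hn.le, h.dPow]
    simp
  rw [Commute, SemiconjBy, casimir]
  simp only [sub_mul, mul_sub, smul_mul_assoc, mul_smul_comm, mul_assoc]
  rw [e1, h.bc, ← pow_succ, ← pow_succ']

theorem exists_invariant_of_isWt (h : Rels m n ζ s t A B C D) (hm : 1 < m) (hn : 1 < n)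
    (hζ : IsPrimitiveRoot ζ (m * n)) {β χ : 𝕜} (hβ : β ^ n = 1) {l : ℕ} (hl1 : 1 ≤ l)
    (hl2 : l < n) {w : V} (hw : IsWt q β m l B C 0 w) (hχ : C w = χ • w)
    (hK : K (K w - kap q β l 0 • w) = kap q β l 0 • (K w - kap q β l 0 • w)) :
    ∃ S : Submodule 𝕜 V, FiniteDimensional 𝕜 S ∧ Module.finrank 𝕜 S ≤ 2 * n ∧ w ∈ S ∧
      (∀ x ∈ S, A x ∈ S) ∧ (∀ x ∈ S, B x ∈ S) ∧ (∀ x ∈ S, C x ∈ S) ∧ (∀ x ∈ S, D x ∈ S) := by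
  have hq := isPrimitiveRoot_q hm hn hζ
  have hζ0 : ζ ≠ 0 := hζ.ne_zero (by positivity)
  have h0 : q ≠ 0 := pow_ne_zero _ hζ0
  have hq1 : q - 1 ≠ 0 := sub_ne_zero.2 (hq.ne_one hn)
  have hβ0 : β ≠ 0 := by
    rintro rfl
    simp [show n ≠ 0 by omega] at hβ
  have hDl := h.dPow_casimir_sub hm hn hζ hβ0 hl1 hl2 hw hK
  have hAw := h.a_casimir_sub hm hn hζ hβ hl1 hl2 hw hK
  have hAn := h.aPow_eq_zero hm hn hζ hβ hl1 hl2 hw hK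
  have hw1 : IsWt q β m l B C 0 (K w - kap q β l 0 • w) :=
    (h.isWt_casimir hm hn hζ hw).sub_smul hw _
  set w1 := K w - kap q β l 0 • w with hw1d
  have hKw : K w = kap q β l 0 • w + w1 := by rw [hw1d]; abel
  have hχ1 : C w1 = χ • w1 := by
    rw [hw1d, map_sub, map_smul, ← Module.End.mul_apply, ← (h.casimir_c hn hζ0).eq, Module.End.mul_apply, hχ,
      map_smul]
    module
  clear_value w1
  let f : Fin n ⊕ Fin l ⊕ Fin (n - l) → V := Sum.elim (fun k => (D ^ (k : ℕ)) w)
    (Sum.elim (fun k => (D ^ (k : ℕ)) w1) (fun k => (A ^ (k + 1 : ℕ)) w))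
  let S := Submodule.span 𝕜 (Set.range f)
  have hS1 : ∀ k, (D ^ k) w ∈ S := fun k => by
    by_cases hk : k < n
    · exact Submodule.subset_span ⟨.inl ⟨k, hk⟩, rfl⟩
    · rw [pow_eq_zero_of_le (not_lt.1 hk) h.dPow]
      exact S.zero_mem
  have hS2 : ∀ k, (D ^ k) w1 ∈ S := fun k => by
    by_cases hk : k < l
    · exact Submodule.subset_span ⟨.inr (.inl ⟨k, hk⟩), rfl⟩
    · obtain ⟨j, rfl⟩ := Nat.exists_eq_add_of_le (not_lt.1 hk)
      rw [add_comm, pow_add, Module.End.mul_apply, hDl, map_zero]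
      exact S.zero_mem
  have hA0 : ∀ k, n - l < k → (A ^ k) w = 0 := fun k hk => by
    obtain ⟨j, rfl⟩ := Nat.exists_eq_add_of_le (Nat.succ_le_of_lt hk)
    rw [add_comm, pow_add, Module.End.mul_apply, hAn, map_zero]
  have hS3 : ∀ k, (A ^ k) w ∈ S := fun k => by
    obtain _ | k := k
    · simpa using hS1 0
    by_cases hk : k < n - l
    · exact Submodule.subset_span ⟨.inr (.inr ⟨k, hk⟩), rfl⟩
    · rw [hA0 _ (by omega)]
      exact S.zero_mem
  have hind : ∀ T : Module.End 𝕜 V, (∀ k, T ((D ^ k) w) ∈ S) → (∀ k, T ((D ^ k) w1) ∈ S) →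
      (∀ k, T ((A ^ (k + 1)) w) ∈ S) → ∀ x ∈ S, T x ∈ S := fun T h1 h2 h3 x hx => by
    refine (Submodule.span_le (p := S.comap T)).2 ?_ hx
    rintro _ ⟨k | k | k, rfl⟩
    exacts [h1 k, h2 k, h3 k]
  have hKA : ∀ k, K ((A ^ k) w) = kap q β l 0 • (A ^ k) w + (A ^ k) w1 := fun k => by
    rw [← Module.End.mul_apply, ((h.casimir_a hm hn hζ).pow_right k).eq, Module.End.mul_apply,
      hKw, map_add, map_smul]
  have hKD : ∀ k, K ((D ^ k) w) = kap q β l 0 • (D ^ k) w + (D ^ k) w1 := fun k => by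
    rw [← Module.End.mul_apply, (h.casimir_d.pow_right k).eq, Module.End.mul_apply,
      hKw, map_add, map_smul]
  have hKD1 : ∀ k, K ((D ^ k) w1) = kap q β l 0 • (D ^ k) w1 := fun k => by
    rw [← Module.End.mul_apply, (h.casimir_d.pow_right k).eq, Module.End.mul_apply, hK, map_smul]
  have hAw1 : ∀ k, (A ^ (k + 1)) w1 = 0 := fun k => by
    rw [pow_succ, Module.End.mul_apply, hAw, map_zero]
  have hDA : ∀ k : ℕ, D ((A ^ (k + 1)) w) =
      (q - 1)⁻¹ • (kap q β l 0 • (A ^ k) w + (A ^ k) w1 - kap q β l (0 + k) • (A ^ k) w) :=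
    fun k => by
      rw [pow_succ', Module.End.mul_apply, ← hKA,
        ← h.smul_da_apply h0 (h.isWt_aPow hm hn hζ hw k), inv_smul_smul₀ hq1]
  have hCD : ∀ k (c : 𝕜) (x : V), C x = c • x → C ((D ^ k) x) = (c * (ζ ^ k)⁻¹) • (D ^ k) x :=
    fun k c x hx => by
      have := congrArg (· x) (pow_mul_of_smul_comm h.dc k)
      simp only [Module.End.mul_apply, LinearMap.smul_apply, hx, map_smul] at this
      rw [mul_comm, mul_smul, this, inv_smul_smul₀ (pow_ne_zero _ hζ0)]
  have hA : ∀ x ∈ S, A x ∈ S := by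
    refine hind A (fun k => ?_) (fun k => ?_) (fun k => ?_)
    · obtain _ | k := k
      · simpa using hS3 1
      rw [pow_succ', Module.End.mul_apply, ← inv_smul_smul₀ hq1 (A _),
        h.smul_ad_apply h0 (h.isWt_dPow h0 hw k), hKD]
      exact S.smul_mem _ (S.sub_mem (S.add_mem (S.smul_mem _ (hS1 k)) (hS2 k))
        (S.smul_mem _ (hS1 k)))
    · obtain _ | k := k
      · simp [hAw]
      rw [pow_succ', Module.End.mul_apply, ← inv_smul_smul₀ hq1 (A _),
        h.smul_ad_apply h0 (h.isWt_dPow h0 hw1 k), hKD1]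
      exact S.smul_mem _ (S.sub_mem (S.smul_mem _ (hS2 k)) (S.smul_mem _ (hS2 k)))
    · rw [← Module.End.mul_apply, ← pow_succ']
      exact hS3 _
  have hDApow : ∀ j k, j ≤ k → ∃ c e : 𝕜, ∃ i : ℕ,
      (D ^ k) ((A ^ j) w) = c • (D ^ i) w + e • (D ^ i) w1 := by
    intro j
    induction j with
    | zero => exact fun k _ => ⟨1, 0, k, by simp⟩
    | succ j ih =>
      intro k hk
      obtain ⟨k, rfl⟩ : ∃ k', k = k' + 1 := ⟨k - 1, by omega⟩
      rw [pow_succ, Module.End.mul_apply, hDA]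
      obtain ⟨c, e, i, hi⟩ := ih k (by omega)
      obtain _ | j := j
      · refine ⟨(q - 1)⁻¹ * (kap q β l 0 - kap q β l (0 + (0 : ℕ))), (q - 1)⁻¹, k, ?_⟩
        simp only [pow_zero, Module.End.one_apply, map_smul, map_sub, map_add]
        module
      · refine ⟨(q - 1)⁻¹ * (kap q β l 0 - kap q β l (0 + (j + 1 : ℕ))) * c,
          (q - 1)⁻¹ * (kap q β l 0 - kap q β l (0 + (j + 1 : ℕ))) * e, i, ?_⟩
        simp only [hAw1, add_zero, map_smul, map_sub, hi]
        module
  have hBD : ∀ k, B ((D ^ k) w) ∈ S := fun k => by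
    rw [(h.isWt_dPow h0 hw k).1]
    exact S.smul_mem _ (hS1 k)
  have hBD1 : ∀ k, B ((D ^ k) w1) ∈ S := fun k => by
    rw [(h.isWt_dPow h0 hw1 k).1]
    exact S.smul_mem _ (hS2 k)
  have hB : ∀ x ∈ S, B x ∈ S := by
    refine hind B hBD hBD1 (fun k => ?_)
    rw [(h.isWt_aPow hm hn hζ hw _).1]
    exact S.smul_mem _ (hS3 _)
  have hCA : ∀ k, C ((A ^ k) w) ∈ S := fun k => by
    induction k with
    | zero => simpa [hχ] using S.smul_mem χ (hS1 0)
    | succ k ih =>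
      by_cases hk : n - l < k + 1
      · rw [hA0 _ hk, map_zero]
        exact S.zero_mem
      have e := congrArg (· ((A ^ k) w)) h.ac
      obtain ⟨c, e', i, hi⟩ := hDApow k (n - 1) (by omega)
      have hx1 := h.isWt_dPow h0 hw i
      have hx2 := h.isWt_dPow h0 hw1 i
      have hY : C (((s • C ^ m + t • B) * D ^ (n - 1)) ((A ^ k) w)) ∈ S := by
        rw [Module.End.mul_apply, hi]
        simp only [map_add, map_smul, LinearMap.add_apply, LinearMap.smul_apply, hx1.1, hx1.2,
          hx2.1, hx2.2, hCD i _ _ hχ, hCD i _ _ hχ1]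
        refine S.add_mem (S.smul_mem _ (S.add_mem ?_ ?_)) (S.smul_mem _ (S.add_mem ?_ ?_))
        all_goals exact S.smul_mem _ (S.smul_mem _ (S.smul_mem _ (by first | exact hS1 i | exact hS2 i)))
      simp only [LinearMap.add_apply, LinearMap.smul_apply, Module.End.mul_apply (f := A),
        Module.End.mul_apply (f := C)] at e
      have e2 : C ((A ^ (k + 1)) w) = ζ • (A (C ((A ^ k) w)) -
          C (((s • C ^ m + t • B) * D ^ (n - 1)) ((A ^ k) w))) := by
        rw [e, add_sub_cancel_right, smul_inv_smul₀ hζ0, pow_succ', Module.End.mul_apply]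
      rw [e2]
      exact S.smul_mem _ (S.sub_mem (hA _ ih) hY)
  refine ⟨S, FiniteDimensional.span_of_finite 𝕜 (Set.finite_range f), ?_, by simpa using hS1 0, hA, hB, ?_, ?_⟩
  · refine (finrank_range_le_card (R := 𝕜) f).trans ?_
    simp only [Fintype.card_sum, Fintype.card_fin]
    omega
  · refine hind C (fun k => ?_) (fun k => ?_) (fun k => hCA _)
    · rw [hCD k _ _ hχ]
      exact S.smul_mem _ (hS1 k)
    · rw [hCD k _ _ hχ1]
      exact S.smul_mem _ (hS2 k)
  · refine hind D (fun k => ?_) (fun k => ?_) (fun k => ?_)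
    · rw [← Module.End.mul_apply, ← pow_succ']
      exact hS1 _
    · rw [← Module.End.mul_apply, ← pow_succ']
      exact hS2 _
    · rw [hDA]
      refine S.smul_mem _ (S.sub_mem (S.add_mem (S.smul_mem _ (hS3 k)) ?_) (S.smul_mem _ (hS3 k)))
      obtain _ | k := k
      · simpa using hS2 0
      · rw [hAw1]
        exact S.zero_mem

end Rels

end Operators

section Lifting

open Polynomial

variable {𝕜 m n}
variable {V V' : Type*} [AddCommGroup V] [Module 𝕜 V] [AddCommGroup V'] [Module 𝕜 V']

theorem map_aeval_apply {T : Module.End 𝕜 V} {T' : Module.End 𝕜 V'} {φ : V →ₗ[𝕜] V'}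
    (hT : ∀ x, φ (T x) = T' (φ x)) (p : 𝕜[X]) (x : V) :
    φ (aeval T p x) = aeval T' p (φ x) := by
  induction p using Polynomial.induction_on' generalizing x with
  | add p r hp hr => simp [hp, hr]
  | monomial k a =>
    have : ∀ x, φ ((T ^ k) x) = (T' ^ k) (φ x) := by
      induction k with
      | zero => simp
      | succ k ih => intro x; rw [pow_succ, pow_succ, Module.End.mul_apply, ih, hT]; rfl
    simp [aeval_monomial, Module.algebraMap_end_apply, this]

theorem exists_aeval_lift {T : Module.End 𝕜 V} {T' : Module.End 𝕜 V'} {φ : V →ₗ[𝕜] V'}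
    (hT : ∀ x, φ (T x) = T' (φ x)) {F G : 𝕜[X]} (hFG : IsCoprime F G) {x : V}
    (hx : aeval T (F * G) x = 0) (hx' : aeval T' F (φ x) = 0) :
    ∃ p : 𝕜[X], aeval T F (aeval T p x) = 0 ∧ φ (aeval T p x) = φ x := by
  obtain ⟨a, b, hab⟩ := hFG
  refine ⟨b * G, ?_, ?_⟩
  · rw [← Module.End.mul_apply, ← map_mul, show F * (b * G) = b * (F * G) by ring, map_mul,
      Module.End.mul_apply, hx, map_zero]
  · rw [map_aeval_apply hT, eq_sub_of_add_eq' hab, map_sub, map_one, LinearMap.sub_apply, map_mul,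
      Module.End.mul_apply, hx', map_zero, sub_zero, Module.End.one_apply]

theorem exists_aeval_lift_of_pow_eq_one {N : ℕ} (hN : (N : 𝕜) ≠ 0) {T : Module.End 𝕜 V}
    {T' : Module.End 𝕜 V'} {φ : V →ₗ[𝕜] V'} (hT : ∀ x, φ (T x) = T' (φ x)) (hTN : T ^ N = 1)
    {c : 𝕜} (hcN : c ^ N = 1) {x : V} (hx : T' (φ x) = c • φ x) :
    ∃ p : 𝕜[X], T (aeval T p x) = c • aeval T p x ∧ φ (aeval T p x) = φ x := by
  obtain ⟨G, hG⟩ : X - Polynomial.C c ∣ (X ^ N - Polynomial.C 1 : 𝕜[X]) :=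
    dvd_iff_isRoot.2 (by simp [hcN])
  have hcop : IsCoprime (X - Polynomial.C c) G :=
    (hG ▸ separable_X_pow_sub_C (1 : 𝕜) hN one_ne_zero).isCoprime
  obtain ⟨p, h1, h2⟩ := exists_aeval_lift hT hcop (x := x) (by rw [← hG]; simp [hTN])
    (by simp [hx, Module.algebraMap_end_apply])
  exact ⟨p, by simpa [sub_eq_zero, Module.algebraMap_end_apply] using h1, h2⟩

theorem aeval_X_sub_C_sq_apply (T : Module.End 𝕜 V) (κ : 𝕜) (y : V) :
    aeval T ((X - Polynomial.C κ) ^ 2) y = T (T y - κ • y) - κ • (T y - κ • y) := by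
  simp [pow_two, Module.algebraMap_end_apply]

variable {ζ s t : 𝕜} {A B C D : Module.End 𝕜 V} {A' B' C' D' : Module.End 𝕜 V'}

theorem Rels.exists_lift (h : Rels m n ζ s t A B C D) (hm : 1 < m) (hn : 1 < n)
    (hζ : IsPrimitiveRoot ζ (m * n)) {φ : V →ₗ[𝕜] V'} (hφA : ∀ x, φ (A x) = A' (φ x))
    (hφB : ∀ x, φ (B x) = B' (φ x)) (hφC : ∀ x, φ (C x) = C' (φ x))
    (hφD : ∀ x, φ (D x) = D' (φ x)) {β χ : 𝕜} {l : ℕ} (hl1 : 1 ≤ l) (hl2 : l < n)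
    (hβ : β ^ n = 1) (hχ : χ ^ m = β * (ζ ^ m) ^ (l - 1)) {x : V}
    (hB : B' (φ x) = β • φ x) (hC : C' (φ x) = χ • φ x)
    (hK : casimir m ζ A' B' C' D' (casimir m ζ A' B' C' D' (φ x) - kap (ζ ^ m) β l 0 • φ x) =
      kap (ζ ^ m) β l 0 • (casimir m ζ A' B' C' D' (φ x) - kap (ζ ^ m) β l 0 • φ x)) :
    ∃ (S : Submodule 𝕜 V) (w : V), FiniteDimensional 𝕜 S ∧ Module.finrank 𝕜 S ≤ 2 * n ∧ w ∈ S ∧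
      φ w = φ x ∧
      (∀ x ∈ S, A x ∈ S) ∧ (∀ x ∈ S, B x ∈ S) ∧ (∀ x ∈ S, C x ∈ S) ∧ (∀ x ∈ S, D x ∈ S) := by
  have hq := isPrimitiveRoot_q hm hn hζ
  have hζ0 : ζ ≠ 0 := hζ.ne_zero (by positivity)
  have h0 : ζ ^ m ≠ 0 := pow_ne_zero _ hζ0
  have hβ0 : β ≠ 0 := by
    rintro rfl
    simp [show n ≠ 0 by omega] at hβ
  have hN : ((m * n : ℕ) : 𝕜) ≠ 0 := by
    have : NeZero (m * n) := ⟨by positivity⟩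
    exact hζ.neZero'.out
  have hβN : β ^ (m * n) = 1 := by rw [mul_comm, pow_mul, hβ, one_pow]
  have hχN : χ ^ (m * n) = 1 := by
    rw [pow_mul, hχ, mul_pow, hβ, ← pow_mul, mul_comm (l - 1), pow_mul, hq.pow_eq_one, one_pow,
      one_mul]
  obtain ⟨p₁, hp₁, hp₁'⟩ := exists_aeval_lift_of_pow_eq_one hN hφB h.bPow hβN hB
  set x₁ := aeval B p₁ x
  obtain ⟨p₂, hp₂, hp₂'⟩ := exists_aeval_lift_of_pow_eq_one hN hφC h.cPow hχN
    (x := x₁) (by rw [hp₁', hC])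
  set x₂ := aeval C p₂ x₁
  have hBx₂ : B x₂ = β • x₂ := by
    rw [← Module.End.mul_apply, ← (commute_aeval (show Commute C B from h.bc.symm) p₂).eq,
      Module.End.mul_apply, hp₁, map_smul]
  have hCpow : (C ^ m) x₂ = χ ^ m • x₂ := by
    have := aeval_apply_of_eigen hp₂ (X ^ m)
    simpa using this
  have hwt : IsWt (ζ ^ m) β m l B C 0 x₂ := by
    refine ⟨by simpa using hBx₂, ?_⟩
    rw [hCpow, hχ, ← zpow_natCast (ζ ^ m), Nat.cast_sub hl1]
    simp
  have hφK : ∀ y, φ (casimir m ζ A B C D y) = casimir m ζ A' B' C' D' (φ y) := fun y => by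
    have : ∀ k y, φ ((C ^ k) y) = (C' ^ k) (φ y) := fun k y => by
      simpa using map_aeval_apply hφC (X ^ k) y
    simp [casimir, hφA, hφB, hφD, this]
  set κ := kap (ζ ^ m) β l 0 with hκ
  have hF := h.smul_dPow_aPow_apply hm hn hζ hwt n
  rw [h.dPow, LinearMap.zero_apply, smul_zero] at hF
  have hfac : ∏ j ∈ Finset.range n, (X - Polynomial.C (kap (ζ ^ m) β l (0 + j))) =
      (X - Polynomial.C κ) ^ 2 * ∏ j ∈ ((Finset.range n).erase 0).erase (n - l),
        (X - Polynomial.C (kap (ζ ^ m) β l (0 + j))) := by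
    rw [← Finset.mul_prod_erase _ _ (Finset.mem_range.2 (show 0 < n by omega)),
      ← Finset.mul_prod_erase ((Finset.range n).erase 0) _
        (Finset.mem_erase.2 ⟨(show n - l ≠ 0 by omega), Finset.mem_range.2 (by omega)⟩),
      show kap (ζ ^ m) β l (0 + (n - l : ℕ)) = κ by
        rw [kap_eq_iff hq (by omega) hβ0]
        right
        push_cast [hl2.le]
        simp]
    simp only [Nat.cast_zero, add_zero]
    ring
  have hcop : IsCoprime ((X - Polynomial.C κ) ^ 2)
      (∏ j ∈ ((Finset.range n).erase 0).erase (n - l),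
        (X - Polynomial.C (kap (ζ ^ m) β l (0 + j)))) := by
    refine IsCoprime.pow_left (IsCoprime.prod_right fun j hj => ?_)
    refine isCoprime_X_sub_C_of_isUnit_sub (sub_ne_zero.2 fun e => ?_).isUnit
    rw [Finset.mem_erase, Finset.mem_erase, Finset.mem_range] at hj
    rw [hκ, eq_comm, kap_eq_iff hq (by omega) hβ0, zero_add] at e
    obtain e | ⟨k, hk⟩ := e
    · have := Int.le_of_dvd (by omega) e
      omega
    · have h1 : (l : ℤ) + j < 2 * n := by omega
      obtain h2 | rfl | h2 : k ≤ 0 ∨ k = 1 ∨ 2 ≤ k := by omega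
      · nlinarith
      · omega
      · nlinarith
  have hφx₂ : φ x₂ = φ x := by rw [hp₂', hp₁']
  obtain ⟨p₃, hp₃, hp₃'⟩ := exists_aeval_lift hφK hcop (x := x₂) (by rw [← hfac, ← hF])
    (by rw [aeval_X_sub_C_sq_apply, hφx₂, hK, sub_self])
  rw [aeval_X_sub_C_sq_apply, sub_eq_zero] at hp₃
  have hwt₃ : IsWt (ζ ^ m) β m l B C 0 (aeval (casimir m ζ A B C D) p₃ x₂) := by
    constructor
    · rw [← Module.End.mul_apply, ← (commute_aeval h.casimir_b p₃).eq, Module.End.mul_apply,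
        hwt.1, map_smul]
    · rw [← Module.End.mul_apply, ← (commute_aeval (h.casimir_cPow hm hn hζ) p₃).eq,
        Module.End.mul_apply, hwt.2, map_smul]
  have hCx₃ : C (aeval (casimir m ζ A B C D) p₃ x₂) =
      χ • aeval (casimir m ζ A B C D) p₃ x₂ := by
    rw [← Module.End.mul_apply, ← (commute_aeval (h.casimir_c hn hζ0) p₃).eq,
      Module.End.mul_apply, hp₂, map_smul]
  obtain ⟨S, h1, h2, h3, h4⟩ := h.exists_invariant_of_isWt hm hn hζ hβ hl1 hl2 hwt₃ hCx₃ hp₃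
  exact ⟨S, _, h1, h2, h3, by rw [hp₃', hφx₂], h4⟩

end Lifting

section Relations

variable {𝕜 m n ξ}

/-- The quotient map from the free algebra. -/
def mkH : FreeAlgebra 𝕜 (Fin 4) →ₐ[𝕜] H 𝕜 m n ξ := RingQuot.mkAlgHom 𝕜 (HRel 𝕜 m n ξ)

theorem mkH_surjective : Function.Surjective (mkH : FreeAlgebra 𝕜 (Fin 4) →ₐ[𝕜] H 𝕜 m n ξ) :=
  RingQuot.mkAlgHom_surjective 𝕜 (HRel 𝕜 m n ξ)

theorem mkH_fgen (k : Fin 4) : mkH (fgen 𝕜 k) = gen 𝕜 m n ξ k := rfl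

theorem mkH_eq {x y : FreeAlgebra 𝕜 (Fin 4)} (h : HRel 𝕜 m n ξ x y) :
    (mkH x : H 𝕜 m n ξ) = mkH y :=
  RingQuot.mkAlgHom_rel 𝕜 h

theorem ha_pow : ha ^ n = hb ^ n - 1 := by
  simpa only [map_pow, map_sub, map_one, mkH_fgen] using mkH_eq (HRel.aPow (𝕜 := 𝕜) (m := m))

theorem hb_pow : hb ^ (m * n) = 1 := by
  simpa only [map_pow, map_one, mkH_fgen] using mkH_eq (HRel.bPow (𝕜 := 𝕜))

theorem hc_pow : hc ^ (m * n) = 1 := by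
  simpa only [map_pow, map_one, mkH_fgen] using mkH_eq (HRel.cPow (𝕜 := 𝕜))

theorem hd_pow : hd ^ n = 0 := by
  simpa only [map_pow, map_zero, mkH_fgen] using mkH_eq (HRel.dPow (𝕜 := 𝕜) (m := m))

theorem ha_mul_hb : ha * hb = ξ ^ m • (hb * ha) := by
  simpa only [map_mul, map_smul, mkH_fgen] using mkH_eq (HRel.ab (𝕜 := 𝕜) (n := n))

theorem hd_mul_hc : hd * hc = ξ • (hc * hd) := by
  simpa only [map_mul, map_smul, mkH_fgen] using mkH_eq (HRel.dc (𝕜 := 𝕜) (m := m) (n := n))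

theorem hb_mul_hc : hb * hc = hc * hb := by
  simpa only [map_mul, mkH_fgen] using mkH_eq (HRel.bc (𝕜 := 𝕜) (m := m) (n := n))

theorem hb_mul_hd : hb * hd = ξ ^ m • (hd * hb) := by
  simpa only [map_mul, map_smul, mkH_fgen] using mkH_eq (HRel.bd (𝕜 := 𝕜) (n := n))

theorem ha_hd_commutator : ha * hd - hd * ha = hb - hc ^ m := by
  simpa only [map_mul, map_sub, map_pow, mkH_fgen] using mkH_eq (HRel.ad (𝕜 := 𝕜) (n := n))

theorem ha_mul_hc : ha * hc = ξ⁻¹ • (hc * ha) +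
    ((ξ⁻¹ - ξ ^ (n - 1)) / qFact 𝕜 (ξ ^ m) (n - 1)) •
      ((hc ^ (m + 1) - ξ ^ m • (hb * hc)) * hd ^ (n - 1)) := by
  simpa only [map_mul, map_smul, map_add, map_sub, map_pow, mkH_fgen] using
    mkH_eq (HRel.ac (𝕜 := 𝕜) (m := m) (n := n))

variable (𝕜 m n ξ) in
/-- The Casimir element of `H_{mn}(ξ)`. -/
def casH : H 𝕜 m n ξ := (ξ ^ m - 1) • (hd * ha) - hb - ξ ^ m • hc ^ m

theorem rels_lsmul (V : Type*) [AddCommGroup V] [Module 𝕜 V] [Module (H 𝕜 m n ξ) V]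
    [IsScalarTower 𝕜 (H 𝕜 m n ξ) V] :
    ∃ s t : 𝕜, Rels m n ξ s t (Algebra.lsmul 𝕜 𝕜 V ha) (Algebra.lsmul 𝕜 𝕜 V hb)
      (Algebra.lsmul 𝕜 𝕜 V hc) (Algebra.lsmul 𝕜 𝕜 V hd) := by
  refine ⟨(ξ⁻¹ - ξ ^ (n - 1)) / qFact 𝕜 (ξ ^ m) (n - 1),
    -(ξ ^ m * ((ξ⁻¹ - ξ ^ (n - 1)) / qFact 𝕜 (ξ ^ m) (n - 1))), ?_⟩
  constructor
  · simpa only [map_pow, map_sub, map_one] using congrArg (Algebra.lsmul 𝕜 𝕜 V) ha_pow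
  · simpa only [map_pow, map_one] using congrArg (Algebra.lsmul 𝕜 𝕜 V) hb_pow
  · simpa only [map_pow, map_one] using congrArg (Algebra.lsmul 𝕜 𝕜 V) hc_pow
  · simpa only [map_pow, map_zero] using congrArg (Algebra.lsmul 𝕜 𝕜 V) hd_pow
  · simpa only [map_mul, map_smul] using congrArg (Algebra.lsmul 𝕜 𝕜 V) (ha_mul_hb (𝕜 := 𝕜) (m := m) (n := n) (ξ := ξ))
  · simpa only [map_mul, map_smul] using congrArg (Algebra.lsmul 𝕜 𝕜 V) (hd_mul_hc (𝕜 := 𝕜) (m := m) (n := n) (ξ := ξ))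
  · simpa only [map_mul] using congrArg (Algebra.lsmul 𝕜 𝕜 V) hb_mul_hc
  · simpa only [map_mul, map_smul] using congrArg (Algebra.lsmul 𝕜 𝕜 V) (hb_mul_hd (𝕜 := 𝕜) (m := m) (n := n) (ξ := ξ))
  · simpa only [map_mul, map_sub, map_pow] using congrArg (Algebra.lsmul 𝕜 𝕜 V) ha_hd_commutator
  · simp only [← map_mul, ← map_smul, ← map_add, ← map_pow]
    congr 1
    rw [ha_mul_hc, hb_mul_hc, ← mul_assoc hc, mul_add, mul_smul_comm, mul_smul_comm, ← pow_succ']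
    simp only [sub_mul, add_mul, smul_mul_assoc]
    module

variable (𝕜 m n ξ) in
/-- Right multiplication on `H_{mn}(ξ)`. -/
def rmul : (H 𝕜 m n ξ)ᵐᵒᵖ →ₐ[𝕜] Module.End 𝕜 (H 𝕜 m n ξ) := Algebra.lsmul 𝕜 𝕜 (H 𝕜 m n ξ)

theorem rmul_op_apply (x y : H 𝕜 m n ξ) : rmul 𝕜 m n ξ (.op x) y = y * x := rfl

theorem rels_op (h0 : ξ ≠ 0) {V : Type*} [AddCommGroup V] [Module 𝕜 V]
    (ρ : (H 𝕜 m n ξ)ᵐᵒᵖ →ₐ[𝕜] Module.End 𝕜 V) :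
    ∃ s t : 𝕜, Rels m n ξ⁻¹ s t (ρ (.op ha)) (ρ (.op hb))
      (ρ (.op hc)) (-ρ (.op hd)) := by
  set e := (ξ⁻¹ - ξ ^ (n - 1)) / qFact 𝕜 (ξ ^ m) (n - 1) with he
  refine ⟨-(ξ * e * ((ξ ^ (n - 1)) ^ (m + 1))⁻¹ * (-1) ^ (n - 1)),
    ξ * e * ξ ^ m * (ξ ^ m) ^ (n - 1) * (ξ ^ (n - 1))⁻¹ * (-1) ^ (n - 1), ?_⟩
  have hq0 : ξ ^ m ≠ 0 := pow_ne_zero _ h0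
  have hr : ∀ x y : H 𝕜 m n ξ, x = y → ρ (.op x) = ρ (.op y) :=
    fun _ _ e => e ▸ rfl
  constructor
  · simpa using hr _ _ ha_pow
  · simpa using hr _ _ hb_pow
  · simpa using hr _ _ hc_pow
  · rw [neg_pow]
    simpa using hr _ _ hd_pow
  · have := hr _ _ ha_mul_hb
    simp only [MulOpposite.op_mul, MulOpposite.op_smul, map_mul, map_smul] at this
    rw [this, inv_pow, inv_smul_smul₀ hq0]
  · have := hr _ _ hd_mul_hc
    simp only [MulOpposite.op_mul, MulOpposite.op_smul, map_mul, map_smul] at this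
    rw [neg_mul, mul_neg, this, smul_neg, inv_smul_smul₀ h0]
  · simpa using (hr _ _ hb_mul_hc).symm
  · have := hr _ _ hb_mul_hd
    simp only [MulOpposite.op_mul, MulOpposite.op_smul, map_mul, map_smul] at this
    rw [neg_mul, mul_neg, this, smul_neg, inv_pow, inv_smul_smul₀ hq0]
  · have := hr _ _ ha_hd_commutator
    simp only [MulOpposite.op_mul, MulOpposite.op_sub, MulOpposite.op_pow, map_mul, map_sub,
      map_pow] at this
    rw [← this]
    noncomm_ring
  · have hbd : hd ^ (n - 1) * hb = ((ξ ^ m) ^ (n - 1))⁻¹ • (hb * hd ^ (n - 1)) := by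
      rw [mul_pow_of_smul_comm hb_mul_hd, inv_smul_smul₀ (pow_ne_zero _ hq0)]
    have hdc : hd ^ (n - 1) * hc = ξ ^ (n - 1) • (hc * hd ^ (n - 1)) :=
      pow_mul_of_smul_comm hd_mul_hc _
    have hdcp := mul_pow_of_smul_comm hdc (m + 1)
    have key : hc * ha = ξ • (ha * hc) +
        (-(ξ * e * ((ξ ^ (n - 1)) ^ (m + 1))⁻¹)) • (hd ^ (n - 1) * hc ^ (m + 1)) +
        (ξ * e * ξ ^ m * (ξ ^ m) ^ (n - 1) * (ξ ^ (n - 1))⁻¹) • (hd ^ (n - 1) * (hb * hc)) := by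
      rw [hdcp, ← mul_assoc, hbd, smul_mul_assoc, mul_assoc _ _ hc, hdc, mul_smul_comm, ha_mul_hc, ← he,
        smul_add, smul_inv_smul₀ h0, smul_smul, smul_smul, smul_smul, smul_smul, ← mul_assoc]
      have e1 : ξ ^ (n - 1) ≠ 0 := pow_ne_zero _ h0
      rw [show ξ * e * ξ ^ m * (ξ ^ m) ^ (n - 1) * (ξ ^ (n - 1))⁻¹ *
          ((ξ ^ m) ^ (n - 1))⁻¹ * ξ ^ (n - 1) = ξ * e * ξ ^ m by field_simp,
        show -(ξ * e * ((ξ ^ (n - 1)) ^ (m + 1))⁻¹) * (ξ ^ (n - 1)) ^ (m + 1) = -(ξ * e) by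
          field_simp, sub_mul, smul_mul_assoc]
      module
    have := hr _ _ key
    simp only [MulOpposite.op_mul, MulOpposite.op_smul, MulOpposite.op_add, MulOpposite.op_pow,
      map_mul, map_smul, map_add, map_pow] at this
    rw [this, inv_inv, neg_pow (ρ (.op hd)), add_assoc]
    congr 1
    have e2 : (-1 : Module.End 𝕜 V) ^ (n - 1) = algebraMap 𝕜 _ ((-1) ^ (n - 1)) := by
      simp
    rw [e2, Algebra.algebraMap_eq_smul_one, smul_one_mul, pow_succ' (ρ (.op hc))]
    simp only [mul_smul_comm, smul_mul_assoc, add_mul, mul_add, mul_assoc]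
    obtain h1 | h1 := neg_one_pow_eq_or 𝕜 (n - 1) <;> rw [h1] <;> module

end Relations

section Generation

variable {𝕜 m n ξ}

theorem gen_induction {p : H 𝕜 m n ξ → Prop} (hs : ∀ r : 𝕜, p (algebraMap 𝕜 _ r))
    (hg : ∀ k, p (gen 𝕜 m n ξ k)) (hmul : ∀ x y, p x → p y → p (x * y))
    (hadd : ∀ x y, p x → p y → p (x + y)) (x : H 𝕜 m n ξ) : p x := by
  obtain ⟨y, rfl⟩ := mkH_surjective x
  induction y using FreeAlgebra.induction with
  | grade0 r => rw [AlgHom.commutes]; exact hs r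
  | grade1 k => exact hg k
  | mul a b ha' hb' => rw [map_mul]; exact hmul _ _ ha' hb'
  | add a b ha' hb' => rw [map_add]; exact hadd _ _ ha' hb'

variable {V V' : Type*} [AddCommGroup V] [Module 𝕜 V] [Module (H 𝕜 m n ξ) V]
  [IsScalarTower 𝕜 (H 𝕜 m n ξ) V] [AddCommGroup V'] [Module 𝕜 V'] [Module (H 𝕜 m n ξ) V']
  [IsScalarTower 𝕜 (H 𝕜 m n ξ) V']

theorem smul_mem_of_gen {N : Submodule 𝕜 V} (h : ∀ k, ∀ x ∈ N, gen 𝕜 m n ξ k • x ∈ N)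
    (r : H 𝕜 m n ξ) : ∀ x ∈ N, r • x ∈ N := by
  induction r using gen_induction with
  | hs r => exact fun x hx => by rw [algebraMap_smul]; exact N.smul_mem _ hx
  | hg k => exact h k
  | hmul r s hr hs => exact fun x hx => by rw [mul_smul]; exact hr _ (hs x hx)
  | hadd r s hr hs => exact fun x hx => by rw [add_smul]; exact N.add_mem (hr x hx) (hs x hx)

/-- A subspace which is stable under the generators is a submodule. -/
def ofGenStable (N : Submodule 𝕜 V) (h : ∀ k, ∀ x ∈ N, gen 𝕜 m n ξ k • x ∈ N) :
    Submodule (H 𝕜 m n ξ) V where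
  __ := N
  smul_mem' r x hx := smul_mem_of_gen h r x hx

theorem mem_ofGenStable {N : Submodule 𝕜 V} {h : ∀ k, ∀ x ∈ N, gen 𝕜 m n ξ k • x ∈ N} {x : V} :
    x ∈ ofGenStable N h ↔ x ∈ N := Iff.rfl

theorem map_smul_of_gen {f : V →ₗ[𝕜] V'} (h : ∀ k x, f (gen 𝕜 m n ξ k • x) = gen 𝕜 m n ξ k • f x)
    (r : H 𝕜 m n ξ) : ∀ x, f (r • x) = r • f x := by
  induction r using gen_induction with
  | hs r => exact fun x => by rw [algebraMap_smul, algebraMap_smul, map_smul]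
  | hg k => exact h k
  | hmul r s hr hs => exact fun x => by rw [mul_smul, hr, hs, mul_smul]
  | hadd r s hr hs => exact fun x => by rw [add_smul, map_add, hr, hs, add_smul]

/-- A linear map which commutes with the generators is a module homomorphism. -/
def ofGenMap (f : V →ₗ[𝕜] V') (h : ∀ k x, f (gen 𝕜 m n ξ k • x) = gen 𝕜 m n ξ k • f x) :
    V →ₗ[H 𝕜 m n ξ] V' where
  __ := f
  map_smul' := map_smul_of_gen h

theorem mul_mem_of_gen {S : Submodule 𝕜 (H 𝕜 m n ξ)} (h : ∀ k, ∀ x ∈ S, x * gen 𝕜 m n ξ k ∈ S)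
    (r : H 𝕜 m n ξ) : ∀ x ∈ S, x * r ∈ S := by
  induction r using gen_induction with
  | hs r =>
    exact fun x hx => by rw [← Algebra.commutes, ← Algebra.smul_def]; exact S.smul_mem _ hx
  | hg k => exact h k
  | hmul r s hr hs => exact fun x hx => by rw [← mul_assoc]; exact hs _ (hr x hx)
  | hadd r s hr hs => exact fun x hx => by rw [mul_add]; exact S.add_mem (hr x hx) (hs x hx)

theorem q_smul_ha_mul_hd :
    (ξ ^ m - 1) • (ha * hd) = casH 𝕜 m n ξ + ξ ^ m • hb + hc ^ m := by
  rw [casH]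
  linear_combination (norm := module) (ξ ^ m - 1) • ha_hd_commutator (𝕜 := 𝕜) (n := n)

theorem casH_mul_hd : casH 𝕜 m n ξ * hd = hd * casH 𝕜 m n ξ := by
  have e1 := mul_pow_of_smul_comm (hd_mul_hc (𝕜 := 𝕜) (m := m) (n := n) (ξ := ξ)) m
  have e2 := congrArg (hd * ·) (ha_hd_commutator (𝕜 := 𝕜) (m := m) (n := n) (ξ := ξ))
  have e3 := hb_mul_hd (𝕜 := 𝕜) (m := m) (n := n) (ξ := ξ)
  simp only [mul_sub] at e2
  rw [casH]
  simp only [sub_mul, mul_sub, smul_mul_assoc, mul_smul_comm, mul_assoc]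
  linear_combination (norm := module) (ξ ^ m - 1) • e2 - e3 + e1

variable (hm : 1 < m) (hn : 1 < n) (hξ : IsPrimitiveRoot ξ (m * n))
include hm hn hξ

theorem exists_left_ideal {β χ : 𝕜} {l : ℕ} (hl1 : 1 ≤ l) (hl2 : l < n) (hβ : β ^ n = 1)
    (hχ : χ ^ m = β * (ξ ^ m) ^ (l - 1)) {x : V} (hB : hb • x = β • x) (hC : hc • x = χ • x)
    (hK : casH 𝕜 m n ξ • (casH 𝕜 m n ξ • x - kap (ξ ^ m) β l 0 • x) =
      kap (ξ ^ m) β l 0 • (casH 𝕜 m n ξ • x - kap (ξ ^ m) β l 0 • x)) :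
    ∃ (S : Submodule (H 𝕜 m n ξ) (H 𝕜 m n ξ)) (w : H 𝕜 m n ξ), FiniteDimensional 𝕜 S ∧
      Module.finrank 𝕜 S ≤ 2 * n ∧ w ∈ S ∧ w • x = x := by
  obtain ⟨s, t, h⟩ := rels_lsmul (𝕜 := 𝕜) (m := m) (n := n) (ξ := ξ) (H 𝕜 m n ξ)
  have hcas : ∀ y : V, casimir m ξ (Algebra.lsmul 𝕜 𝕜 V ha) (Algebra.lsmul 𝕜 𝕜 V hb)
      (Algebra.lsmul 𝕜 𝕜 V hc) (Algebra.lsmul 𝕜 𝕜 V hd) y = casH 𝕜 m n ξ • y := fun y => by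
    rw [casimir, ← map_mul, ← map_pow, ← map_smul, ← map_smul, ← map_sub, ← map_sub]
    rfl
  let φ : H 𝕜 m n ξ →ₗ[𝕜] V := (LinearMap.toSpanSingleton (H 𝕜 m n ξ) V x).restrictScalars 𝕜
  have hφ : ∀ y, φ y = y • x := fun y => rfl
  have hφg : ∀ g y : H 𝕜 m n ξ,
      φ (Algebra.lsmul 𝕜 𝕜 (H 𝕜 m n ξ) g y) = Algebra.lsmul 𝕜 𝕜 V g (φ y) := fun g y =>
    mul_smul g y x
  have h1 : φ 1 = x := by rw [hφ, one_smul]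
  obtain ⟨S, w, i1, i2, i3, i4, i5, i6, i7, i8⟩ := h.exists_lift hm hn hξ (hφg ha) (hφg hb)
    (hφg hc) (hφg hd) hl1 hl2 hβ hχ (x := 1) (by rw [h1]; exact hB) (by rw [h1]; exact hC)
    (by rw [h1, hcas, hcas]; exact hK)
  have hS : ∀ k, ∀ x ∈ S, gen 𝕜 m n ξ k • x ∈ S := fun k => by
    fin_cases k
    exacts [i5, i6, i7, i8]
  exact ⟨ofGenStable S hS, w, i1, i2, i3, by rw [← hφ, i4, h1]⟩

theorem exists_right_ideal {β χ : 𝕜} {l : ℕ} (hl1 : 1 ≤ l) (hl2 : l < n) (hβ : β ^ n = 1)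
    (hχ : χ ^ m * (ξ ^ m) ^ (l - 1) = β) {η : V →ₗ[𝕜] 𝕜} (hB : ∀ x, η (hb • x) = β * η x)
    (hC : ∀ x, η (hc • x) = χ * η x) {κ : 𝕜} (hκ : ξ ^ m * kap (ξ ^ m)⁻¹ β l 0 = κ)
    (hK : ∀ x : V, casH 𝕜 m n ξ • (casH 𝕜 m n ξ • x - κ • x) =
      κ • (casH 𝕜 m n ξ • x - κ • x)) :
    ∃ (S : Submodule 𝕜 (H 𝕜 m n ξ)) (w : H 𝕜 m n ξ), FiniteDimensional 𝕜 S ∧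
      Module.finrank 𝕜 S ≤ 2 * n ∧ w ∈ S ∧ (∀ s ∈ S, ∀ r, s * r ∈ S) ∧
      ∀ x : V, η (w • x) = η x := by
  have h0 : ξ ≠ 0 := hξ.ne_zero (by positivity)
  have hq0 : ξ ^ m ≠ 0 := pow_ne_zero _ h0
  obtain ⟨s, t, h⟩ := rels_op h0 (rmul 𝕜 m n ξ)
  let T : H 𝕜 m n ξ → Module.End 𝕜 (V →ₗ[𝕜] 𝕜) := fun r =>
    LinearMap.lcomp 𝕜 𝕜 (Algebra.lsmul 𝕜 𝕜 V r)
  have hT : ∀ r f x, T r f x = f (r • x) := fun r f x => rfl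
  have hTc : ∀ (k : ℕ) f x, (T hc ^ k) f x = f (hc ^ k • x) := fun k f => by
    induction k with
    | zero => simp
    | succ k ih => intro x; rw [pow_succ', Module.End.mul_apply, hT, ih, ← mul_smul, ← pow_succ]
  have hcas : ∀ f x, casimir m ξ⁻¹ (T ha) (T hb) (T hc) (-T hd) f x =
      (ξ ^ m)⁻¹ * f (casH 𝕜 m n ξ • x) := fun f x => by
    have e : casH 𝕜 m n ξ = (ξ ^ m - 1) • (ha * hd) - ξ ^ m • hb - hc ^ m := by
      rw [q_smul_ha_mul_hd]; abel
    simp only [casimir, LinearMap.sub_apply, LinearMap.smul_apply, Module.End.mul_apply,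
      LinearMap.neg_apply, hT, hTc, e, sub_smul, smul_assoc, map_sub, map_smul, smul_eq_mul,
      mul_smul, inv_pow, mul_neg]
    field_simp
    ring
  let φ : H 𝕜 m n ξ →ₗ[𝕜] (V →ₗ[𝕜] 𝕜) :=
    (LinearMap.compRight 𝕜 η).comp (Algebra.lsmul 𝕜 𝕜 V).toLinearMap
  have hφ : ∀ r x, φ r x = η (r • x) := fun r x => rfl
  have hφg : ∀ g y : H 𝕜 m n ξ, φ (rmul 𝕜 m n ξ (.op g) y) = T g (φ y) := fun g y => by
    ext x
    rw [hφ, hT, hφ, rmul_op_apply, mul_smul]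
  have h1 : φ 1 = η := by ext x; rw [hφ, one_smul]
  obtain ⟨S, w, i1, i2, i3, i4, i5, i6, i7, i8⟩ := h.exists_lift hm hn hξ.inv (D' := -T hd)
    (hφg ha) (hφg hb) (hφg hc)
    (fun x => by rw [LinearMap.neg_apply, map_neg, hφg, LinearMap.neg_apply]) hl1 hl2 hβ
    (χ := χ)
    (by rw [← hχ, inv_pow, inv_pow, mul_inv_cancel_right₀ (pow_ne_zero _ hq0)]) (x := 1)
    (by rw [h1]; ext x; simp [hT, hB]) (by rw [h1]; ext x; simp [hT, hC])
    (by
      rw [h1, inv_pow]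
      have hκ' : kap (ξ ^ m)⁻¹ β l 0 = (ξ ^ m)⁻¹ * κ := by rw [← hκ, inv_mul_cancel_left₀ hq0]
      ext x
      have := congrArg η (hK x)
      have e : casH 𝕜 m n ξ • κ • x = κ • casH 𝕜 m n ξ • x := smul_comm ..
      simp only [hcas, LinearMap.sub_apply, LinearMap.smul_apply, smul_eq_mul, hκ', map_sub,
        map_smul, smul_sub, e] at this ⊢
      linear_combination (ξ ^ m)⁻¹ ^ 2 * this)
  refine ⟨S, w, i1, i2, i3, fun s hs r => mul_mem_of_gen (fun k => ?_) r s hs, fun x => ?_⟩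
  · fin_cases k
    exacts [i5, i6, i7, fun x hx => by
      have e := S.neg_mem (i8 x hx)
      rwa [LinearMap.neg_apply, neg_neg, rmul_op_apply] at e]
  · rw [← hφ, i4, h1]

end Generation

section Strings

variable {𝕜 m n ξ}

theorem mem_span_singleton_of_chain {V : Type*} [AddCommGroup V] [Module 𝕜 V]
    {D : Module.End 𝕜 V} {e : ℕ → V} (h0 : D (e 0) = 0) (he : e 0 ≠ 0) (k : ℕ)
    (hD : ∀ j, j + 1 < k → D (e (j + 1)) = e j) :
    ∀ x ∈ Submodule.span 𝕜 (e '' Set.Iio k), D x = 0 → x ∈ Submodule.span 𝕜 {e 0} := by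
  have key : ∀ j, j < k → (D ^ j) (e j) = e 0 := fun j hj => by
    induction j with
    | zero => rfl
    | succ j ih => rw [pow_succ, Module.End.mul_apply, hD j hj, ih (by omega)]
  induction k with
  | zero =>
    intro x hx _
    have e0 : Set.Iio 0 = (∅ : Set ℕ) := by ext; simp
    rw [e0, Set.image_empty, Submodule.span_empty, Submodule.mem_bot] at hx
    rw [hx]
    exact Submodule.zero_mem _
  | succ k ih =>
    intro x hx hx0
    have e1 : Set.Iio (k + 1) = insert k (Set.Iio k) := Order.Iio_succ_eq_insert k
    rw [e1, Set.image_insert_eq, Submodule.mem_span_insert] at hx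
    obtain ⟨c, y, hy, rfl⟩ := hx
    have hy0 : (D ^ k) y = 0 := by
      clear hx0
      induction hy using Submodule.span_induction with
      | mem y hy =>
        obtain ⟨j, hj, rfl⟩ := hy
        rw [Set.mem_Iio] at hj
        obtain ⟨r, rfl⟩ : ∃ r, k = r + 1 + j := ⟨k - 1 - j, by omega⟩
        rw [pow_add, Module.End.mul_apply, key j (by omega), pow_succ, Module.End.mul_apply, h0,
          map_zero]
      | zero => exact map_zero _
      | add x y _ _ hx hy => rw [map_add, hx, hy, add_zero]
      | smul c x _ hx => rw [map_smul, hx, smul_zero]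
    rcases Nat.eq_zero_or_pos k with rfl | hk
    · rw [pow_zero, Module.End.one_apply] at hy0
      rw [hy0, add_zero]
      exact Submodule.smul_mem _ _ (Submodule.mem_span_singleton_self _)
    · have hc0 : c = 0 := by
        have e2 := congrArg (D ^ (k - 1)) hx0
        rw [← Module.End.mul_apply, ← pow_succ, Nat.sub_add_cancel hk, map_add, hy0, map_smul,
          key k (by omega), map_zero, add_zero] at e2
        exact (smul_eq_zero.1 e2).resolve_right he
      subst hc0
      rw [zero_smul, zero_add] at hx0 ⊢
      exact ih (fun j hj => hD j (by omega)) (fun j hj => key j (by omega)) y hy hx0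

variable {V V' : Type*} [AddCommGroup V] [Module 𝕜 V] [Module (H 𝕜 m n ξ) V]
  [IsScalarTower 𝕜 (H 𝕜 m n ξ) V] [AddCommGroup V'] [Module 𝕜 V'] [Module (H 𝕜 m n ξ) V']
  [IsScalarTower 𝕜 (H 𝕜 m n ξ) V']

omit [Module 𝕜 V] [IsScalarTower 𝕜 (H 𝕜 m n ξ) V] in
theorem exists_ne_zero_hd_smul_eq_zero {N : Submodule (H 𝕜 m n ξ) V} (hN : N ≠ ⊥) :
    ∃ y ∈ N, y ≠ 0 ∧ hd • y = 0 := by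
  classical
  obtain ⟨x, hx, hx0⟩ := N.ne_bot_iff.1 hN
  have h : ∃ k, hd ^ k • x = 0 := ⟨n, by rw [hd_pow, zero_smul]⟩
  obtain ⟨k, hk⟩ : ∃ k, Nat.find h = k + 1 := by
    refine Nat.exists_eq_succ_of_ne_zero fun h0 => hx0 ?_
    have := Nat.find_spec h
    rwa [h0, pow_zero, one_smul] at this
  refine ⟨hd ^ k • x, N.smul_mem _ hx, Nat.find_min h (by omega), ?_⟩
  rw [← mul_smul, ← pow_succ', ← hk]
  exact Nat.find_spec h

omit [Module 𝕜 V] [IsScalarTower 𝕜 (H 𝕜 m n ξ) V] in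
theorem jrad_smul_eq_zero {N : Submodule (H 𝕜 m n ξ) V} [IsSimpleModule (H 𝕜 m n ξ) N]
    {r : H 𝕜 m n ξ} (hr : r ∈ jrad 𝕜 m n ξ) {x : V} (hx : x ∈ N) : r • x = 0 := by
  have h := Ring.jacobson_smul_top_le (R := H 𝕜 m n ξ) (M := N)
  rw [IsSimpleModule.jacobson_eq_bot] at h
  rw [jrad, Ideal.jacobson_bot] at hr
  have := h (Submodule.smul_mem_smul hr (Submodule.mem_top (x := (⟨x, hx⟩ : N))))
  exact congrArg Subtype.val this

theorem ne_zpow_of_lt {ζ : 𝕜} {k : ℕ} (h : IsPrimitiveRoot ζ k) (hk : k ≠ 0) {a b : ℤ}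
    (h1 : a < b) (h2 : b < a + k) : ζ ^ a ≠ ζ ^ b := fun e => by
  have h0 := h.ne_zero hk
  have e1 : ζ ^ (b - a) = 1 := by
    rw [zpow_sub₀ h0, ← e, div_self (zpow_ne_zero _ h0)]
  have := Int.le_of_dvd (by omega) ((h.zpow_eq_one_iff_dvd _).1 e1)
  omega

theorem sub_one_mul_qInt (q : 𝕜) (k : ℕ) : (q - 1) * qInt 𝕜 q k = q ^ k - 1 := mul_geom_sum q k

theorem qInt_ne_zero {q : 𝕜} {k : ℕ} (hq : IsPrimitiveRoot q n) (h1 : k ≠ 0) (h2 : k < n) :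
    qInt 𝕜 q k ≠ 0 := fun h => by
  have e := sub_one_mul_qInt q k
  rw [h, mul_zero] at e
  exact hq.pow_ne_one_of_pos_of_lt h1 h2 (sub_eq_zero.1 e.symm)

variable (𝕜 m n ξ) in
/-- The first `l` terms of `e` satisfy the relations of the standard basis of `M(l, i)`. -/
structure IsString (l : ℕ) (i : ℤ) (e : ℕ → V) : Prop where
  ha_smul : ∀ j, j + 1 < l → ha • e j = alph 𝕜 m n ξ l i (j + 1) • e (j + 1)
  ha_smul_last : ∀ j, j + 1 = l → ha • e j = 0
  hb_smul : ∀ j, j < l → hb • e j = ((ξ ^ m) ^ (i + (l : ℤ) - ((j : ℕ) + 1 : ℤ)) : 𝕜) • e j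
  hc_smul : ∀ j, j < l → hc • e j = (ξ ^ (i + (j : ℕ) : ℤ) : 𝕜) • e j
  hd_smul : ∀ j, j + 1 < l → hd • e (j + 1) = e j
  hd_smul_zero : hd • e 0 = 0

namespace IsString

variable {l : ℕ} {i : ℤ} {e : ℕ → V}

theorem map (h : IsString 𝕜 m n ξ l i e) (f : V →ₗ[H 𝕜 m n ξ] V') :
    IsString 𝕜 m n ξ l i (fun j => f (e j)) where
  ha_smul j hj := by rw [← map_smul, h.ha_smul j hj, f.map_smul_of_tower]
  ha_smul_last j hj := by rw [← map_smul, h.ha_smul_last j hj, map_zero]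
  hb_smul j hj := by rw [← map_smul, h.hb_smul j hj, f.map_smul_of_tower]
  hc_smul j hj := by rw [← map_smul, h.hc_smul j hj, f.map_smul_of_tower]
  hd_smul j hj := by rw [← map_smul, h.hd_smul j hj]
  hd_smul_zero := by rw [← map_smul, h.hd_smul_zero, map_zero]

theorem of_injective {f : V →ₗ[H 𝕜 m n ξ] V'} (hf : Function.Injective f)
    (h : IsString 𝕜 m n ξ l i (fun j => f (e j))) : IsString 𝕜 m n ξ l i e where
  ha_smul j hj := hf (by rw [map_smul, h.ha_smul j hj, f.map_smul_of_tower])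
  ha_smul_last j hj := hf (by rw [map_smul, h.ha_smul_last j hj, map_zero])
  hb_smul j hj := hf (by rw [map_smul, h.hb_smul j hj, f.map_smul_of_tower])
  hc_smul j hj := hf (by rw [map_smul, h.hc_smul j hj, f.map_smul_of_tower])
  hd_smul j hj := hf (by rw [map_smul, h.hd_smul j hj])
  hd_smul_zero := hf (by rw [map_smul, h.hd_smul_zero, map_zero])

theorem gen_smul_mem (h : IsString 𝕜 m n ξ l i e) (k : Fin 4) :
    ∀ x ∈ Submodule.span 𝕜 (e '' Set.Iio l),
      gen 𝕜 m n ξ k • x ∈ Submodule.span 𝕜 (e '' Set.Iio l) := by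
  have hmem : ∀ j, j < l → e j ∈ Submodule.span 𝕜 (e '' Set.Iio l) := fun j hj =>
    Submodule.subset_span ⟨j, hj, rfl⟩
  intro x hx
  induction hx using Submodule.span_induction with
  | mem x hx =>
    obtain ⟨j, hj, rfl⟩ := hx
    rw [Set.mem_Iio] at hj
    fin_cases k
    · show ha • e j ∈ _
      rcases Nat.lt_or_ge (j + 1) l with h1 | h1
      · rw [h.ha_smul j h1]
        exact Submodule.smul_mem _ _ (hmem _ h1)
      · rw [h.ha_smul_last j (by omega)]
        exact Submodule.zero_mem _
    · show hb • e j ∈ _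
      rw [h.hb_smul j hj]
      exact Submodule.smul_mem _ _ (hmem _ hj)
    · show hc • e j ∈ _
      rw [h.hc_smul j hj]
      exact Submodule.smul_mem _ _ (hmem _ hj)
    · show hd • e j ∈ _
      rcases j with _ | j
      · rw [h.hd_smul_zero]
        exact Submodule.zero_mem _
      · rw [h.hd_smul j hj]
        exact hmem _ (by omega)
  | zero => rw [smul_zero]; exact Submodule.zero_mem _
  | add x y _ _ hx hy => rw [smul_add]; exact Submodule.add_mem _ hx hy
  | smul c x _ hx => rw [smul_comm]; exact Submodule.smul_mem _ _ hx

/-- The submodule spanned by a string. -/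
def toSubmodule (h : IsString 𝕜 m n ξ l i e) : Submodule (H 𝕜 m n ξ) V :=
  ofGenStable (Submodule.span 𝕜 (e '' Set.Iio l)) h.gen_smul_mem

theorem mem_toSubmodule (h : IsString 𝕜 m n ξ l i e) {x : V} :
    x ∈ h.toSubmodule ↔ x ∈ Submodule.span 𝕜 (e '' Set.Iio l) := Iff.rfl

theorem apply_mem (h : IsString 𝕜 m n ξ l i e) {j : ℕ} (hj : j < l) : e j ∈ h.toSubmodule :=
  Submodule.subset_span ⟨j, hj, rfl⟩

theorem toSubmodule_le (h : IsString 𝕜 m n ξ l i e) {N : Submodule (H 𝕜 m n ξ) V}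
    (hN : ∀ j, j < l → e j ∈ N) : h.toSubmodule ≤ N := fun x hx => by
  have : Submodule.span 𝕜 (e '' Set.Iio l) ≤ N.restrictScalars 𝕜 :=
    Submodule.span_le.2 (by rintro _ ⟨j, hj, rfl⟩; exact hN j hj)
  exact this hx

theorem mem_span_singleton (h : IsString 𝕜 m n ξ l i e) (h0 : e 0 ≠ 0) {x : V}
    (hx : x ∈ h.toSubmodule) (hx0 : hd • x = 0) : x ∈ Submodule.span 𝕜 {e 0} :=
  mem_span_singleton_of_chain (D := Algebra.lsmul 𝕜 𝕜 V hd) h.hd_smul_zero h0 l h.hd_smul x hx hx0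

omit [IsScalarTower 𝕜 (H 𝕜 m n ξ) V] in
theorem ne_zero (h : IsString 𝕜 m n ξ l i e) (h0 : e 0 ≠ 0) (j : ℕ) (hj : j < l) : e j ≠ 0 := by
  induction j with
  | zero => exact h0
  | succ j ih =>
    intro e0
    refine ih (by omega) ?_
    rw [← h.hd_smul j hj, e0, smul_zero]

variable (hm : 1 < m) (hn : 1 < n) (hξ : IsPrimitiveRoot ξ (m * n)) (hl : l < n)
include hm hn hξ hl

theorem linearIndependent (h : IsString 𝕜 m n ξ l i e) (h0 : e 0 ≠ 0) :
    LinearIndependent 𝕜 (fun j : Fin l => e j) := by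
  refine Module.End.eigenvectors_linearIndependent' (Algebra.lsmul 𝕜 𝕜 V hc)
    (fun j : Fin l => ξ ^ (i + (j : ℕ) : ℤ)) (fun a b hab => ?_) _ fun j =>
      ⟨Module.End.mem_eigenspace_iff.2 (h.hc_smul j j.2), h.ne_zero h0 j j.2⟩
  have hlt : ∀ a b : ℕ, a < b → b < l → ξ ^ (i + a : ℤ) ≠ ξ ^ (i + b : ℤ) := fun a b h1 h2 =>
    ne_zpow_of_lt hξ (by positivity) (by omega)
      (by have : l < m * n := hl.trans_le (Nat.le_mul_of_pos_left n (by omega)); omega)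
  rcases lt_trichotomy (a : ℕ) b with h1 | h1 | h1
  exacts [absurd hab (hlt _ _ h1 b.2), Fin.ext h1, absurd hab.symm (hlt _ _ h1 a.2)]

theorem alph_ne_zero {k : ℕ} (h1 : k ≠ 0) (h2 : k < l) : alph 𝕜 m n ξ l i k ≠ 0 := by
  have hq := Rels.isPrimitiveRoot_q hm hn hξ
  rw [alph, if_neg (by omega)]
  exact mul_ne_zero (qInt_ne_zero hq h1 (by omega))
    (sub_ne_zero.2 (ne_zpow_of_lt hq (by omega) (by omega) (by omega)))

theorem le_of_apply_zero_mem (h : IsString 𝕜 m n ξ l i e) {N : Submodule (H 𝕜 m n ξ) V}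
    (hN : e 0 ∈ N) : h.toSubmodule ≤ N := by
  refine h.toSubmodule_le fun j => ?_
  induction j with
  | zero => exact fun _ => hN
  | succ j ih =>
    intro hj
    have e1 := N.smul_mem ha (ih (by omega))
    rw [h.ha_smul j hj] at e1
    have e2 := N.smul_of_tower_mem (alph 𝕜 m n ξ l i (j + 1))⁻¹ e1
    rwa [inv_smul_smul₀ (alph_ne_zero hm hn hξ hl (by omega) hj)] at e2

theorem isSimpleModule (h : IsString 𝕜 m n ξ l i e) (hl1 : 1 ≤ l) (h0 : e 0 ≠ 0) :
    IsSimpleModule (H 𝕜 m n ξ) h.toSubmodule := by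
  rw [isSimpleModule_iff_isAtom]
  refine ⟨(Submodule.ne_bot_iff _).2 ⟨e 0, h.apply_mem hl1, h0⟩, fun N hN => ?_⟩
  by_contra hne
  obtain ⟨y, hy, hy0, hdy⟩ := exists_ne_zero_hd_smul_eq_zero hne
  obtain ⟨c, rfl⟩ := Submodule.mem_span_singleton.1 (h.mem_span_singleton h0 (hN.le hy) hdy)
  refine hN.not_ge (h.le_of_apply_zero_mem hm hn hξ hl ?_)
  have e2 := N.smul_of_tower_mem c⁻¹ hy
  rwa [inv_smul_smul₀ (by rintro rfl; simp at hy0)] at e2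

theorem isMrep {W : Type} [AddCommGroup W] [Module 𝕜 W] [Module (H 𝕜 m n ξ) W]
    [IsScalarTower 𝕜 (H 𝕜 m n ξ) W] {e : ℕ → W} (h : IsString 𝕜 m n ξ l i e) (h0 : e 0 ≠ 0)
    (htop : h.toSubmodule = ⊤) : IsMrep 𝕜 m n ξ l i (fun j : Fin l => e j) := by
  refine ⟨h.linearIndependent hm hn hξ hl h0, ?_, fun j hj => h.ha_smul j hj,
    fun j hj => h.ha_smul_last j, fun j => h.hb_smul j j.2, fun j => h.hc_smul j j.2,
    fun j hj => h.hd_smul j hj, fun _ => h.hd_smul_zero⟩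
  have : (Set.range fun j : Fin l => e j) = e '' Set.Iio l := by
    ext x
    simp only [Set.mem_range, Set.mem_image, Set.mem_Iio]
    exact ⟨fun ⟨j, hj⟩ => ⟨j, j.2, hj⟩, fun ⟨j, hj, hx⟩ => ⟨⟨j, hj⟩, hx⟩⟩
  rw [this, eq_top_iff]
  intro x _
  have hx : x ∈ h.toSubmodule := htop ▸ Submodule.mem_top
  exact hx

end IsString

end Strings

section Scalars

variable {𝕜 m n ξ}

theorem alph_self {l : ℕ} {i : ℤ} (hl2 : l < n) : alph 𝕜 m n ξ l i l = 0 := by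
  rw [alph, if_neg hl2.ne, add_sub_cancel_right, sub_self, mul_zero]

variable (hm : 1 < m) (hn : 1 < n) (hξ : IsPrimitiveRoot ξ (m * n))
include hm hn hξ

theorem q_zpow_add_n (r : ℤ) : (ξ ^ m) ^ (r + n) = (ξ ^ m) ^ r := by
  have hq := Rels.isPrimitiveRoot_q hm hn hξ
  rw [zpow_add₀ (hq.ne_zero (by omega)), zpow_natCast, hq.pow_eq_one, mul_one]

theorem gam_sub {l : ℕ} {i : ℤ} (hl1 : 1 ≤ l) (hl2 : l < n) : gam 𝕜 m n ξ l i (n - l) = 0 := by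
  rw [gam, if_neg (by omega), ← q_zpow_add_n hm hn hξ (i - _), Nat.cast_sub hl2.le,
    show i - ((n : ℤ) - l) + n = i + l by ring, sub_self, mul_zero]

theorem gam_ne_zero {l k : ℕ} {i : ℤ} (h1 : k ≠ 0) (h2 : k + l < n) :
    gam 𝕜 m n ξ l i k ≠ 0 := by
  have hq := Rels.isPrimitiveRoot_q hm hn hξ
  rw [gam, if_neg (by omega)]
  exact mul_ne_zero (qInt_ne_zero hq h1 (by omega))
    (sub_ne_zero.2 (ne_zpow_of_lt hq (by omega) (by omega) (by omega)).symm)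

theorem alph_add {l k : ℕ} {i : ℤ} (h2 : l + k < n) :
    alph 𝕜 m n ξ l i (l + k) = alph 𝕜 m n ξ (n - l) (i + l) k := by
  have hq := Rels.isPrimitiveRoot_q hm hn hξ
  have h0 := hq.ne_zero (by omega)
  have h3 := hq.pow_eq_one
  refine mul_left_cancel₀ (sub_ne_zero.2 (hq.ne_one hn)) ?_
  rw [alph, alph, if_neg (by omega), if_neg (by omega), ← mul_assoc, ← mul_assoc,
    sub_one_mul_qInt, sub_one_mul_qInt, Nat.cast_sub (by omega)]
  rw [show i + l + ((n : ℤ) - l) - k = i - k + n by ring, q_zpow_add_n hm hn hξ, Nat.cast_add,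
    show i + l - (l + k : ℤ) = i - k by ring]
  simp only [zpow_add₀ h0, zpow_sub₀ h0, zpow_natCast, pow_add]
  field_simp

theorem gam_eq_alph {l k : ℕ} {i : ℤ} (h2 : l + k < n) (hl : 1 ≤ l) :
    gam 𝕜 m n ξ l i k = alph 𝕜 m n ξ (n - l) (i + l - n) k := by
  rw [alph, gam, if_neg (by omega), if_neg (by omega), Nat.cast_sub (by omega),
    ← q_zpow_add_n hm hn hξ (i + l - n)]
  ring_nf

theorem gam_add {l k : ℕ} {i : ℤ} (h2 : k < l) (hl : l < n) :
    gam 𝕜 m n ξ l i (n - l + k) = alph 𝕜 m n ξ l i k := by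
  have hq := Rels.isPrimitiveRoot_q hm hn hξ
  have h0 := hq.ne_zero (by omega)
  have h3 : (ξ ^ m) ^ (n - l + k) * (ξ ^ m) ^ l = (ξ ^ m) ^ k := by
    rw [← pow_add, show n - l + k + l = k + n by omega, pow_add, hq.pow_eq_one, mul_one]
  refine mul_left_cancel₀ (sub_ne_zero.2 (hq.ne_one hn)) ?_
  rw [alph, gam, if_neg (by omega), if_neg (by omega), ← mul_assoc, ← mul_assoc,
    sub_one_mul_qInt, sub_one_mul_qInt]
  rw [← q_zpow_add_n hm hn hξ (i - _), Nat.cast_add, Nat.cast_sub (by omega),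
    show i - (((n : ℤ) - l) + k) + n = i + l - k by ring]
  simp only [zpow_add₀ h0, zpow_sub₀ h0, zpow_natCast]
  field_simp
  linear_combination ((ξ ^ m) ^ k - 1) * h3

end Scalars

section Standard

variable {V : Type*} [AddCommGroup V] [Module 𝕜 V] [Module (H 𝕜 m n ξ) V]
  [IsScalarTower 𝕜 (H 𝕜 m n ξ) V]

/-- The span of the first `a` terms of `v` and the first `b` terms of `u`. -/
def spanLT (v u : ℕ → V) (a b : ℕ) : Submodule 𝕜 V :=
  Submodule.span 𝕜 (v '' Set.Iio a ∪ u '' Set.Iio b)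

/-- The first `n` terms of `v` and `u` form a standard basis of `P(l, i)`. -/
structure IsStd (l : ℕ) (i : ℤ) (v u : ℕ → V) : Prop where
  one_le : 1 ≤ l
  lt : l < n
  linearIndependent : LinearIndependent 𝕜 (Sum.elim (fun j : Fin n => v j) fun j : Fin n => u j)
  span : Submodule.span 𝕜 (v '' Set.Iio n ∪ u '' Set.Iio n) = ⊤
  ha_v : ∀ j, j + l + 2 ≤ n → ha • v j = gam 𝕜 m n ξ l i (j + 1) • v (j + 1)
  ha_v' : ∀ j, j + 1 < n → n ≤ j + 1 + l →
    ha • v j = gam 𝕜 m n ξ l i (j + 1) • v (j + 1) + u (j + 1 + l - n)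
  ha_v_last : ha • v (n - 1) = gam 𝕜 m n ξ l i n • v 0 + u l
  ha_u : ∀ j, j + 1 < n → ha • u j = alph 𝕜 m n ξ l i (j + 1) • u (j + 1)
  ha_u_last : ha • u (n - 1) = alph 𝕜 m n ξ l i n • u 0
  hb_v : ∀ j, j < n → hb • v j = ((ξ ^ m) ^ (i + (n : ℤ) - ((j : ℕ) + 1 : ℤ)) : 𝕜) • v j
  hb_u : ∀ j, j < n → hb • u j = ((ξ ^ m) ^ (i + (l : ℤ) - ((j : ℕ) + 1 : ℤ)) : 𝕜) • u j
  hc_v : ∀ j, j < n → hc • v j = (ξ ^ (i - ((n : ℤ) - (l : ℤ)) + (j : ℕ) : ℤ) : 𝕜) • v j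
  hc_u : ∀ j, j < n → hc • u j = (ξ ^ (i + (j : ℕ) : ℤ) : 𝕜) • u j
  hd_v_zero : hd • v 0 = 0
  hd_v : ∀ j, j + 1 < n → hd • v (j + 1) = v j
  hd_u_zero : hd • u 0 = 0
  hd_u : ∀ j, j + 1 < n → hd • u (j + 1) = u j

variable {𝕜 m n ξ}

theorem IsPrep.exists_isStd {P : Type} [AddCommGroup P] [Module 𝕜 P] [Module (H 𝕜 m n ξ) P]
    [IsScalarTower 𝕜 (H 𝕜 m n ξ) P] {l : ℕ} {hl1 : 1 ≤ l} {hl2 : l < n} {i : ℤ}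
    {v u : Fin n → P} (hP : IsPrep 𝕜 m n ξ l hl1 hl2 i v u) :
    ∃ v' u' : ℕ → P, IsStd 𝕜 m n ξ l i v' u' := by
  obtain ⟨p1, p2, p3, p4, p5, p6, p7, p8, p9, p10, p11, p12, p13, p14, p15⟩ := hP
  let E : (Fin n → P) → ℕ → P := fun w j => if h : j < n then w ⟨j, h⟩ else 0
  have hE : ∀ w j (h : j < n), E w j = w ⟨j, h⟩ := fun w j h => dif_pos h
  have hE' : ∀ w (j : Fin n), E w j = w j := fun w j => hE w j j.2
  have hr : ∀ w, E w '' Set.Iio n = Set.range w := fun w => by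
    ext x
    simp only [Set.mem_range, Set.mem_image, Set.mem_Iio]
    exact ⟨fun ⟨j, hj, hx⟩ => ⟨⟨j, hj⟩, by rw [← hx, hE]⟩, fun ⟨j, hj⟩ => ⟨j, j.2, by rw [← hj, hE']⟩⟩
  refine ⟨E v, E u, hl1, hl2, ?_, by rw [hr, hr, p2], fun j hj => ?_, fun j hj hj' => ?_, ?_,
    fun j hj => ?_, ?_, fun j hj => ?_, fun j hj => ?_, fun j hj => ?_, fun j hj => ?_, ?_,
    fun j hj => ?_, ?_, fun j hj => ?_⟩
  · simp only [hE']
    exact p1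
  · rw [hE _ _ (by omega), hE _ _ (by omega), p3 j hj]
  · rw [hE _ _ (by omega), hE _ _ (by omega), hE _ _ (by omega), p4 j hj hj']
  · rw [hE _ _ (by omega), hE _ _ (by omega), hE _ _ (by omega), p5]
  · rw [hE _ _ (by omega), hE _ _ (by omega), p6 j hj]
  · rw [hE _ _ (by omega), hE _ _ (by omega), p7]
  · rw [hE _ _ hj, p8]
  · rw [hE _ _ hj, p9]
  · rw [hE _ _ hj, p10]
  · rw [hE _ _ hj, p11]
  · rw [hE _ _ (by omega), p12]
  · rw [hE _ _ (by omega), hE _ _ (by omega), p13]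
  · rw [hE _ _ (by omega), p14]
  · rw [hE _ _ (by omega), hE _ _ (by omega), p15]

namespace IsStd

variable {l : ℕ} {i : ℤ} {v u : ℕ → V} (h : IsStd 𝕜 m n ξ l i v u)

theorem v_mem {a b j : ℕ} (hj : j < a) : v j ∈ spanLT 𝕜 v u a b :=
  Submodule.subset_span (.inl ⟨j, hj, rfl⟩)

theorem u_mem {a b j : ℕ} (hj : j < b) : u j ∈ spanLT 𝕜 v u a b :=
  Submodule.subset_span (.inr ⟨j, hj, rfl⟩)

theorem spanLT_le {a b : ℕ} {N : Submodule 𝕜 V} (h1 : ∀ j, j < a → v j ∈ N)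
    (h2 : ∀ j, j < b → u j ∈ N) : spanLT 𝕜 v u a b ≤ N :=
  Submodule.span_le.2 (by rintro _ (⟨j, hj, rfl⟩ | ⟨j, hj, rfl⟩); exacts [h1 j hj, h2 j hj])

include h

omit [IsScalarTower 𝕜 (H 𝕜 m n ξ) V] in
theorem v_notMem {a b : ℕ} (ha' : a < n) (hb' : b ≤ n) : v a ∉ spanLT 𝕜 v u a b := fun hx => by
  have e := h.linearIndependent.notMem_span_image (s := {.inl ⟨a, ha'⟩}ᶜ) (x := .inl ⟨a, ha'⟩)
    (by simp)
  refine e (Submodule.span_mono ?_ hx)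
  rintro _ (⟨j, hj, rfl⟩ | ⟨j, hj, rfl⟩)
  · rw [Set.mem_Iio] at hj
    exact ⟨.inl ⟨j, by omega⟩, by simp; omega, rfl⟩
  · rw [Set.mem_Iio] at hj
    exact ⟨.inr ⟨j, by omega⟩, by simp, rfl⟩

omit [IsScalarTower 𝕜 (H 𝕜 m n ξ) V] in
theorem u_notMem {a b : ℕ} (ha' : a ≤ n) (hb' : b < n) : u b ∉ spanLT 𝕜 v u a b := fun hx => by
  have e := h.linearIndependent.notMem_span_image (s := {.inr ⟨b, hb'⟩}ᶜ) (x := .inr ⟨b, hb'⟩)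
    (by simp)
  refine e (Submodule.span_mono ?_ hx)
  rintro _ (⟨j, hj, rfl⟩ | ⟨j, hj, rfl⟩)
  · rw [Set.mem_Iio] at hj
    exact ⟨.inl ⟨j, by omega⟩, by simp, rfl⟩
  · rw [Set.mem_Iio] at hj
    exact ⟨.inr ⟨j, by omega⟩, by simp; omega, rfl⟩

theorem gen_smul_mem {a b : ℕ} (ha' : a ≤ n) (hb' : b ≤ n)
    (hv : ∀ j, j < a → ha • v j ∈ spanLT 𝕜 v u a b)
    (hu : ∀ j, j < b → ha • u j ∈ spanLT 𝕜 v u a b) (k : Fin 4) :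
    ∀ x ∈ spanLT 𝕜 v u a b, gen 𝕜 m n ξ k • x ∈ spanLT 𝕜 v u a b := by
  intro x hx
  induction hx using Submodule.span_induction with
  | mem x hx =>
    obtain ⟨j, hj, rfl⟩ | ⟨j, hj, rfl⟩ := hx
    · rw [Set.mem_Iio] at hj
      fin_cases k
      · exact hv j hj
      · show hb • v j ∈ _
        rw [h.hb_v j (by omega)]
        exact Submodule.smul_mem _ _ (v_mem hj)
      · show hc • v j ∈ _
        rw [h.hc_v j (by omega)]
        exact Submodule.smul_mem _ _ (v_mem hj)
      · show hd • v j ∈ _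
        rcases j with _ | j
        · rw [h.hd_v_zero]
          exact Submodule.zero_mem _
        · rw [h.hd_v j (by omega)]
          exact v_mem (by omega)
    · rw [Set.mem_Iio] at hj
      fin_cases k
      · exact hu j hj
      · show hb • u j ∈ _
        rw [h.hb_u j (by omega)]
        exact Submodule.smul_mem _ _ (u_mem hj)
      · show hc • u j ∈ _
        rw [h.hc_u j (by omega)]
        exact Submodule.smul_mem _ _ (u_mem hj)
      · show hd • u j ∈ _
        rcases j with _ | j
        · rw [h.hd_u_zero]
          exact Submodule.zero_mem _
        · rw [h.hd_u j (by omega)]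
          exact u_mem (by omega)
  | zero => rw [smul_zero]; exact Submodule.zero_mem _
  | add x y _ _ hx hy => rw [smul_add]; exact Submodule.add_mem _ hx hy
  | smul c x _ hx => rw [smul_comm]; exact Submodule.smul_mem _ _ hx

omit [IsScalarTower 𝕜 (H 𝕜 m n ξ) V] in
theorem ha_u_mem {j : ℕ} (hj : j < n) (a : ℕ) : ha • u j ∈ spanLT 𝕜 v u a n := by
  rcases Nat.lt_or_ge (j + 1) n with h1 | h1
  · rw [h.ha_u j h1]
    exact Submodule.smul_mem _ _ (u_mem h1)
  · rw [show j = n - 1 by omega, h.ha_u_last]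
    exact Submodule.smul_mem _ _ (u_mem (by omega))

/-- The submodule spanned by `u`. -/
def subU : Submodule (H 𝕜 m n ξ) V :=
  ofGenStable (spanLT 𝕜 v u 0 n) (h.gen_smul_mem (Nat.zero_le _) le_rfl (fun j hj => by omega)
    fun j hj => h.ha_u_mem hj 0)

/-- The submodule spanned by the first `l` terms of `u`. -/
def subU' : Submodule (H 𝕜 m n ξ) V :=
  ofGenStable (spanLT 𝕜 v u 0 l) (h.gen_smul_mem (Nat.zero_le _) h.lt.le (fun j hj => by omega)
    fun j hj => by
      rw [h.ha_u j (by have := h.lt; omega)]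
      rcases Nat.lt_or_ge (j + 1) l with h1 | h1
      · exact Submodule.smul_mem _ _ (u_mem h1)
      · rw [show j + 1 = l by omega, alph_self h.lt, zero_smul]
        exact Submodule.zero_mem _)

omit [IsScalarTower 𝕜 (H 𝕜 m n ξ) V] in
theorem isString_u : IsString 𝕜 m n ξ l i u := by
  have := h.lt
  refine ⟨fun j hj => h.ha_u j (by omega), fun j hj => ?_, fun j hj => h.hb_u j (by omega),
    fun j hj => h.hc_u j (by omega), fun j hj => h.hd_u j (by omega), h.hd_u_zero⟩
  rw [h.ha_u j (by omega), hj, alph_self h.lt, zero_smul]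

theorem mkQ_u_eq_zero {j : ℕ} (hj : j < l) : (h.subU').mkQ (u j) = 0 := by
  rw [← LinearMap.mem_ker, Submodule.ker_mkQ]
  exact u_mem hj

variable (hm : 1 < m) (hn : 1 < n) (hξ : IsPrimitiveRoot ξ (m * n))
include hm hn hξ

/-- The submodule spanned by `u` and the first `n - l` terms of `v`. -/
def subUV : Submodule (H 𝕜 m n ξ) V :=
  ofGenStable (spanLT 𝕜 v u (n - l) n) (h.gen_smul_mem (Nat.sub_le _ _) le_rfl
    (fun j hj => by
      rcases Nat.lt_or_ge (j + 1 + l) n with h1 | h1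
      · rw [h.ha_v j (by omega)]
        exact Submodule.smul_mem _ _ (v_mem (by omega))
      · rw [h.ha_v' j (by have := h.one_le; omega) h1, show j + 1 = n - l by omega,
          gam_sub hm hn hξ h.one_le h.lt, zero_smul, zero_add]
        exact u_mem (by omega))
    fun j hj => h.ha_u_mem hj _)

theorem isString_mkQ_u :
    IsString 𝕜 m n ξ (n - l) (i + l) (fun j => (h.subU').mkQ (u (l + j))) := by
  have h1 := h.one_le
  have := h.lt
  have hmap : ∀ (c : 𝕜) x, (h.subU').mkQ (c • x) = c • (h.subU').mkQ x :=
    fun c x => LinearMap.map_smul_of_tower _ c x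
  refine ⟨fun j hj => ?_, fun j hj => ?_, fun j hj => ?_, fun j hj => ?_, fun j hj => ?_, ?_⟩
  · rw [← map_smul, h.ha_u _ (by omega), hmap, add_assoc,
      alph_add hm hn hξ (by omega)]
  · rw [← map_smul, show l + j = n - 1 by omega, h.ha_u_last, hmap, h.mkQ_u_eq_zero h1,
      smul_zero]
  · rw [← map_smul, h.hb_u _ (by omega), hmap, ← q_zpow_add_n hm hn hξ, Nat.cast_sub this.le]
    congr 2
    push_cast
    ring
  · rw [← map_smul, h.hc_u _ (by omega), hmap]
    congr 2
    push_cast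
    ring
  · rw [← map_smul, ← add_assoc, h.hd_u _ (by omega)]
  · have e := h.hd_u (l - 1) (by omega)
    rw [Nat.sub_add_cancel h1] at e
    rw [← map_smul, add_zero, e, h.mkQ_u_eq_zero (by omega)]

theorem isString_mkQ_v :
    IsString 𝕜 m n ξ (n - l) (i + l - n) (fun j => (h.subU').mkQ (v j)) := by
  have h1 := h.one_le
  have := h.lt
  have hmap : ∀ (c : 𝕜) x, (h.subU').mkQ (c • x) = c • (h.subU').mkQ x :=
    fun c x => LinearMap.map_smul_of_tower _ c x
  refine ⟨fun j hj => ?_, fun j hj => ?_, fun j hj => ?_, fun j hj => ?_, fun j hj => ?_, ?_⟩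
  · rw [← map_smul, h.ha_v _ (by omega), hmap, gam_eq_alph hm hn hξ (by omega) h1]
  · rw [← map_smul, h.ha_v' _ (by omega) (by omega), hj, gam_sub hm hn hξ h1 this, zero_smul,
      zero_add, h.mkQ_u_eq_zero (by omega)]
  · rw [← map_smul, h.hb_v _ (by omega), hmap, Nat.cast_sub this.le,
      ← q_zpow_add_n hm hn hξ (i + l - n + _ - _)]
    congr 2
    ring
  · rw [← map_smul, h.hc_v _ (by omega), hmap]
    congr 2
    ring
  · rw [← map_smul, h.hd_v _ (by omega)]
  · rw [← map_smul, h.hd_v_zero, map_zero]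

theorem isString_mkQ_v' :
    IsString 𝕜 m n ξ l i (fun j => (h.subUV hm hn hξ).mkQ (v (n - l + j))) := by
  have h1 := h.one_le
  have := h.lt
  have hmap : ∀ (c : 𝕜) x, (h.subUV hm hn hξ).mkQ (c • x) = c • (h.subUV hm hn hξ).mkQ x :=
    fun c x => LinearMap.map_smul_of_tower _ c x
  have hu : ∀ j, j < n → (h.subUV hm hn hξ).mkQ (u j) = 0 := fun j hj => by
    rw [← LinearMap.mem_ker, Submodule.ker_mkQ]
    exact u_mem hj
  have hv : ∀ j, j < n - l → (h.subUV hm hn hξ).mkQ (v j) = 0 := fun j hj => by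
    rw [← LinearMap.mem_ker, Submodule.ker_mkQ]
    exact v_mem hj
  refine ⟨fun j hj => ?_, fun j hj => ?_, fun j hj => ?_, fun j hj => ?_, fun j hj => ?_, ?_⟩
  · rw [← map_smul, h.ha_v' _ (by omega) (by omega), map_add, hmap, hu _ (by omega), add_zero,
      add_assoc, gam_add hm hn hξ hj this]
  · rw [← map_smul, show n - l + j = n - 1 by omega, h.ha_v_last, map_add, hmap,
      hv _ (by omega), hu _ this, smul_zero, add_zero]
  · rw [← map_smul, h.hb_v _ (by omega), hmap, Nat.cast_add, Nat.cast_sub this.le]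
    congr 2
    ring
  · rw [← map_smul, h.hc_v _ (by omega), hmap, Nat.cast_add, Nat.cast_sub this.le]
    congr 2
    ring
  · rw [← map_smul, ← add_assoc, h.hd_v _ (by omega)]
  · rw [← map_smul, add_zero, show n - l = n - l - 1 + 1 by omega, h.hd_v _ (by omega),
      hv _ (by omega)]

end IsStd

end Standard

section StringLemmas

variable {𝕜 m n ξ}
variable {V V' : Type*} [AddCommGroup V] [Module 𝕜 V] [Module (H 𝕜 m n ξ) V]
  [IsScalarTower 𝕜 (H 𝕜 m n ξ) V] [AddCommGroup V'] [Module 𝕜 V'] [Module (H 𝕜 m n ξ) V']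
  [IsScalarTower 𝕜 (H 𝕜 m n ξ) V']

theorem covBy_comap_mkQ {R M : Type*} [Ring R] [AddCommGroup M] [Module R M] {N : Submodule R M}
    {S : Submodule R (M ⧸ N)} (hS : IsSimpleModule R S) : N ⋖ S.comap N.mkQ := by
  rw [isSimpleModule_iff_isAtom] at hS
  have hle : N ≤ S.comap N.mkQ := fun x hx => by
    rw [Submodule.mem_comap, Submodule.mkQ_apply, (Submodule.Quotient.mk_eq_zero N).2 hx]
    exact S.zero_mem
  refine ⟨lt_of_le_of_ne hle fun e => hS.1 ?_, fun X h1 h2 => ?_⟩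
  · rw [eq_bot_iff]
    intro y hy
    obtain ⟨x, rfl⟩ := N.mkQ_surjective y
    have hx : x ∈ S.comap N.mkQ := hy
    rw [← e] at hx
    exact (Submodule.Quotient.mk_eq_zero N).2 hx
  · have e1 : (X.map N.mkQ).comap N.mkQ = X := by
      rw [Submodule.comap_map_eq, Submodule.ker_mkQ, sup_eq_left.2 h1.le]
    rcases hS.le_iff.1 (Submodule.map_le_iff_le_comap.2 h2.le) with e | e
    · rw [e] at e1
      exact h1.not_ge (e1 ▸ by rw [Submodule.comap_bot, Submodule.ker_mkQ])
    · rw [e] at e1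
      exact h2.ne e1.symm

namespace IsString

variable {l : ℕ} {i : ℤ} {e : ℕ → V}

theorem mem_comap_mkQ {N : Submodule (H 𝕜 m n ξ) V}
    (h : IsString 𝕜 m n ξ l i (fun j => N.mkQ (e j))) (x : V) :
    x ∈ h.toSubmodule.comap N.mkQ ↔
      x ∈ N.restrictScalars 𝕜 ⊔ Submodule.span 𝕜 (e '' Set.Iio l) := by
  have e1 : Submodule.span 𝕜 ((fun j => N.mkQ (e j)) '' Set.Iio l) =
      (Submodule.span 𝕜 (e '' Set.Iio l)).map (N.mkQ.restrictScalars 𝕜) := by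
    rw [Submodule.map_span, Set.image_image]
    rfl
  rw [Submodule.mem_comap, mem_toSubmodule, e1, Submodule.mem_map, Submodule.mem_sup]
  constructor
  · rintro ⟨y, hy, hxy⟩
    refine ⟨x - y, ?_, y, hy, sub_add_cancel _ _⟩
    exact (Submodule.Quotient.eq N).1 hxy.symm
  · rintro ⟨y, hy, z, hz, rfl⟩
    refine ⟨z, hz, ?_⟩
    have hy0 : N.mkQ y = 0 := (Submodule.Quotient.mk_eq_zero N).2 hy
    rw [map_add, hy0, zero_add]
    rfl

theorem exists_lift (h : IsString 𝕜 m n ξ l i e) (hl : 1 ≤ l) {f : V' →ₗ[H 𝕜 m n ξ] V}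
    (hf : Function.Injective f) (he : ∀ j, j < l → e j ∈ LinearMap.range f) :
    ∃ e' : ℕ → V', IsString 𝕜 m n ξ l i e' ∧ ∀ j, j < l → f (e' j) = e j := by
  have h1 : ∀ j, ∃ x, j < l → f x = e j := fun j => by
    by_cases hj : j < l
    · obtain ⟨x, hx⟩ := he j hj
      exact ⟨x, fun _ => hx⟩
    · exact ⟨0, fun hj' => absurd hj' hj⟩
  choose e' he' using h1
  refine ⟨e', of_injective hf ⟨fun j hj => ?_, fun j hj => ?_, fun j hj => ?_, fun j hj => ?_,
    fun j hj => ?_, ?_⟩, he'⟩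
  · rw [he' _ hj, he' _ (by omega), h.ha_smul j hj]
  · rw [he' _ (by omega), h.ha_smul_last j hj]
  · rw [he' _ hj, h.hb_smul j hj]
  · rw [he' _ hj, h.hc_smul j hj]
  · rw [he' _ hj, he' _ (by omega), h.hd_smul j hj]
  · rw [he' _ hl, h.hd_smul_zero]

theorem exists_isMrep (hm : 1 < m) (hn : 1 < n) (hξ : IsPrimitiveRoot ξ (m * n)) (hl : l < n)
    {W : Type} [AddCommGroup W] [Module 𝕜 W] [Module (H 𝕜 m n ξ) W]
    [IsScalarTower 𝕜 (H 𝕜 m n ξ) W] {e : ℕ → W} (h : IsString 𝕜 m n ξ l i e) (hl1 : 1 ≤ l)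
    (h0 : e 0 ≠ 0) : ∃ mv : Fin l → h.toSubmodule, IsMrep 𝕜 m n ξ l i mv := by
  obtain ⟨e', he', hee⟩ := h.exists_lift hl1 (f := h.toSubmodule.subtype)
    Subtype.val_injective fun j hj => ⟨⟨e j, h.apply_mem hj⟩, rfl⟩
  refine ⟨_, he'.isMrep hm hn hξ hl (fun h1 => h0 ?_) (eq_top_iff.2 fun x _ => ?_)⟩
  · rw [← hee 0 hl1, h1, map_zero]
  · have h2 := h.toSubmodule_le (N := he'.toSubmodule.map h.toSubmodule.subtype) (fun j hj =>
      ⟨e' j, he'.apply_mem hj, hee j hj⟩) x.2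
    obtain ⟨y, hy, hyx⟩ := h2
    rwa [← Subtype.ext hyx]

end IsString

end StringLemmas

section Casimir

variable {𝕜 m n ξ}
variable {V : Type*} [AddCommGroup V] [Module 𝕜 V] [Module (H 𝕜 m n ξ) V]
  [IsScalarTower 𝕜 (H 𝕜 m n ξ) V]

theorem casH_mul_hdPow (r : ℕ) : casH 𝕜 m n ξ * hd ^ r = hd ^ r * casH 𝕜 m n ξ :=
  (Commute.pow_right casH_mul_hd r : Commute (casH 𝕜 m n ξ) (hd ^ r))

theorem hcPow_smul {x : V} {i : ℤ} (h : hc • x = (ξ ^ i) • x) (k : ℕ) :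
    hc ^ k • x = (ξ ^ k) ^ i • x := by
  induction k with
  | zero => simp
  | succ k ih =>
    rw [pow_succ, mul_smul, h, smul_comm, ih, smul_smul, pow_succ, mul_zpow, mul_comm]

namespace IsStd

variable {l : ℕ} {i : ℤ} {v u : ℕ → V} (h : IsStd 𝕜 m n ξ l i v u)
include h

omit [IsScalarTower 𝕜 (H 𝕜 m n ξ) V] in
theorem hdPow_v (r j : ℕ) (hj : j + r < n) : hd ^ r • v (j + r) = v j := by
  induction r with
  | zero => rw [pow_zero, one_smul, add_zero]
  | succ r ih => rw [pow_succ, mul_smul, ← add_assoc, h.hd_v (j + r) hj, ih (by omega)]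

omit [IsScalarTower 𝕜 (H 𝕜 m n ξ) V] in
theorem hdPow_u (r j : ℕ) (hj : j + r < n) : hd ^ r • u (j + r) = u j := by
  induction r with
  | zero => rw [pow_zero, one_smul, add_zero]
  | succ r ih => rw [pow_succ, mul_smul, ← add_assoc, h.hd_u (j + r) hj, ih (by omega)]

variable (hm : 1 < m) (hn : 1 < n) (hξ : IsPrimitiveRoot ξ (m * n))
include hm hn hξ

theorem casH_u {j : ℕ} (hj : j < n) :
    casH 𝕜 m n ξ • u j = kap (ξ ^ m) ((ξ ^ m) ^ i) l 0 • u j := by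
  have hq := Rels.isPrimitiveRoot_q hm hn hξ
  have h0 := hq.ne_zero (by omega)
  have hlast : casH 𝕜 m n ξ • u (n - 1) = kap (ξ ^ m) ((ξ ^ m) ^ i) l 0 • u (n - 1) := by
    rw [casH, sub_smul, sub_smul, smul_assoc, mul_smul, h.ha_u_last, smul_comm hd, h.hd_u_zero,
      smul_zero, smul_zero, h.hb_u _ (by omega), smul_assoc,
      hcPow_smul (h.hc_u _ (by omega)) m, kap, Nat.cast_sub hn.le,
      ← q_zpow_add_n hm hn hξ (i + l - _), smul_smul, ← zpow_one_add₀ h0,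
      show i + l - ((n : ℤ) - (1 : ℕ) + 1) + n = i + l by push_cast; ring,
      show 1 + (i + ((n : ℤ) - (1 : ℕ))) = i + n by push_cast; ring, q_zpow_add_n hm hn hξ,
      zpow_add₀ h0, add_zero, neg_zero, zpow_zero]
    module
  obtain ⟨r, hr⟩ : ∃ r, n - 1 = j + r := ⟨n - 1 - j, by omega⟩
  have e := congrArg (hd ^ r • ·) hlast
  rwa [← mul_smul, ← casH_mul_hdPow, mul_smul, smul_comm (hd ^ r), hr,
    h.hdPow_u r j (by omega)] at e

theorem casH_v_last : casH 𝕜 m n ξ • v (n - 1) =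
    kap (ξ ^ m) ((ξ ^ m) ^ i) l 0 • v (n - 1) + (ξ ^ m - 1) • u (l - 1) := by
  have hq := Rels.isPrimitiveRoot_q hm hn hξ
  have h0 := hq.ne_zero (by omega)
  have h1 := h.one_le
  have h2 := h.lt
  have h3 := h.hd_u (l - 1) (by omega)
  rw [Nat.sub_add_cancel h1] at h3
  rw [casH, sub_smul, sub_smul, smul_assoc, mul_smul, h.ha_v_last, smul_add, smul_comm hd,
    h.hd_v_zero, smul_zero, zero_add, h.hb_v _ (by omega), smul_assoc, h3,
    hcPow_smul (h.hc_v _ (by omega)) m, kap, Nat.cast_sub hn.le,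
    smul_smul, ← zpow_one_add₀ h0,
    show i + n - ((n : ℤ) - (1 : ℕ) + 1) = i by push_cast; ring,
    show 1 + (i - ((n : ℤ) - l) + ((n : ℤ) - (1 : ℕ))) = i + l by push_cast; ring,
    zpow_add₀ h0, add_zero, neg_zero, zpow_zero]
  module

theorem casH_v {j : ℕ} (hj : j < n - l) :
    casH 𝕜 m n ξ • v j = kap (ξ ^ m) ((ξ ^ m) ^ i) l 0 • v j := by
  have h1 := h.one_le
  have h2 := h.lt
  obtain ⟨r, hr⟩ : ∃ r, n - 1 = j + (r + l) := ⟨n - 1 - j - l, by omega⟩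
  have e := congrArg (hd ^ (r + l) • ·) (h.casH_v_last hm hn hξ)
  have e1 := h.hdPow_u (l - 1) 0 (by omega)
  rw [zero_add] at e1
  have e2 : hd ^ (r + l) • u (l - 1) = 0 := by
    rw [show r + l = r + 1 + (l - 1) by omega, pow_add, mul_smul, e1, pow_succ, mul_smul,
      h.hd_u_zero, smul_zero]
  rwa [← mul_smul, ← casH_mul_hdPow, mul_smul, smul_add, smul_comm (hd ^ (r + l)),
    smul_comm (hd ^ (r + l)), e2, smul_zero, add_zero, hr, h.hdPow_v _ j (by omega)] at e

theorem casH_v' {j : ℕ} (hj : j < l) :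
    casH 𝕜 m n ξ • v (n - l + j) =
      kap (ξ ^ m) ((ξ ^ m) ^ i) l 0 • v (n - l + j) + (ξ ^ m - 1) • u j := by
  have h2 := h.lt
  obtain ⟨r, hr⟩ : ∃ r, l - 1 = j + r := ⟨l - 1 - j, by omega⟩
  have e := congrArg (hd ^ r • ·) (h.casH_v_last hm hn hξ)
  rwa [← mul_smul, ← casH_mul_hdPow, mul_smul, smul_add, smul_comm (hd ^ r), smul_comm (hd ^ r),
    hr, show n - 1 = n - l + j + r by omega, h.hdPow_v _ _ (by omega),
    h.hdPow_u _ _ (by omega)] at e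

theorem casH_of_mem {x : V} (hx : x ∈ h.subUV hm hn hξ) :
    casH 𝕜 m n ξ • x = kap (ξ ^ m) ((ξ ^ m) ^ i) l 0 • x := by
  have : spanLT 𝕜 v u (n - l) n ≤ LinearMap.eqLocus (Algebra.lsmul 𝕜 𝕜 V (casH 𝕜 m n ξ))
      (kap (ξ ^ m) ((ξ ^ m) ^ i) l 0 • LinearMap.id) :=
    spanLT_le (fun j hj => h.casH_v hm hn hξ hj) fun j hj => h.casH_u hm hn hξ hj
  exact this hx

theorem casH_casH (x : V) :
    casH 𝕜 m n ξ • (casH 𝕜 m n ξ • x - kap (ξ ^ m) ((ξ ^ m) ^ i) l 0 • x) =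
      kap (ξ ^ m) ((ξ ^ m) ^ i) l 0 •
        (casH 𝕜 m n ξ • x - kap (ξ ^ m) ((ξ ^ m) ^ i) l 0 • x) := by
  refine h.casH_of_mem hm hn hξ ?_
  have h2 := h.lt
  have : spanLT 𝕜 v u n n ≤ (spanLT 𝕜 v u (n - l) n).comap
      (Algebra.lsmul 𝕜 𝕜 V (casH 𝕜 m n ξ) - kap (ξ ^ m) ((ξ ^ m) ^ i) l 0 • LinearMap.id) := by
    refine spanLT_le (fun j hj => ?_) fun j hj => ?_
    · show casH 𝕜 m n ξ • v j - kap (ξ ^ m) ((ξ ^ m) ^ i) l 0 • v j ∈ spanLT 𝕜 v u (n - l) n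
      rcases Nat.lt_or_ge j (n - l) with h3 | h3
      · rw [h.casH_v hm hn hξ h3, sub_self]
        exact Submodule.zero_mem _
      · obtain ⟨r, rfl⟩ := Nat.exists_eq_add_of_le h3
        rw [h.casH_v' hm hn hξ (by omega), add_sub_cancel_left]
        exact Submodule.smul_mem _ _ (u_mem (by omega))
    · show casH 𝕜 m n ξ • u j - kap (ξ ^ m) ((ξ ^ m) ^ i) l 0 • u j ∈ spanLT 𝕜 v u (n - l) n
      rw [h.casH_u hm hn hξ hj, sub_self]
      exact Submodule.zero_mem _
  have hx : x ∈ spanLT 𝕜 v u n n := by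
    rw [spanLT, h.span]
    exact Submodule.mem_top
  exact this hx

end IsStd

end Casimir

section Lattice

variable {𝕜 m n ξ}
variable {V : Type*} [AddCommGroup V] [Module 𝕜 V] [Module (H 𝕜 m n ξ) V]
  [IsScalarTower 𝕜 (H 𝕜 m n ξ) V]

namespace IsStd

variable {l : ℕ} {i : ℤ} {v u : ℕ → V} (h : IsStd 𝕜 m n ξ l i v u)
include h

omit [IsScalarTower 𝕜 (H 𝕜 m n ξ) V] in
theorem u_zero_ne_zero : u 0 ≠ 0 := fun e =>
  h.u_notMem (a := 0) (b := 0) (Nat.zero_le _) (by have := h.lt; omega)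
    (by rw [e]; exact Submodule.zero_mem _)

omit [IsScalarTower 𝕜 (H 𝕜 m n ξ) V] in
theorem mem_spanLT (x : V) : x ∈ spanLT 𝕜 v u n n := by
  rw [spanLT, h.span]
  exact Submodule.mem_top

theorem subU'_eq : h.subU' = h.isString_u.toSubmodule := by
  ext x
  have : Set.Iio 0 = (∅ : Set ℕ) := by ext; simp
  rw [IsString.mem_toSubmodule, subU', mem_ofGenStable, spanLT, this, Set.image_empty,
    Set.empty_union]

theorem mem_span_pair {y : V} (hy : hd • y = 0) : ∃ c c' : 𝕜, y = c • v 0 + c' • u 0 := by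
  have h2 := h.lt
  have e1 := mem_span_singleton_of_chain (D := Algebra.lsmul 𝕜 𝕜 (V ⧸ h.subU) hd)
    (e := fun j => h.subU.mkQ (v j))
    (show hd • h.subU.mkQ (v 0) = 0 by rw [← map_smul, h.hd_v_zero, map_zero])
    (fun e => h.v_notMem (b := n) (by omega : 0 < n) le_rfl
      ((Submodule.Quotient.mk_eq_zero h.subU).1 e)) n
    (fun j hj => show hd • h.subU.mkQ (v (j + 1)) = _ by rw [← map_smul, h.hd_v j hj])
    (h.subU.mkQ y) ?_ (show hd • h.subU.mkQ y = 0 by rw [← map_smul, hy, map_zero])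
  · obtain ⟨c, hc0⟩ := Submodule.mem_span_singleton.1 e1
    have e2 : y - c • v 0 ∈ h.subU := by
      rw [← Submodule.Quotient.mk_eq_zero, Submodule.Quotient.mk_sub, sub_eq_zero]
      exact hc0.symm
    have e3 : Set.Iio 0 = (∅ : Set ℕ) := by ext; simp
    rw [subU, mem_ofGenStable, spanLT, e3, Set.image_empty, Set.empty_union] at e2
    have e4 := mem_span_singleton_of_chain (D := Algebra.lsmul 𝕜 𝕜 V hd) h.hd_u_zero
      h.u_zero_ne_zero n h.hd_u _ e2
      (show hd • (y - c • v 0) = 0 by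
        rw [smul_sub, smul_comm, hy, h.hd_v_zero, smul_zero, sub_zero])
    obtain ⟨c', hc'⟩ := Submodule.mem_span_singleton.1 e4
    exact ⟨c, c', by rw [hc']; abel⟩
  · have : spanLT 𝕜 v u n n ≤ (Submodule.span 𝕜 ((fun j => h.subU.mkQ (v j)) '' Set.Iio n)).comap
        (h.subU.mkQ.restrictScalars 𝕜) := by
      refine spanLT_le (fun j hj => Submodule.subset_span ⟨j, hj, rfl⟩) fun j hj => ?_
      have e : h.subU.mkQ (u j) = 0 := (Submodule.Quotient.mk_eq_zero h.subU).2 (u_mem hj)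
      rw [Submodule.mem_comap, LinearMap.restrictScalars_apply, e]
      exact Submodule.zero_mem _
    exact this (h.mem_spanLT y)

theorem subU'_ne_bot : h.subU' ≠ ⊥ :=
  (Submodule.ne_bot_iff _).2 ⟨u 0, u_mem h.one_le, h.u_zero_ne_zero⟩

theorem mkQ_u_ne_zero : h.subU'.mkQ (u (l + 0)) ≠ 0 := fun e =>
  h.u_notMem (a := 0) (Nat.zero_le _) h.lt ((Submodule.Quotient.mk_eq_zero h.subU').1 e)

theorem mkQ_v_ne_zero : h.subU'.mkQ (v 0) ≠ 0 := fun e =>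
  h.v_notMem (a := 0) (b := l) (by have := h.lt; omega) h.lt.le
    ((Submodule.Quotient.mk_eq_zero h.subU').1 e)

variable (hm : 1 < m) (hn : 1 < n) (hξ : IsPrimitiveRoot ξ (m * n))
include hm hn hξ

theorem subU'_isSimple : IsSimpleModule (H 𝕜 m n ξ) h.subU' := by
  rw [h.subU'_eq]
  exact h.isString_u.isSimpleModule hm hn hξ h.lt h.one_le h.u_zero_ne_zero

theorem u_zero_mem_of_v_zero_mem {N : Submodule (H 𝕜 m n ξ) V} (hN : v 0 ∈ N) : u 0 ∈ N := by
  have h1 := h.one_le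
  have h2 := h.lt
  have key : ∀ j, j < n - l → v j ∈ N := fun j => by
    induction j with
    | zero => exact fun _ => hN
    | succ j ih =>
      intro hj
      have e1 := N.smul_mem ha (ih (by omega))
      rw [h.ha_v j (by omega)] at e1
      have e2 := N.smul_of_tower_mem (gam 𝕜 m n ξ l i (j + 1))⁻¹ e1
      rwa [inv_smul_smul₀ (gam_ne_zero hm hn hξ (by omega) (by omega))] at e2
  have e1 := N.smul_mem ha (key (n - l - 1) (by omega))
  rwa [h.ha_v' _ (by omega) (by omega), Nat.sub_add_cancel (by omega), gam_sub hm hn hξ h1 h2,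
    zero_smul, zero_add, Nat.sub_add_cancel h2.le, Nat.sub_self] at e1

theorem subU'_le {N : Submodule (H 𝕜 m n ξ) V} (hN : N ≠ ⊥) : h.subU' ≤ N := by
  have h1 := h.one_le
  have h2 := h.lt
  rw [h.subU'_eq]
  refine h.isString_u.le_of_apply_zero_mem hm hn hξ h2 ?_
  obtain ⟨y, hy, hy0, hdy⟩ := exists_ne_zero_hd_smul_eq_zero hN
  obtain ⟨c, c', rfl⟩ := h.mem_span_pair hdy
  rcases eq_or_ne c 0 with rfl | hc0
  · rw [zero_smul, zero_add] at hy hy0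
    have e2 := N.smul_of_tower_mem c'⁻¹ hy
    rwa [inv_smul_smul₀ (by rintro rfl; simp at hy0)] at e2
  · refine h.u_zero_mem_of_v_zero_mem hm hn hξ ?_
    have e1 := N.sub_mem (N.smul_mem hc hy) (N.smul_of_tower_mem (ξ ^ i) hy)
    rw [smul_add, smul_comm hc, smul_comm hc, h.hc_v 0 (by omega), h.hc_u 0 (by omega),
      Nat.cast_zero, add_zero, add_zero] at e1
    have hne : ξ ^ (i - ((n : ℤ) - l)) ≠ ξ ^ i :=
      ne_zpow_of_lt hξ (by positivity) (by omega)
        (by have := Nat.le_mul_of_pos_left n (by omega : 0 < m); omega)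
    have e2 : (c * (ξ ^ (i - ((n : ℤ) - l)) - ξ ^ i)) • v 0 ∈ N := by
      convert e1 using 1
      module
    have e3 := N.smul_of_tower_mem (c * (ξ ^ (i - ((n : ℤ) - l)) - ξ ^ i))⁻¹ e2
    rwa [inv_smul_smul₀ (mul_ne_zero hc0 (sub_ne_zero.2 hne))] at e3

theorem eq_top_of_v_last_mem {N : Submodule (H 𝕜 m n ξ) V} (hN : v (n - 1) ∈ N) : N = ⊤ := by
  have h1 := h.one_le
  have h2 := h.lt
  have hv : ∀ j, j < n → v j ∈ N := fun j hj => by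
    have e := N.smul_mem (hd ^ (n - 1 - j)) hN
    rwa [show n - 1 = j + (n - 1 - j) by omega, Nat.add_sub_cancel_left,
      h.hdPow_v _ _ (by omega)] at e
  have hu : ∀ j, l + j < n → u (l + j) ∈ N := fun j => by
    induction j with
    | zero =>
      intro _
      have e := N.sub_mem (N.smul_mem ha hN)
        (N.smul_of_tower_mem (gam 𝕜 m n ξ l i n) (hv 0 (by omega)))
      rwa [h.ha_v_last, add_sub_cancel_left] at e
    | succ j ih =>
      intro hj
      have e1 := N.smul_mem ha (ih (by omega))
      rw [h.ha_u (l + j) hj, add_assoc, alph_add hm hn hξ (by omega)] at e1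
      have e2 := N.smul_of_tower_mem (alph 𝕜 m n ξ (n - l) (i + l) (j + 1))⁻¹ e1
      rwa [inv_smul_smul₀ (IsString.alph_ne_zero hm hn hξ (by omega) (by omega) (by omega))] at e2
  have hu' : ∀ j, j < n → u j ∈ N := fun j hj => by
    have e := N.smul_mem (hd ^ (n - 1 - j)) (hu (n - 1 - l) (by omega))
    rwa [show l + (n - 1 - l) = j + (n - 1 - j) by omega, h.hdPow_u _ _ (by omega)] at e
  rw [eq_top_iff]
  intro x _
  have : spanLT 𝕜 v u n n ≤ N.restrictScalars 𝕜 := spanLT_le hv hu'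
  exact this (h.mem_spanLT x)

theorem mkQ_v_ne_zero' : (h.subUV hm hn hξ).mkQ (v (n - l + 0)) ≠ 0 := fun e =>
  h.v_notMem (a := n - l) (b := n) (by have := h.one_le; omega) le_rfl
    ((Submodule.Quotient.mk_eq_zero (h.subUV hm hn hξ)).1 e)

theorem comap_mkQ_u : (h.isString_mkQ_u hm hn hξ).toSubmodule.comap h.subU'.mkQ = h.subU := by
  have h2 := h.lt
  ext x
  rw [IsString.mem_comap_mkQ (e := fun j => u (l + j))]
  constructor
  · have : h.subU'.restrictScalars 𝕜 ⊔ Submodule.span 𝕜 ((fun j => u (l + j)) '' Set.Iio (n - l)) ≤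
        spanLT 𝕜 v u 0 n := by
      refine sup_le (spanLT_le (fun j hj => by omega) fun j hj => u_mem (by omega)) ?_
      rw [Submodule.span_le]
      rintro _ ⟨j, hj, rfl⟩
      rw [Set.mem_Iio] at hj
      exact u_mem (by omega)
    exact fun hx => this hx
  · have : spanLT 𝕜 v u 0 n ≤ h.subU'.restrictScalars 𝕜 ⊔
        Submodule.span 𝕜 ((fun j => u (l + j)) '' Set.Iio (n - l)) := by
      refine spanLT_le (fun j hj => by omega) fun j hj => ?_
      rcases Nat.lt_or_ge j l with h3 | h3
      · exact Submodule.mem_sup_left (u_mem h3)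
      · exact Submodule.mem_sup_right (Submodule.subset_span ⟨j - l, by simp; omega, by
          simp only; rw [Nat.add_sub_cancel' h3]⟩)
    exact fun hx => this hx

theorem subU'_le_subU : h.subU' ≤ h.subU := by
  rw [← h.comap_mkQ_u hm hn hξ]
  exact (covBy_comap_mkQ ((h.isString_mkQ_u hm hn hξ).isSimpleModule hm hn hξ
    (by have := h.one_le; omega) (by have := h.lt; omega) (h.mkQ_u_ne_zero))).le

theorem isString_mkQ_subU_v :
    IsString 𝕜 m n ξ (n - l) (i + l - n) (fun j => h.subU.mkQ (v j)) :=
  (h.isString_mkQ_v hm hn hξ).map (Submodule.factor (h.subU'_le_subU hm hn hξ))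

theorem comap_mkQ_v :
    (h.isString_mkQ_subU_v hm hn hξ).toSubmodule.comap h.subU.mkQ = h.subUV hm hn hξ := by
  have h2 := h.lt
  ext x
  rw [IsString.mem_comap_mkQ (e := v)]
  constructor
  · have : h.subU.restrictScalars 𝕜 ⊔ Submodule.span 𝕜 (v '' Set.Iio (n - l)) ≤
        spanLT 𝕜 v u (n - l) n := by
      refine sup_le (spanLT_le (fun j hj => by omega) fun j hj => u_mem (by omega)) ?_
      rw [Submodule.span_le]
      rintro _ ⟨j, hj, rfl⟩
      exact v_mem hj
    exact fun hx => this hx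
  · have : spanLT 𝕜 v u (n - l) n ≤ h.subU.restrictScalars 𝕜 ⊔
        Submodule.span 𝕜 (v '' Set.Iio (n - l)) :=
      spanLT_le (fun j hj => Submodule.mem_sup_right (Submodule.subset_span ⟨j, hj, rfl⟩))
        fun j hj => Submodule.mem_sup_left (u_mem hj)
    exact fun hx => this hx

theorem comap_mkQ_v' :
    (h.isString_mkQ_v' hm hn hξ).toSubmodule.comap (h.subUV hm hn hξ).mkQ = ⊤ := by
  have h1 := h.one_le
  rw [eq_top_iff]
  intro x _
  rw [IsString.mem_comap_mkQ (e := fun j => v (n - l + j))]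
  have : spanLT 𝕜 v u n n ≤ (h.subUV hm hn hξ).restrictScalars 𝕜 ⊔
      Submodule.span 𝕜 ((fun j => v (n - l + j)) '' Set.Iio l) := by
    refine spanLT_le (fun j hj => ?_) fun j hj => Submodule.mem_sup_left (u_mem hj)
    rcases Nat.lt_or_ge j (n - l) with h3 | h3
    · exact Submodule.mem_sup_left (v_mem h3)
    · exact Submodule.mem_sup_right (Submodule.subset_span ⟨j - (n - l), by simp; omega, by
        simp only; rw [Nat.add_sub_cancel' h3]⟩)
  exact this (h.mem_spanLT x)

theorem toSubmodule_mkQ_v' : (h.isString_mkQ_v' hm hn hξ).toSubmodule = ⊤ := by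
  rw [eq_top_iff]
  intro y _
  obtain ⟨x, rfl⟩ := (h.subUV hm hn hξ).mkQ_surjective y
  have : x ∈ (h.isString_mkQ_v' hm hn hξ).toSubmodule.comap (h.subUV hm hn hξ).mkQ := by
    rw [h.comap_mkQ_v' hm hn hξ]
    exact Submodule.mem_top
  exact this

theorem bot_covBy : ⊥ ⋖ h.subU' :=
  bot_covBy_iff.2 (isSimpleModule_iff_isAtom.1 (h.subU'_isSimple hm hn hξ))

theorem subU'_covBy : h.subU' ⋖ h.subU := by
  have h1 := h.one_le
  have h2 := h.lt
  have := covBy_comap_mkQ ((h.isString_mkQ_u hm hn hξ).isSimpleModule hm hn hξ (by omega)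
    (by omega) (h.mkQ_u_ne_zero))
  rwa [h.comap_mkQ_u hm hn hξ] at this

theorem subU_covBy : h.subU ⋖ h.subUV hm hn hξ := by
  have h1 := h.one_le
  have h2 := h.lt
  have := covBy_comap_mkQ ((h.isString_mkQ_subU_v hm hn hξ).isSimpleModule hm hn hξ (by omega)
    (by omega) fun e => h.v_notMem (b := n) (by omega : 0 < n) le_rfl
      ((Submodule.Quotient.mk_eq_zero h.subU).1 e))
  rwa [h.comap_mkQ_v hm hn hξ] at this

theorem subUV_covBy : h.subUV hm hn hξ ⋖ ⊤ := by
  have := covBy_comap_mkQ ((h.isString_mkQ_v' hm hn hξ).isSimpleModule hm hn hξ h.lt h.one_le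
    (h.mkQ_v_ne_zero' hm hn hξ))
  rwa [h.comap_mkQ_v' hm hn hξ] at this

end IsStd

end Lattice

section ProjInj

variable {𝕜 m n ξ}
variable {V : Type*} [AddCommGroup V] [Module 𝕜 V] [Module (H 𝕜 m n ξ) V]
  [IsScalarTower 𝕜 (H 𝕜 m n ξ) V]

namespace IsStd

variable {l : ℕ} {i : ℤ} {v u : ℕ → V} (h : IsStd 𝕜 m n ξ l i v u)
include h

/-- The basis formed by `v` and `u`. -/
def basis : Module.Basis (Fin n ⊕ Fin n) 𝕜 V :=
  Module.Basis.mk h.linearIndependent <| by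
    rw [← h.span, Submodule.span_le]
    rintro _ (⟨j, hj, rfl⟩ | ⟨j, hj, rfl⟩)
    · exact Submodule.subset_span ⟨.inl ⟨j, hj⟩, rfl⟩
    · exact Submodule.subset_span ⟨.inr ⟨j, hj⟩, rfl⟩

omit [IsScalarTower 𝕜 (H 𝕜 m n ξ) V] in
theorem basis_inl (j : Fin n) : h.basis (.inl j) = v j := Module.Basis.mk_apply _ _ _

omit [IsScalarTower 𝕜 (H 𝕜 m n ξ) V] in
theorem basis_inr (j : Fin n) : h.basis (.inr j) = u j := Module.Basis.mk_apply _ _ _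

omit [IsScalarTower 𝕜 (H 𝕜 m n ξ) V] in
theorem finrank_eq : Module.finrank 𝕜 V = 2 * n := by
  rw [Module.finrank_eq_card_basis h.basis, Fintype.card_sum, Fintype.card_fin, two_mul]

variable (hm : 1 < m) (hn : 1 < n) (hξ : IsPrimitiveRoot ξ (m * n))
include hm hn hξ

theorem exists_section : ∃ ψ : V →ₗ[H 𝕜 m n ξ] H 𝕜 m n ξ, ∀ x, ψ x • v (n - 1) = x := by
  have h1 := h.one_le
  have h2 := h.lt
  have hξ0 : ξ ≠ 0 := hξ.ne_zero (by positivity)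
  have hq := Rels.isPrimitiveRoot_q hm hn hξ
  have hB : hb • v (n - 1) = ((ξ ^ m) ^ i) • v (n - 1) := by
    rw [h.hb_v _ (by omega), Nat.cast_sub hn.le]
    congr 2
    push_cast
    ring
  have hC : hc • v (n - 1) = (ξ ^ (i + ((l - 1 : ℕ) : ℤ))) • v (n - 1) := by
    rw [h.hc_v _ (by omega), Nat.cast_sub hn.le, Nat.cast_sub h1]
    congr 2
    push_cast
    ring
  obtain ⟨S, w, hfin, hdim, hwS, hw⟩ := exists_left_ideal hm hn hξ h1 h2
    (by rw [← zpow_natCast, ← zpow_mul, mul_comm, zpow_mul, zpow_natCast, hq.pow_eq_one, one_zpow])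
    (by rw [← zpow_natCast, ← zpow_mul, mul_comm, zpow_mul, zpow_natCast,
      zpow_add₀ (pow_ne_zero _ hξ0), zpow_natCast])
    hB hC (h.casH_casH hm hn hξ _)
  let φ : S →ₗ[H 𝕜 m n ξ] V :=
    (LinearMap.toSpanSingleton (H 𝕜 m n ξ) V (v (n - 1))) ∘ₗ S.subtype
  have hφ : ∀ s : S, φ s = (s : H 𝕜 m n ξ) • v (n - 1) := fun s => rfl
  have hsurj : Function.Surjective φ := by
    rw [← LinearMap.range_eq_top]
    exact h.eq_top_of_v_last_mem hm hn hξ ⟨⟨w, hwS⟩, hw⟩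
  have hfd : FiniteDimensional 𝕜 V := h.basis.finiteDimensional_of_finite
  have hinj : Function.Injective φ :=
    (LinearMap.injective_iff_surjective_of_finrank_eq_finrank (f := φ.restrictScalars 𝕜)
      (le_antisymm (hdim.trans h.finrank_eq.ge)
        (LinearMap.finrank_le_finrank_of_surjective (f := φ.restrictScalars 𝕜) hsurj))).2 hsurj
  let e := LinearEquiv.ofBijective φ ⟨hinj, hsurj⟩
  exact ⟨S.subtype ∘ₗ e.symm.toLinearMap, fun x => e.apply_symm_apply x⟩

theorem projective : Module.Projective (H 𝕜 m n ξ) V := by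
  obtain ⟨ψ, hψ⟩ := h.exists_section hm hn hξ
  exact Module.Projective.of_split ψ (LinearMap.toSpanSingleton (H 𝕜 m n ξ) V (v (n - 1)))
    (LinearMap.ext hψ)

theorem exists_right_ideal_functional : ∃ (S : Submodule 𝕜 (H 𝕜 m n ξ)) (η : V →ₗ[𝕜] 𝕜),
    (∀ s ∈ S, ∀ r, s * r ∈ S) ∧
      ∀ θ : S →ₗ[𝕜] 𝕜, ∃! p : V, ∀ s : S, η ((s : H 𝕜 m n ξ) • p) = θ s := by
  have h1 := h.one_le
  have h2 := h.lt
  have hξ0 : ξ ≠ 0 := hξ.ne_zero (by positivity)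
  have hq := Rels.isPrimitiveRoot_q hm hn hξ
  have hq0 := hq.ne_zero (by omega)
  let η : V →ₗ[𝕜] 𝕜 := h.basis.coord (.inr ⟨0, by omega⟩)
  have hηv : ∀ j, j < n → η (v j) = 0 := fun j hj => by
    rw [← h.basis_inl ⟨j, hj⟩, Module.Basis.coord_apply, Module.Basis.repr_self,
      Finsupp.single_apply, if_neg (by simp)]
  have hηu : ∀ j, j < n → j ≠ 0 → η (u j) = 0 := fun j hj hj0 => by
    rw [← h.basis_inr ⟨j, hj⟩, Module.Basis.coord_apply, Module.Basis.repr_self,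
      Finsupp.single_apply, if_neg (by simpa using hj0)]
  have hηu0 : η (u 0) = 1 := by
    have := h.basis_inr ⟨0, by omega⟩
    simp only at this
    rw [← this, Module.Basis.coord_apply, Module.Basis.repr_self, Finsupp.single_eq_same]
  have hB : ∀ x, η (hb • x) = (ξ ^ m) ^ (i + ((l : ℤ) - 1)) * η x := by
    have : spanLT 𝕜 v u n n ≤ LinearMap.eqLocus (η ∘ₗ Algebra.lsmul 𝕜 𝕜 V hb)
        ((ξ ^ m) ^ (i + ((l : ℤ) - 1)) • η) := by
      refine spanLT_le (fun j hj => ?_) fun j hj => ?_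
      · show η (hb • v j) = ((ξ ^ m) ^ (i + ((l : ℤ) - 1)) : 𝕜) • η (v j)
        rw [h.hb_v j hj, map_smul, hηv j hj, smul_zero, smul_zero]
      · show η (hb • u j) = ((ξ ^ m) ^ (i + ((l : ℤ) - 1)) : 𝕜) • η (u j)
        rw [h.hb_u j hj, map_smul]
        rcases eq_or_ne j 0 with rfl | hj0
        · congr 2
          push_cast
          ring
        · rw [hηu j hj hj0, smul_zero, smul_zero]
    exact fun x => this (h.mem_spanLT x)
  have hC : ∀ x, η (hc • x) = ξ ^ i * η x := by
    have : spanLT 𝕜 v u n n ≤ LinearMap.eqLocus (η ∘ₗ Algebra.lsmul 𝕜 𝕜 V hc)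
        (ξ ^ i • η) := by
      refine spanLT_le (fun j hj => ?_) fun j hj => ?_
      · show η (hc • v j) = (ξ ^ i : 𝕜) • η (v j)
        rw [h.hc_v j hj, map_smul, hηv j hj, smul_zero, smul_zero]
      · show η (hc • u j) = (ξ ^ i : 𝕜) • η (u j)
        rw [h.hc_u j hj, map_smul]
        rcases eq_or_ne j 0 with rfl | hj0
        · rw [Nat.cast_zero, add_zero]
        · rw [hηu j hj hj0, smul_zero, smul_zero]
    exact fun x => this (h.mem_spanLT x)
  obtain ⟨S, w, hfin, hdim, hwS, hS, hw⟩ := exists_right_ideal hm hn hξ h1 h2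
    (by rw [← zpow_natCast, ← zpow_mul, mul_comm, zpow_mul, zpow_natCast, hq.pow_eq_one, one_zpow])
    (by rw [← zpow_natCast, ← zpow_mul, mul_comm i, zpow_mul, zpow_natCast,
      ← zpow_natCast _ (l - 1), ← zpow_add₀ hq0, Nat.cast_sub h1, Nat.cast_one])
    hB hC (κ := kap (ξ ^ m) ((ξ ^ m) ^ i) l 0)
    (by
      simp only [kap, neg_zero, zpow_zero, add_zero, inv_zpow', mul_neg, mul_add, mul_one,
        ← zpow_add₀ hq0, ← zpow_one_add₀ hq0]
      ring_nf)
    (h.casH_casH hm hn hξ)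
  refine ⟨S, η, hS, ?_⟩
  let Φ : V →ₗ[𝕜] (S →ₗ[𝕜] 𝕜) := LinearMap.mk₂ 𝕜 (fun x (s : S) => η ((s : H 𝕜 m n ξ) • x))
    (fun x y s => by rw [smul_add, map_add]) (fun c x s => by rw [smul_comm, map_smul])
    (fun x s t => by rw [Submodule.coe_add, add_smul, map_add])
    (fun c x s => by rw [Submodule.coe_smul, smul_assoc, map_smul])
  have hΦ : ∀ x (s : S), Φ x s = η ((s : H 𝕜 m n ξ) • x) := fun x s => rfl
  have hinj : Function.Injective Φ := by
    let K : Submodule (H 𝕜 m n ξ) V :=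
      { Φ.ker.toAddSubmonoid with
        smul_mem' := fun r x hx => by
          refine LinearMap.mem_ker.2 (LinearMap.ext fun s => ?_)
          rw [hΦ, ← mul_smul]
          exact LinearMap.congr_fun (LinearMap.mem_ker.1 hx) ⟨_, hS s s.2 r⟩ }
    have hK : K = ⊥ := by
      by_contra hK
      have h3 : u 0 ∈ K := h.subU'_le hm hn hξ hK (u_mem h1)
      have h4 : Φ (u 0) ⟨w, hwS⟩ = 0 := LinearMap.congr_fun (LinearMap.mem_ker.1 h3) _
      rw [hΦ, hw, hηu0] at h4
      exact one_ne_zero h4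
    rw [← LinearMap.ker_eq_bot, eq_bot_iff]
    intro x hx
    have h5 : x ∈ K := hx
    rwa [hK] at h5
  have hfd : FiniteDimensional 𝕜 V := h.basis.finiteDimensional_of_finite
  have hsurj : Function.Surjective Φ :=
    (LinearMap.injective_iff_surjective_of_finrank_eq_finrank
      (le_antisymm (LinearMap.finrank_le_finrank_of_injective hinj)
        ((Subspace.dual_finrank_eq (K := 𝕜) (V := S)).le.trans (hdim.trans h.finrank_eq.ge)))).1
      hinj
  intro θ
  obtain ⟨p, rfl⟩ := hsurj θ
  exact ⟨p, fun s => rfl, fun p' hp' => hinj (LinearMap.ext hp')⟩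

theorem injective : Module.Injective (H 𝕜 m n ξ) V := by
  obtain ⟨S, η, hS, hex⟩ := h.exists_right_ideal_functional hm hn hξ
  refine Module.Baer.injective fun I g => ?_
  obtain ⟨θ, hθ⟩ := LinearMap.exists_extend (p := I.restrictScalars 𝕜)
    (η ∘ₗ (g.restrictScalars 𝕜 : I.restrictScalars 𝕜 →ₗ[𝕜] V))
  obtain ⟨p, hp, -⟩ := hex (θ ∘ₗ S.subtype)
  refine ⟨LinearMap.toSpanSingleton (H 𝕜 m n ξ) V p, fun x hx => ?_⟩
  have key : ∀ r (hr : r ∈ I), θ r = η (g ⟨r, hr⟩) := fun r hr =>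
    LinearMap.congr_fun hθ ⟨r, hr⟩
  obtain ⟨p', -, huniq⟩ := hex (θ ∘ₗ LinearMap.mulRight 𝕜 x ∘ₗ S.subtype)
  refine (huniq _ fun s => ?_).trans (huniq _ fun s => ?_).symm
  · rw [LinearMap.toSpanSingleton_apply, ← mul_smul]
    exact hp ⟨_, hS s s.2 x⟩
  · rw [← map_smul]
    exact (key (s * x) (I.mul_mem_left _ hx)).symm

end IsStd

end ProjInj

section Radical

variable {𝕜 m n ξ}
variable {V : Type} [AddCommGroup V] [Module 𝕜 V] [Module (H 𝕜 m n ξ) V]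
  [IsScalarTower 𝕜 (H 𝕜 m n ξ) V]

namespace IsStd

variable {l : ℕ} {i : ℤ} {v u : ℕ → V} (h : IsStd 𝕜 m n ξ l i v u)
variable (hm : 1 < m) (hn : 1 < n) (hξ : IsPrimitiveRoot ξ (m * n))
include h hm hn hξ

theorem eq_top_of_not_le {X : Submodule (H 𝕜 m n ξ) V} (hX : ¬X ≤ h.subUV hm hn hξ) : X = ⊤ := by
  have h1 := h.one_le
  have h2 := h.lt
  have hq := Rels.isPrimitiveRoot_q hm hn hξ
  have hco := covBy_top_iff.1 (h.subUV_covBy hm hn hξ)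
  have hsup : h.subUV hm hn hξ ⊔ X = ⊤ := hco.2 _ (left_lt_sup.2 hX)
  have hsurj : Function.Surjective ((h.subUV hm hn hξ).mkQ ∘ₗ X.subtype) := fun y => by
    obtain ⟨x, rfl⟩ := (h.subUV hm hn hξ).mkQ_surjective y
    obtain ⟨a, ha', b, hb', rfl⟩ := Submodule.mem_sup.1 (hsup ▸ Submodule.mem_top (x := x))
    refine ⟨⟨b, hb'⟩, ?_⟩
    have ha0 : (h.subUV hm hn hξ).mkQ a = 0 := (Submodule.Quotient.mk_eq_zero _).2 ha'
    rw [map_add, ha0, zero_add]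
    rfl
  have := h.projective hm hn hξ
  obtain ⟨g, hg⟩ := Module.projective_lifting_property _ (h.subUV hm hn hξ).mkQ hsurj
  let f : V →ₗ[H 𝕜 m n ξ] V := X.subtype ∘ₗ g
  have hf : ∀ x, f x - x ∈ h.subUV hm hn hξ := fun x => by
    rw [← Submodule.Quotient.mk_eq_zero, Submodule.Quotient.mk_sub, sub_eq_zero]
    exact LinearMap.congr_fun hg x
  have hu : f (u (l - 1)) = u (l - 1) := by
    have e1 := h.casH_of_mem hm hn hξ (hf (v (n - 1)))
    have e2 : f ((ξ ^ m - 1) • u (l - 1)) = (ξ ^ m - 1) • f (u (l - 1)) :=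
      (f.restrictScalars 𝕜).map_smul _ _
    have e3 : f (kap (ξ ^ m) ((ξ ^ m) ^ i) l 0 • v (n - 1)) =
        kap (ξ ^ m) ((ξ ^ m) ^ i) l 0 • f (v (n - 1)) := (f.restrictScalars 𝕜).map_smul _ _
    rw [smul_sub, ← map_smul, h.casH_v_last hm hn hξ, map_add, e2, e3] at e1
    refine smul_right_injective V (sub_ne_zero.2 (hq.ne_one hn)) (sub_eq_zero.1 ?_)
    rw [smul_sub] at e1
    rw [← sub_eq_zero] at e1
    rw [← e1]
    abel
  have hinj : Function.Injective f := by
    rw [← LinearMap.ker_eq_bot]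
    by_contra hk
    have e1 : f (u (l - 1)) = 0 := h.subU'_le hm hn hξ hk (u_mem (by omega))
    rw [hu] at e1
    exact h.u_notMem (a := 0) (b := l - 1) (Nat.zero_le _) (by omega)
      (by rw [e1]; exact Submodule.zero_mem _)
  have hfd : FiniteDimensional 𝕜 V := h.basis.finiteDimensional_of_finite
  have hfs : Function.Surjective f :=
    (LinearMap.injective_iff_surjective (f := f.restrictScalars 𝕜)).1 hinj
  refine eq_top_iff.2 fun x _ => ?_
  obtain ⟨y, rfl⟩ := hfs x
  exact (g y).2

theorem jacobson_eq : Module.jacobson (H 𝕜 m n ξ) V = h.subUV hm hn hξ := by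
  have hco := covBy_top_iff.1 (h.subUV_covBy hm hn hξ)
  refine le_antisymm (sInf_le hco) (le_sInf fun X hX => ?_)
  have hle : X ≤ h.subUV hm hn hξ := by
    by_contra hle
    exact hX.1 (h.eq_top_of_not_le hm hn hξ hle)
  by_contra hne
  exact hco.1 (hX.2 _ (lt_of_le_not_ge hle hne))

theorem exists_jrad_smul_eq {x : V} (hx : x ∈ h.subUV hm hn hξ) :
    ∃ r ∈ jrad 𝕜 m n ξ, r • v (n - 1) = x := by
  obtain ⟨ψ, hψ⟩ := h.exists_section hm hn hξ
  rw [← h.jacobson_eq hm hn hξ] at hx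
  refine ⟨ψ x, ?_, hψ x⟩
  rw [jrad, Ideal.jacobson_bot]
  exact Module.le_comap_jacobson ψ hx

theorem jrad_smul_mem_subUV {r : H 𝕜 m n ξ} (hr : r ∈ jrad 𝕜 m n ξ) (x : V) :
    r • x ∈ h.subUV hm hn hξ := by
  have := (h.isString_mkQ_v' hm hn hξ).isSimpleModule hm hn hξ h.lt h.one_le
    (h.mkQ_v_ne_zero' hm hn hξ)
  rw [← Submodule.Quotient.mk_eq_zero, Submodule.Quotient.mk_smul]
  refine jrad_smul_eq_zero (N := (h.isString_mkQ_v' hm hn hξ).toSubmodule) hr ?_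
  rw [h.toSubmodule_mkQ_v' hm hn hξ]
  exact Submodule.mem_top

theorem jrad_smul_mem_subU' {r : H 𝕜 m n ξ} (hr : r ∈ jrad 𝕜 m n ξ) {x : V}
    (hx : x ∈ h.subUV hm hn hξ) : r • x ∈ h.subU' := by
  have h1 := h.one_le
  have h2 := h.lt
  have i1 := (h.isString_mkQ_v hm hn hξ).isSimpleModule hm hn hξ (by omega) (by omega)
    h.mkQ_v_ne_zero
  have i2 := (h.isString_mkQ_u hm hn hξ).isSimpleModule hm hn hξ (by omega) (by omega)
    h.mkQ_u_ne_zero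
  have : spanLT 𝕜 v u (n - l) n ≤
      (h.subU'.restrictScalars 𝕜).comap (Algebra.lsmul 𝕜 𝕜 V r) := by
    refine spanLT_le (fun j hj => ?_) fun j hj => ?_
    · show r • v j ∈ h.subU'
      rw [← Submodule.Quotient.mk_eq_zero, Submodule.Quotient.mk_smul]
      exact jrad_smul_eq_zero hr ((h.isString_mkQ_v hm hn hξ).apply_mem hj)
    · show r • u j ∈ h.subU'
      rcases Nat.lt_or_ge j l with h3 | h3
      · exact h.subU'.smul_mem r (u_mem h3)
      · obtain ⟨j, rfl⟩ := Nat.exists_eq_add_of_le h3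
        rw [← Submodule.Quotient.mk_eq_zero, Submodule.Quotient.mk_smul]
        exact jrad_smul_eq_zero hr ((h.isString_mkQ_u hm hn hξ).apply_mem (by omega))
  exact this hx

theorem jrad_smul_eq_zero_of_mem {r : H 𝕜 m n ξ} (hr : r ∈ jrad 𝕜 m n ξ) {x : V}
    (hx : x ∈ h.subU') : r • x = 0 := by
  have := h.subU'_isSimple hm hn hξ
  exact jrad_smul_eq_zero hr hx

theorem radM_eq : radM 𝕜 m n ξ V = h.subUV hm hn hξ := by
  refine le_antisymm (Submodule.span_le.2 ?_) fun x hx => ?_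
  · rintro _ ⟨r, hr, w, rfl⟩
    exact h.jrad_smul_mem_subUV hm hn hξ hr w
  · obtain ⟨r, hr, rfl⟩ := h.exists_jrad_smul_eq hm hn hξ hx
    exact Submodule.subset_span ⟨r, hr, _, rfl⟩

theorem rad3M_eq : rad3M 𝕜 m n ξ V = ⊥ := by
  refine eq_bot_iff.2 (Submodule.span_le.2 ?_)
  rintro _ ⟨r, hr, s, hs, t, ht, w, rfl⟩
  exact h.jrad_smul_eq_zero_of_mem hm hn hξ hr (h.jrad_smul_mem_subU' hm hn hξ hs
    (h.jrad_smul_mem_subUV hm hn hξ ht w))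

theorem exists_left_ideal_u_last : ∃ (S : Submodule (H 𝕜 m n ξ) (H 𝕜 m n ξ)) (w : H 𝕜 m n ξ),
    FiniteDimensional 𝕜 S ∧ w ∈ S ∧ w • u (n - 1) = u (n - 1) := by
  have h1 := h.one_le
  have h2 := h.lt
  have hξ0 : ξ ≠ 0 := hξ.ne_zero (by positivity)
  have hq := Rels.isPrimitiveRoot_q hm hn hξ
  have hq0 := hq.ne_zero (by omega)
  have hκ : kap (ξ ^ m) ((ξ ^ m) ^ (i + l)) ((n - l : ℕ) : ℤ) 0 =
      kap (ξ ^ m) ((ξ ^ m) ^ i) l 0 := by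
    rw [kap, kap, Nat.cast_sub h2.le, neg_zero, zpow_zero, mul_add, mul_add, ← zpow_add₀ hq0,
      ← zpow_add₀ hq0, show i + l + ((n : ℤ) - l + 0) = i + n by ring, q_zpow_add_n hm hn hξ,
      add_zero, mul_one, mul_one, add_comm]
  obtain ⟨S, w, hfin, -, hwS, hw⟩ := exists_left_ideal hm hn hξ (l := n - l)
    (β := (ξ ^ m) ^ (i + l)) (χ := ξ ^ (i + ((n - 1 : ℕ) : ℤ))) (x := u (n - 1))
    (by omega) (by omega)
    (by rw [← zpow_natCast, ← zpow_mul, mul_comm, zpow_mul, zpow_natCast, hq.pow_eq_one, one_zpow])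
    (by
      rw [← zpow_natCast, ← zpow_mul, mul_comm, zpow_mul, zpow_natCast, ← zpow_natCast _ (n - l - 1),
        ← zpow_add₀ hq0, Nat.cast_sub hn.le, Nat.cast_sub (by omega), Nat.cast_sub h2.le]
      congr 1
      push_cast
      ring)
    (by
      rw [h.hb_u _ (by omega), ← q_zpow_add_n hm hn hξ (i + l - _), Nat.cast_sub hn.le]
      congr 2
      push_cast
      ring)
    (h.hc_u _ (by omega))
    (by rw [hκ]; exact h.casH_casH hm hn hξ _)
  exact ⟨S, w, hfin, hwS, hw⟩

theorem exists_jrad_smul_u_last_ne_zero : ∃ r ∈ jrad 𝕜 m n ξ, r • u (n - 1) ≠ 0 := by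
  have h1 := h.one_le
  have h2 := h.lt
  by_contra! hcon
  obtain ⟨S, w, hfin, hwS, hw⟩ := h.exists_left_ideal_u_last hm hn hξ
  let φ : S →ₗ[H 𝕜 m n ξ] V :=
    (LinearMap.toSpanSingleton (H 𝕜 m n ξ) V (u (n - 1))) ∘ₗ S.subtype
  have hφ : Module.jacobson (H 𝕜 m n ξ) S ≤ φ.ker := fun s hs => by
    refine hcon s ?_
    rw [jrad, Ideal.jacobson_bot]
    exact Module.le_comap_jacobson S.subtype hs
  have : IsArtinian (H 𝕜 m n ξ) S := isArtinian_of_tower 𝕜 inferInstance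
  have hss : IsSemisimpleModule (H 𝕜 m n ξ) (S ⧸ Module.jacobson (H 𝕜 m n ξ) S) :=
    (IsArtinian.isSemisimpleModule_iff_jacobson _ _).2 (Module.jacobson_quotient_jacobson _ _)
  let f := Submodule.liftQ _ φ hφ
  have hss' := IsSemisimpleModule.range f
  have hu : u (n - 1) ∈ f.range := ⟨Submodule.Quotient.mk ⟨w, hwS⟩, hw⟩
  have hu0 : u (n - 1) ∉ h.subU' := fun e => by
    have : spanLT 𝕜 v u 0 l ≤ spanLT 𝕜 v u 0 (n - 1) :=
      spanLT_le (fun j hj => by omega) fun j hj => u_mem (by omega)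
    exact h.u_notMem (a := 0) (b := n - 1) (Nat.zero_le _) (by omega) (this e)
  obtain ⟨C, hC⟩ := exists_isCompl (h.subU'.comap f.range.subtype)
  have hC0 : C = ⊥ := by
    by_contra hC0
    have e1 : C.map f.range.subtype ≠ ⊥ := fun e =>
      hC0
        (Submodule.map_injective_of_injective Subtype.val_injective (e.trans (Submodule.map_bot _).symm))
    obtain ⟨c, hc', hcu⟩ := h.subU'_le hm hn hξ e1 (u_mem h1 : u 0 ∈ spanLT 𝕜 v u 0 l)
    have e2 : c ∈ h.subU'.comap f.range.subtype := by
      rw [Submodule.mem_comap, hcu]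
      exact (u_mem h1 : u 0 ∈ spanLT 𝕜 v u 0 l)
    have e3 := Submodule.disjoint_def.1 hC.disjoint c e2 hc'
    rw [e3, map_zero] at hcu
    exact h.u_zero_ne_zero hcu.symm
  have htop : h.subU'.comap f.range.subtype = ⊤ := by
    have := hC.sup_eq_top
    rwa [hC0, sup_bot_eq] at this
  have : (⟨u (n - 1), hu⟩ : f.range) ∈ h.subU'.comap f.range.subtype := htop ▸ Submodule.mem_top
  exact hu0 this

theorem rad2M_ne_bot : rad2M 𝕜 m n ξ V ≠ ⊥ := by
  obtain ⟨r, hr, hru⟩ := h.exists_jrad_smul_u_last_ne_zero hm hn hξ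
  have h2 := h.lt
  obtain ⟨s, hs, hsu⟩ := h.exists_jrad_smul_eq hm hn hξ
    (u_mem (by omega) : u (n - 1) ∈ spanLT 𝕜 v u (n - l) n)
  exact (Submodule.ne_bot_iff _).2
    ⟨r • u (n - 1), Submodule.subset_span ⟨r, hr, s, hs, _, by rw [hsu]⟩, hru⟩

theorem rad2M_eq : rad2M 𝕜 m n ξ V = h.subU' := by
  refine le_antisymm (Submodule.span_le.2 ?_) (h.subU'_le hm hn hξ (h.rad2M_ne_bot hm hn hξ))
  rintro _ ⟨r, hr, s, hs, w, rfl⟩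
  exact h.jrad_smul_mem_subU' hm hn hξ hr (h.jrad_smul_mem_subUV hm hn hξ hs w)

theorem socle_eq : socle 𝕜 m n ξ V = h.subU' := by
  refine le_antisymm (sSup_le fun N hN => ?_) (le_sSup (h.subU'_isSimple hm hn hξ))
  have hN' := isSimpleModule_iff_isAtom.1 hN
  have h1 := h.subU'_le hm hn hξ hN'.1
  exact ((hN'.le_iff.1 h1).resolve_left h.subU'_ne_bot).ge

theorem indec : Indec 𝕜 m n ξ V := by
  refine ⟨⟨u 0, 0, h.u_zero_ne_zero⟩, fun N₁ N₂ hN => ?_⟩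
  by_contra! hne
  exact h.subU'_ne_bot (le_bot_iff.1
    (hN.disjoint (h.subU'_le hm hn hξ hne.1) (h.subU'_le hm hn hξ hne.2)))

theorem lengthIs_four : lengthIs 𝕜 m n ξ V 4 := by
  let s : CompositionSeries (Submodule (H 𝕜 m n ξ) V) :=
    ⟨4, ![⊥, h.subU', h.subU, h.subUV hm hn hξ, ⊤], fun k => by
      fin_cases k
      · exact h.bot_covBy hm hn hξ
      · exact h.subU'_covBy hm hn hξ
      · exact h.subU_covBy hm hn hξ
      · exact h.subUV_covBy hm hn hξ⟩
  exact ⟨s, rfl, rfl, rfl⟩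

theorem exists_isMrep_socle : ∃ mv : Fin l → socle 𝕜 m n ξ V, IsMrep 𝕜 m n ξ l i mv := by
  rw [h.socle_eq hm hn hξ, h.subU'_eq]
  exact h.isString_u.exists_isMrep hm hn hξ h.lt h.one_le h.u_zero_ne_zero

theorem exists_isMrep_top :
    ∃ mv : Fin l → V ⧸ radM 𝕜 m n ξ V, IsMrep 𝕜 m n ξ l i mv := by
  rw [h.radM_eq hm hn hξ]
  exact ⟨_, (h.isString_mkQ_v' hm hn hξ).isMrep hm hn hξ h.lt (h.mkQ_v_ne_zero' hm hn hξ)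
    (h.toSubmodule_mkQ_v' hm hn hξ)⟩

end IsStd

end Radical

section MiddleLayer

variable {𝕜 m n ξ}

theorem IsMrep.exists_linearEquiv {V W : Type} [AddCommGroup V] [Module 𝕜 V]
    [Module (H 𝕜 m n ξ) V] [IsScalarTower 𝕜 (H 𝕜 m n ξ) V] [AddCommGroup W] [Module 𝕜 W]
    [Module (H 𝕜 m n ξ) W] [IsScalarTower 𝕜 (H 𝕜 m n ξ) W] {l : ℕ} {i : ℤ} {mv : Fin l → V}
    {mw : Fin l → W} (hv : IsMrep 𝕜 m n ξ l i mv) (hw : IsMrep 𝕜 m n ξ l i mw) :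
    Nonempty (V ≃ₗ[H 𝕜 m n ξ] W) := by
  obtain ⟨v1, v2, v3, v4, v5, v6, v7, v8⟩ := hv
  obtain ⟨w1, w2, w3, w4, w5, w6, w7, w8⟩ := hw
  let e := (Module.Basis.mk v1 v2.ge).equiv (Module.Basis.mk w1 w2.ge) (Equiv.refl _)
  have he : ∀ j, e (mv j) = mw j := fun j => by
    have := (Module.Basis.mk v1 v2.ge).equiv_apply j (Module.Basis.mk w1 w2.ge) (Equiv.refl _)
    rwa [Module.Basis.mk_apply, Equiv.refl_apply, Module.Basis.mk_apply] at this
  have hg : ∀ k x, e (gen 𝕜 m n ξ k • x) = gen 𝕜 m n ξ k • e x := fun k => by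
    refine LinearMap.congr_fun (f := e.toLinearMap ∘ₗ Algebra.lsmul 𝕜 𝕜 V (gen 𝕜 m n ξ k))
      (g := Algebra.lsmul 𝕜 𝕜 W (gen 𝕜 m n ξ k) ∘ₗ e.toLinearMap)
      (LinearMap.ext_on v2 ?_)
    rintro _ ⟨⟨j, hj⟩, rfl⟩
    show e (gen 𝕜 m n ξ k • mv ⟨j, hj⟩) = gen 𝕜 m n ξ k • e (mv ⟨j, hj⟩)
    rw [he]
    fin_cases k
    · show e (ha • mv ⟨j, hj⟩) = ha • mw ⟨j, hj⟩
      rcases Nat.lt_or_ge (j + 1) l with h1 | h1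
      · rw [v3 j h1, w3 j h1, map_smul, he]
      · rw [v4 j hj (by omega), w4 j hj (by omega), map_zero]
    · show e (hb • mv ⟨j, hj⟩) = hb • mw ⟨j, hj⟩
      rw [v5, w5, map_smul, he]
    · show e (hc • mv ⟨j, hj⟩) = hc • mw ⟨j, hj⟩
      rw [v6, w6, map_smul, he]
    · show e (hd • mv ⟨j, hj⟩) = hd • mw ⟨j, hj⟩
      rcases j with _ | j
      · rw [v8, w8, map_zero]
      · rw [v7 j hj, w7 j hj, he]
  exact ⟨LinearEquiv.ofBijective (ofGenMap e.toLinearMap hg) e.bijective⟩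

namespace IsStd

variable {V : Type} [AddCommGroup V] [Module 𝕜 V] [Module (H 𝕜 m n ξ) V]
  [IsScalarTower 𝕜 (H 𝕜 m n ξ) V]
variable {l : ℕ} {i : ℤ} {v u : ℕ → V} (h : IsStd 𝕜 m n ξ l i v u)
variable (hm : 1 < m) (hn : 1 < n) (hξ : IsPrimitiveRoot ξ (m * n))
include h hm hn hξ

theorem exists_isCompl_middle :
    ∃ N₁ N₂ : Submodule (H 𝕜 m n ξ)
        (radM 𝕜 m n ξ V ⧸ (rad2M 𝕜 m n ξ V).comap (radM 𝕜 m n ξ V).subtype),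
      IsCompl N₁ N₂ ∧
      (∃ mv : Fin (n - l) → N₁, IsMrep 𝕜 m n ξ (n - l) (i + l - n) mv) ∧
      ∃ mv : Fin (n - l) → N₂, IsMrep 𝕜 m n ξ (n - l) (i + l) mv := by
  have h1 := h.one_le
  have h2 := h.lt
  rw [h.radM_eq hm hn hξ, h.rad2M_eq hm hn hξ]
  let f : (h.subUV hm hn hξ ⧸ h.subU'.comap (h.subUV hm hn hξ).subtype) →ₗ[H 𝕜 m n ξ]
      V ⧸ h.subU' := Submodule.mapQ _ _ (h.subUV hm hn hξ).subtype le_rfl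
  have hf : Function.Injective f := by
    rw [← LinearMap.ker_eq_bot, Submodule.ker_mapQ, Submodule.mkQ_map_self]
  have hmem : ∀ x (_ : x ∈ h.subUV hm hn hξ), h.subU'.mkQ x ∈ LinearMap.range f := fun x hx =>
    ⟨Submodule.Quotient.mk ⟨x, hx⟩, rfl⟩
  obtain ⟨e₁, he₁, hfe₁⟩ := (h.isString_mkQ_v hm hn hξ).exists_lift (by omega) hf
    fun j hj => hmem _ (v_mem hj : v j ∈ spanLT 𝕜 v u (n - l) n)
  obtain ⟨e₂, he₂, hfe₂⟩ := (h.isString_mkQ_u hm hn hξ).exists_lift (by omega) hf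
    fun j hj => hmem _ (u_mem (by omega) : u (l + j) ∈ spanLT 𝕜 v u (n - l) n)
  have h01 : e₁ 0 ≠ 0 := fun e => h.mkQ_v_ne_zero (by rw [← hfe₁ 0 (by omega), e, map_zero])
  have h02 : e₂ 0 ≠ 0 := fun e => h.mkQ_u_ne_zero (by rw [← hfe₂ 0 (by omega), e, map_zero])
  refine ⟨he₁.toSubmodule, he₂.toSubmodule, ⟨?_, ?_⟩,
    he₁.exists_isMrep hm hn hξ (by omega) (by omega) h01,
    he₂.exists_isMrep hm hn hξ (by omega) (by omega) h02⟩
  · refine IsAtom.disjoint_of_ne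
      (isSimpleModule_iff_isAtom.1 (he₁.isSimpleModule hm hn hξ (by omega) (by omega) h01))
      (isSimpleModule_iff_isAtom.1 (he₂.isSimpleModule hm hn hξ (by omega) (by omega) h02))
      fun e => ?_
    have e1 : e₁ 0 ∈ he₂.toSubmodule := e ▸ he₁.apply_mem (by omega)
    have e2 := he₂.toSubmodule_le (N := (h.isString_mkQ_u hm hn hξ).toSubmodule.comap f)
      (fun j hj => by
        rw [Submodule.mem_comap, hfe₂ j hj]
        exact (h.isString_mkQ_u hm hn hξ).apply_mem hj) e1
    rw [Submodule.mem_comap, hfe₁ 0 (by omega)] at e2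
    have e3 : v 0 ∈ h.subU := by
      rw [← h.comap_mkQ_u hm hn hξ]
      exact e2
    exact h.v_notMem (a := 0) (b := n) (by omega) le_rfl e3
  · rw [codisjoint_iff, eq_top_iff]
    intro x _
    have key : spanLT 𝕜 v u (n - l) n ≤ (((he₁.toSubmodule ⊔ he₂.toSubmodule).map f).comap
        h.subU'.mkQ).restrictScalars 𝕜 := by
      refine spanLT_le (fun j hj => ?_) fun j hj => ?_
      · exact ⟨e₁ j, Submodule.mem_sup_left (he₁.apply_mem hj), hfe₁ j hj⟩
      · rcases Nat.lt_or_ge j l with h3 | h3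
        · have e0 : h.subU'.mkQ (u j) = 0 :=
            (Submodule.Quotient.mk_eq_zero _).2 (u_mem h3 : u j ∈ spanLT 𝕜 v u 0 l)
          show h.subU'.mkQ (u j) ∈ (he₁.toSubmodule ⊔ he₂.toSubmodule).map f
          rw [e0]
          exact Submodule.zero_mem _
        · obtain ⟨j, rfl⟩ := Nat.exists_eq_add_of_le h3
          exact ⟨e₂ j, Submodule.mem_sup_right (he₂.apply_mem (by omega)), hfe₂ j (by omega)⟩
    obtain ⟨y, rfl⟩ := Submodule.mkQ_surjective _ x
    obtain ⟨z, hz, hzy⟩ := key y.2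
    have hzy' : f z = f (Submodule.mkQ _ y) := hzy
    rwa [← hf hzy']

theorem exists_projective_cover {W : Type} [AddCommGroup W] [Module 𝕜 W] [Module (H 𝕜 m n ξ) W]
    [IsScalarTower 𝕜 (H 𝕜 m n ξ) W] {mw : Fin l → W} (hw : IsMrep 𝕜 m n ξ l i mw) :
    ∃ f : V →ₗ[H 𝕜 m n ξ] W, Function.Surjective f ∧ LinearMap.ker f ≤ radM 𝕜 m n ξ V := by
  obtain ⟨mv, hv⟩ := h.exists_isMrep_top hm hn hξ
  obtain ⟨e⟩ := hv.exists_linearEquiv hw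
  refine ⟨e.toLinearMap ∘ₗ (radM 𝕜 m n ξ V).mkQ,
    e.surjective.comp (Submodule.mkQ_surjective _), ?_⟩
  rw [LinearEquiv.ker_comp, Submodule.ker_mkQ]

theorem exists_injective_envelope {W : Type} [AddCommGroup W] [Module 𝕜 W]
    [Module (H 𝕜 m n ξ) W] [IsScalarTower 𝕜 (H 𝕜 m n ξ) W] {mw : Fin l → W}
    (hw : IsMrep 𝕜 m n ξ l i mw) :
    ∃ g : W →ₗ[H 𝕜 m n ξ] V, Function.Injective g ∧
      ∀ N : Submodule (H 𝕜 m n ξ) V, Disjoint N (LinearMap.range g) → N = ⊥ := by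
  obtain ⟨mv, hv⟩ := h.exists_isMrep_socle hm hn hξ
  obtain ⟨e⟩ := hw.exists_linearEquiv hv
  refine ⟨(socle 𝕜 m n ξ V).subtype ∘ₗ e.toLinearMap,
    Subtype.val_injective.comp e.injective, fun N hN => ?_⟩
  rw [LinearEquiv.range_comp, Submodule.range_subtype, h.socle_eq hm hn hξ] at hN
  by_contra hne
  exact h.subU'_ne_bot (le_bot_iff.1 (hN (h.subU'_le hm hn hξ hne) le_rfl))

end IsStd

end MiddleLayer

/-- Proposition 3.8, Corollaries 3.10, 3.11 for `P(l,i)`: `P(l,i)` is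
indecomposable, projective and injective, has socle and top isomorphic to `M(l,i)`, Loewy
length 3, composition length 4, middle Loewy layer `M(n-l,i+l-n) ⊕ M(n-l,i+l)`, and is a
projective cover and injective envelope of `M(l,i)`. -/
theorem statement8 (𝕜 : Type) [Field 𝕜] [IsAlgClosed 𝕜] (m n : ℕ) (hm : 1 < m) (hn : 1 < n)
    (ξ : 𝕜) (hξ : IsPrimitiveRoot ξ (m * n))
    (l : ℕ) (hl1 : 1 ≤ l) (hl2 : l ≤ n - 1) (i : ℤ)
    (P : Type) [AddCommGroup P] [Module 𝕜 P] [Module (H 𝕜 m n ξ) P]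
    [IsScalarTower 𝕜 (H 𝕜 m n ξ) P]
    (v u : Fin n → P) (hP : IsPrep 𝕜 m n ξ l hl1 (by omega) i v u) :
    Indec 𝕜 m n ξ P ∧
    Module.Projective (H 𝕜 m n ξ) P ∧
    Module.Injective (H 𝕜 m n ξ) P ∧
    (∃ mv : Fin l → ↥(socle 𝕜 m n ξ P), IsMrep 𝕜 m n ξ l i mv) ∧
    (∃ mv : Fin l → (P ⧸ radM 𝕜 m n ξ P), IsMrep 𝕜 m n ξ l i mv) ∧
    rad2M 𝕜 m n ξ P ≠ ⊥ ∧ rad3M 𝕜 m n ξ P = ⊥ ∧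
    lengthIs 𝕜 m n ξ P 4 ∧
    (∃ N₁ N₂ : Submodule (H 𝕜 m n ξ)
        (↥(radM 𝕜 m n ξ P) ⧸ (rad2M 𝕜 m n ξ P).comap (radM 𝕜 m n ξ P).subtype),
      IsCompl N₁ N₂ ∧
      (∃ mv : Fin (n - l) → ↥N₁, IsMrep 𝕜 m n ξ (n - l) (i + l - n) mv) ∧
      (∃ mv : Fin (n - l) → ↥N₂, IsMrep 𝕜 m n ξ (n - l) (i + l) mv)) ∧
    (∀ (W : Type) [AddCommGroup W] [Module 𝕜 W] [Module (H 𝕜 m n ξ) W]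
        [IsScalarTower 𝕜 (H 𝕜 m n ξ) W] (mw : Fin l → W), IsMrep 𝕜 m n ξ l i mw →
      (∃ f : P →ₗ[H 𝕜 m n ξ] W, Function.Surjective f ∧
        LinearMap.ker f ≤ radM 𝕜 m n ξ P) ∧
      (∃ g : W →ₗ[H 𝕜 m n ξ] P, Function.Injective g ∧
        ∀ N : Submodule (H 𝕜 m n ξ) P, Disjoint N (LinearMap.range g) → N = ⊥)) := by
  obtain ⟨v', u', h⟩ := hP.exists_isStd
  refine ⟨h.indec hm hn hξ, h.projective hm hn hξ, h.injective hm hn hξ,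
    h.exists_isMrep_socle hm hn hξ, h.exists_isMrep_top hm hn hξ, h.rad2M_ne_bot hm hn hξ,
    h.rad3M_eq hm hn hξ, h.lengthIs_four hm hn hξ, h.exists_isCompl_middle hm hn hξ, ?_⟩
  intro W _ _ _ _ mw hw
  exact ⟨h.exists_projective_cover hm hn hξ hw, h.exists_injective_envelope hm hn hξ hw⟩

end Radford
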